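/- arXiv:0808.1199 — 3 statements merged into one kernel-verified Lean document; each statement's English description precedes it below -/
import Mathlib

section
/- For any embedding of the complete bipartite graph K₄,₄ into ℝ³, there exist two disjoint cycles whose images are linked (have nonzero mod 2 linking number) in ℝ³ (Sachs' theorem). -/
open Set

noncomputable section

/-- The point of `ℝ^V` corresponding to a vertex `v` of a graph. -/
def vert {V : Type*} [DecidableEq V] (v : V) : V → ℝ := fun i => if i = v then 1 else 0

/-- Geometric realization of a simple graph as a subset of `ℝ^V`:
the union of the straight segments joining the standard points of adjacent vertices. -/
def graphRealization {V : Type*} [DecidableEq V] (G : SimpleGraph V) : Set (V → ℝ) :=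
  ⋃ p : {p : V × V // G.Adj p.1 p.2}, segment ℝ (vert p.1.1) (vert p.1.2)

/-- A (compact) polyhedron: a finite union of polytopes (convex hulls of finite sets). -/
def IsPolyhedron {E : Type*} [AddCommGroup E] [Module ℝ E] (s : Set E) : Prop :=
  ∃ T : Set (Set E), T.Finite ∧ (∀ P ∈ T, ∃ Q : Set E, Q.Finite ∧ P = convexHull ℝ Q) ∧
    s = ⋃₀ T

/-- `f` is piecewise linear (PL) on `s`: there is a finite family of polytopes covering `s`
on each of which `f` coincides with an affine map. -/
def IsPLOn {E F : Type*} [AddCommGroup E] [Module ℝ E] [AddCommGroup F] [Module ℝ F]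
    (f : E → F) (s : Set E) : Prop :=
  ∃ T : Set (Set E), T.Finite ∧ (∀ P ∈ T, ∃ Q : Set E, Q.Finite ∧ P = convexHull ℝ Q) ∧
    s ⊆ ⋃₀ T ∧ ∀ P ∈ T, ∃ g : E →ᵃ[ℝ] F, EqOn f g (P ∩ s)

/-- The cone over a set `A` with apex `p` (union of segments from `p` to points of `A`). -/
def coneFrom {E : Type*} [AddCommGroup E] [Module ℝ E] (p : E) (A : Set E) : Set E :=
  ⋃ x ∈ A, segment ℝ p x

/-- Mod 2 linking of two disjoint closed curves `A`, `B` in `ℝ³`: for a dense (hence generic)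
set of apexes `p`, the 2-chain `coneFrom p A` bounding `A` meets `B` in an odd finite number
of points.  For PL curves in general position this is the mod 2 linking number being 1. -/
def LinkedMod2Curves (A B : Set (Fin 3 → ℝ)) : Prop :=
  Dense {p : Fin 3 → ℝ | (coneFrom p A ∩ B).Finite ∧ Odd (coneFrom p A ∩ B).ncard}

/-- The subset of the realization of `G` traced out by (the edges of) a closed walk. -/
def cycleSet {V : Type*} [DecidableEq V] {G : SimpleGraph V} {v : V} (c : G.Walk v v) :
    Set (V → ℝ) :=
  ⋃ p : {p : V × V // s(p.1, p.2) ∈ c.edges}, segment ℝ (vert p.1.1) (vert p.1.2)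

/-- The indicator of a proposition, with values in `ZMod 2`. -/
def ind (q : Prop) : ZMod 2 :=
  open Classical in if q then 1 else 0

theorem ind_of {q : Prop} (h : q) : ind q = 1 := if_pos h

theorem ind_of_not {q : Prop} (h : ¬q) : ind q = 0 := if_neg h

theorem ind_congr {q r : Prop} (h : q ↔ r) : ind q = ind r := by rw [propext h]

theorem ind_add_ind_not (q : Prop) : ind q + ind (¬q) = 1 := by
  by_cases h : q
  · rw [ind_of h, ind_of_not (not_not.2 h), add_zero]
  · rw [ind_of_not h, ind_of h, zero_add]

theorem zmod_two_add_self (a : ZMod 2) : a + a = 0 := CharTwo.add_self_eq_zero a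

/-- The entry half of the parity count for the intersection of a segment with a region cut out by
affine inequalities. -/
theorem sum_ind_entering {ι : Type*} [Fintype ι] (u v : ι → ℝ)
    (h0 : (∀ i, 0 ≤ u i) → ∀ i, 0 < u i)
    (h2 : ∀ t ∈ Icc (0 : ℝ) 1, (∀ i, 0 ≤ u i + t * v i) →
      ∀ i j, u i + t * v i = 0 → u j + t * v j = 0 → i = j)
    (hne : ∃ t ∈ Icc (0 : ℝ) 1, ∀ i, 0 ≤ u i + t * v i) :
    (∑ i, ind ((∃ t ∈ Icc (0 : ℝ) 1, u i + t * v i = 0 ∧ ∀ j, 0 ≤ u j + t * v j) ∧ 0 < v i) =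
      1 + ind (∀ i, 0 ≤ u i)) ∧
    ∀ i, (∃ t ∈ Icc (0 : ℝ) 1, u i + t * v i = 0 ∧ ∀ j, 0 ≤ u j + t * v j) → v i ≠ 0 := by
  classical
  set I : Set ℝ := {t | t ∈ Icc (0 : ℝ) 1 ∧ ∀ i, 0 ≤ u i + t * v i} with hI
  have hIc : IsCompact I := by
    have : I = Icc (0 : ℝ) 1 ∩ ⋂ i, {t | 0 ≤ u i + t * v i} := by
      ext t; simp [hI]
    rw [this]
    refine isCompact_Icc.inter_right (isClosed_iInter fun i => ?_)
    exact isClosed_le continuous_const (by fun_prop)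
  obtain ⟨t₀, ht₀, ht₀'⟩ := hne
  obtain ⟨c, hcI, hcmin⟩ := hIc.exists_isLeast ⟨t₀, ht₀, ht₀'⟩
  have hentry : 0 < c → ∃ i, u i + c * v i = 0 ∧ 0 < v i := by
    intro hc
    by_contra! hno
    have hev : ∀ᶠ t in nhdsWithin c (Iio c), ∀ i, 0 ≤ u i + t * v i := by
      rw [Filter.eventually_all]
      intro i
      rcases (hcI.2 i).eq_or_lt with h | h
      · filter_upwards [self_mem_nhdsWithin] with t ht
        have := hno i h.symm
        have ht : t < c := ht
        nlinarith
      · have : Filter.Tendsto (fun t : ℝ => u i + t * v i) (nhds c) (nhds (u i + c * v i)) := by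
          apply Continuous.tendsto; fun_prop
        exact nhdsWithin_le_nhds ((this.eventually_const_lt h).mono fun t ht => ht.le)
    have hev2 : ∀ᶠ t in nhdsWithin c (Iio c), t ∈ Ioo 0 c := Ioo_mem_nhdsLT hc
    obtain ⟨t, h1, h3⟩ := (hev.and hev2).exists
    have : c ≤ t := hcmin ⟨⟨h3.1.le, h3.2.le.trans hcI.1.2⟩, h1⟩
    exact absurd h3.2 (not_lt.2 this)
  have hc0 : (∀ i, 0 ≤ u i) ↔ c = 0 := by
    constructor
    · intro h
      exact le_antisymm (hcmin ⟨⟨le_rfl, zero_le_one⟩, by simpa using h⟩) hcI.1.1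
    · intro h i
      simpa [h] using hcI.2 i
  have hcpos : c ≠ 0 → 0 < c := fun h => lt_of_le_of_ne hcI.1.1 (Ne.symm h)
  have hit : ∀ i t, t ∈ I → u i + t * v i = 0 → 0 < v i → t = c := by
    intro i t ht h hv
    refine le_antisymm ?_ (hcmin ht)
    have := hcI.2 i
    by_contra! hlt
    nlinarith
  refine ⟨?_, ?_⟩
  · by_cases hc : c = 0
    · rw [ind_of (hc0.2 hc)]
      rw [Finset.sum_eq_zero]
      · rfl
      · rintro i -
        apply ind_of_not
        rintro ⟨⟨t, ht, h, h'⟩, hv⟩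
        have := hit i t ⟨ht, h'⟩ h hv
        subst this
        have h0i := h0 (hc0.2 hc) i
        rw [hc] at h
        simp at h
        exact h0i.ne' h
    · rw [ind_of_not (fun h => hc (hc0.1 h))]
      obtain ⟨i₀, hi₀, hv₀⟩ := hentry (hcpos hc)
      rw [Finset.sum_eq_single i₀]
      · rw [ind_of ⟨⟨c, hcI.1, hi₀, hcI.2⟩, hv₀⟩, add_zero]
      · rintro i - hi
        apply ind_of_not
        rintro ⟨⟨t, ht, h, h'⟩, hv⟩
        have := hit i t ⟨ht, h'⟩ h hv
        subst this
        exact hi (h2 t ht h' i i₀ h hi₀)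
      · simp
  · rintro i ⟨t, ht, h, h'⟩ hv
    have hu : u i = 0 := by simpa [hv] using h
    by_cases hc : c = 0
    · exact (h0 (hc0.2 hc) i).ne' hu
    · obtain ⟨i₀, hi₀, hv₀⟩ := hentry (hcpos hc)
      have := h2 c hcI.1 hcI.2 i i₀ (by simp [hu, hv]) hi₀
      subst this
      exact hv₀.ne' hv

/-- A segment in general position meets the boundary of a region cut out by affine inequalities
in as many faces, modulo `2`, as it has endpoints in the region. -/
theorem sum_ind_face {ι : Type*} [Fintype ι] (u v : ι → ℝ)
    (h0 : (∀ i, 0 ≤ u i) → ∀ i, 0 < u i)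
    (h1 : (∀ i, 0 ≤ u i + v i) → ∀ i, 0 < u i + v i)
    (h2 : ∀ t ∈ Icc (0 : ℝ) 1, (∀ i, 0 ≤ u i + t * v i) →
      ∀ i j, u i + t * v i = 0 → u j + t * v j = 0 → i = j) :
    ∑ i, ind (∃ t ∈ Icc (0 : ℝ) 1, u i + t * v i = 0 ∧ ∀ j, 0 ≤ u j + t * v j) =
      ind (∀ i, 0 ≤ u i) + ind (∀ i, 0 ≤ u i + v i) := by
  by_cases hne : ∃ t ∈ Icc (0 : ℝ) 1, ∀ i, 0 ≤ u i + t * v i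
  · obtain ⟨hpos, hnz⟩ := sum_ind_entering u v h0 h2 hne
    have key : ∀ (s : ℝ) (i : ι), (u i + v i) + (1 - s) * -v i = u i + s * v i :=
      fun s i => by ring
    have flip : ∀ q : ℝ → Prop, (∃ t ∈ Icc (0 : ℝ) 1, q t) ↔ ∃ t ∈ Icc (0 : ℝ) 1, q (1 - t) := by
      intro q
      constructor
      · rintro ⟨t, ht, hq⟩
        exact ⟨1 - t, ⟨by linarith [ht.2], by linarith [ht.1]⟩, by simpa using hq⟩
      · rintro ⟨t, ht, hq⟩
        exact ⟨1 - t, ⟨by linarith [ht.2], by linarith [ht.1]⟩, hq⟩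
    obtain ⟨hneg, -⟩ := sum_ind_entering (fun i => u i + v i) (fun i => -v i) h1
      (by
        intro t ht h i j hi hj
        refine h2 (1 - t) ⟨by linarith [ht.2], by linarith [ht.1]⟩ (fun k => ?_) i j ?_ ?_
        · have := h k; nlinarith
        · linarith
        · linarith)
      (by
        rw [flip]
        simpa only [key] using hne)
    have hsplit : ∀ i, ind (∃ t ∈ Icc (0 : ℝ) 1, u i + t * v i = 0 ∧ ∀ j, 0 ≤ u j + t * v j) =
        ind ((∃ t ∈ Icc (0 : ℝ) 1, u i + t * v i = 0 ∧ ∀ j, 0 ≤ u j + t * v j) ∧ 0 < v i) +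
        ind ((∃ t ∈ Icc (0 : ℝ) 1, (u i + v i) + t * -v i = 0 ∧
          ∀ j, 0 ≤ (u j + v j) + t * -v j) ∧ 0 < -v i) := by
      intro i
      rw [flip (fun t => (u i + v i) + t * -v i = 0 ∧ ∀ j, 0 ≤ (u j + v j) + t * -v j)]
      simp only [key]
      by_cases hq : ∃ t ∈ Icc (0 : ℝ) 1, u i + t * v i = 0 ∧ ∀ j, 0 ≤ u j + t * v j
      · rw [ind_of hq]
        rcases lt_or_gt_of_ne (hnz i hq) with hv | hv
        · rw [ind_of_not (by rintro ⟨-, h⟩; linarith), ind_of ⟨hq, by linarith⟩, zero_add]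
        · rw [ind_of ⟨hq, hv⟩, ind_of_not (by rintro ⟨-, h⟩; linarith), add_zero]
      · rw [ind_of_not hq, ind_of_not (fun h => hq h.1), ind_of_not (fun h => hq h.1), add_zero]
    rw [Finset.sum_congr rfl fun i _ => hsplit i, Finset.sum_add_distrib, hpos, hneg]
    generalize ind _ = a
    generalize ind _ = b
    revert a b; decide
  · rw [ind_of_not (fun h => hne ⟨0, by simp, by simpa using h⟩),
      ind_of_not (fun h => hne ⟨1, by simp, by simpa using h⟩), Finset.sum_eq_zero]
    · simp
    · rintro i -
      exact ind_of_not fun ⟨t, ht, _, h⟩ => hne ⟨t, ht, h⟩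

/-- A point is in general position with respect to a set of points if it lies in none of the
proper affine subspaces spanned by these points. -/
def IsGeneric (W : Set (Fin 3 → ℝ)) (p : Fin 3 → ℝ) : Prop :=
  ∀ Q ⊆ W, affineSpan ℝ Q ≠ ⊤ → p ∉ affineSpan ℝ Q

theorem IsGeneric.mono {V W : Set (Fin 3 → ℝ)} {p : Fin 3 → ℝ} (h : IsGeneric W p) (hVW : V ⊆ W) :
    IsGeneric V p :=
  fun Q hQ => h Q (hQ.trans hVW)

theorem isOpen_isGeneric {W : Set (Fin 3 → ℝ)} (hW : W.Finite) : IsOpen {p | IsGeneric W p} := by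
  have : {p | IsGeneric W p} = ⋂ Q ∈ {Q | Q ⊆ W ∧ affineSpan ℝ Q ≠ ⊤},
      ((affineSpan ℝ Q : Set (Fin 3 → ℝ)))ᶜ := by
    ext p
    simp only [IsGeneric, mem_ofPred_eq, mem_iInter, mem_compl_iff, SetLike.mem_coe, and_imp]
  rw [this]
  refine Set.Finite.isOpen_biInter (hW.finite_subsets.subset fun Q hQ => hQ.1) fun Q _ => ?_
  exact (AffineSubspace.closed_of_finiteDimensional _).isOpen_compl

theorem dense_isGeneric {W : Set (Fin 3 → ℝ)} (hW : W.Finite) : Dense {p | IsGeneric W p} := by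
  refine MeasureTheory.Measure.dense_of_ae (μ := MeasureTheory.volume) ?_
  have hfin : {Q | Q ⊆ W ∧ affineSpan ℝ Q ≠ ⊤}.Finite := hW.finite_subsets.subset fun Q hQ => hQ.1
  have := (MeasureTheory.ae_ball_iff (μ := (MeasureTheory.volume : MeasureTheory.Measure (Fin 3 → ℝ)))
    (p := fun x Q _ => x ∉ affineSpan ℝ Q) hfin.countable).2
    fun Q hQ => MeasureTheory.measure_eq_zero_iff_ae_notMem.1
      (MeasureTheory.Measure.addHaar_affineSubspace _ _ hQ.2)
  filter_upwards [this] with p hp Q hQ hQ'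
  exact hp Q ⟨hQ, hQ'⟩

theorem affineSpan_triple_ne_top (a b c : Fin 3 → ℝ) : affineSpan ℝ {a, b, c} ≠ ⊤ := by
  intro h
  have h1 := finrank_vectorSpan_insert_le_set ℝ {b, c} a
  have h2 := finrank_vectorSpan_insert_le_set ℝ {c} b
  have h3 : vectorSpan ℝ ({a, b, c} : Set (Fin 3 → ℝ)) = ⊤ := by
    rw [← direction_affineSpan, h, AffineSubspace.direction_top]
  rw [h3, finrank_top, Module.finrank_fin_fun] at h1
  rw [vectorSpan_singleton, finrank_bot] at h2
  omega

theorem IsGeneric.notMem_affineSpan_triple {W : Set (Fin 3 → ℝ)} {p a b c : Fin 3 → ℝ}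
    (h : IsGeneric W p) (ha : a ∈ W) (hb : b ∈ W) (hc : c ∈ W) : p ∉ affineSpan ℝ {a, b, c} :=
  h _ (by rintro _ (rfl | rfl | rfl) <;> assumption) (affineSpan_triple_ne_top a b c)

theorem AffineSubspace.mem_of_mem_segment {E : Type*} [AddCommGroup E] [Module ℝ E]
    {S : AffineSubspace ℝ E} {p x y : E} (h : x ∈ segment ℝ p y) (hxy : x ≠ y) (hx : x ∈ S)
    (hy : y ∈ S) : p ∈ S := by
  obtain ⟨t, -, rfl⟩ := (segment_eq_image_lineMap ℝ p y ▸ h :)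
  have ht : 1 - t ≠ 0 := by
    intro ht
    apply hxy
    rw [show t = 1 by linarith]; simp
  have : p = AffineMap.lineMap y (AffineMap.lineMap p y t) (1 - t)⁻¹ := by
    simp only [AffineMap.lineMap_apply, vsub_eq_sub, vadd_eq_add]
    have : p - y = (1 - t)⁻¹ • ((1 - t) • (p - y)) := by
      rw [smul_smul, inv_mul_cancel₀ ht, one_smul]
    rw [← sub_eq_iff_eq_add, this]
    congr 1
    module
  rw [this]
  exact AffineMap.lineMap_mem _ hy hx

theorem segment_subset_affineSubspace {E : Type*} [AddCommGroup E] [Module ℝ E]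
    {S : AffineSubspace ℝ E} {x y : E} (hx : x ∈ S) (hy : y ∈ S) : segment ℝ x y ⊆ S :=
  S.convex.segment_subset hx hy

theorem subsingleton_inter_segment {E : Type*} [AddCommGroup E] [Module ℝ E]
    {S : AffineSubspace ℝ E} {c d : E} (h : ¬(c ∈ S ∧ d ∈ S)) :
    ((S : Set E) ∩ segment ℝ c d).Subsingleton := by
  rw [segment_eq_image_lineMap]
  rintro _ ⟨hs, s, -, rfl⟩ _ ⟨ht, t, -, rfl⟩
  by_contra hne
  have hst : s - t ≠ 0 := by
    intro e
    exact hne (by rw [sub_eq_zero.1 e])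
  have key : ∀ r : ℝ, AffineMap.lineMap c d r ∈ S := by
    intro r
    have : AffineMap.lineMap c d r = AffineMap.lineMap (AffineMap.lineMap c d t : E)
        (AffineMap.lineMap c d s) ((r - t) / (s - t)) := by
      simp only [AffineMap.lineMap_apply, vsub_eq_sub, vadd_eq_add]
      rw [show s • (d - c) + c - (t • (d - c) + c) = (s - t) • (d - c) by module, smul_smul,
        div_mul_cancel₀ _ hst]
      module
    rw [this]
    exact AffineMap.lineMap_mem _ ht hs
  exact h ⟨by simpa using key 0, by simpa using key 1⟩

theorem subsingleton_inter_segment_of_affineSpan_eq_top {S : AffineSubspace ℝ (Fin 3 → ℝ)}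
    {a b c d : Fin 3 → ℝ} (htop : affineSpan ℝ {a, b, c, d} = ⊤) (hS : S ≠ ⊤) (ha : a ∈ S)
    (hb : b ∈ S) : ((S : Set (Fin 3 → ℝ)) ∩ segment ℝ c d).Subsingleton := by
  refine subsingleton_inter_segment fun ⟨hc, hd⟩ => hS (top_unique ?_)
  rw [← htop, affineSpan_le]
  rintro _ (rfl | rfl | rfl | rfl) <;> assumption

theorem mem_coneFrom_segment {p a b z : Fin 3 → ℝ} :
    z ∈ coneFrom p (segment ℝ a b) ↔ ∃ y ∈ segment ℝ a b, z ∈ segment ℝ p y := by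
  simp [coneFrom]

theorem coneFrom_segment_eq (p a b : Fin 3 → ℝ) :
    coneFrom p (segment ℝ a b) = convexHull ℝ {p, a, b} := by
  rw [convexHull_insert (insert_nonempty _ _), convexHull_pair]
  ext z
  simp [coneFrom]

theorem mem_coneFrom_segment_iff {p a b z : Fin 3 → ℝ} :
    z ∈ coneFrom p (segment ℝ a b) ↔
      ∃ r s t : ℝ, 0 ≤ r ∧ 0 ≤ s ∧ 0 ≤ t ∧ r + s + t = 1 ∧ r • p + s • a + t • b = z := by
  rw [mem_coneFrom_segment]
  constructor
  · rintro ⟨_, ⟨s, t, hs, ht, hst, rfl⟩, ⟨u, v, hu, hv, huv, rfl⟩⟩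
    refine ⟨u, v * s, v * t, hu, mul_nonneg hv hs, mul_nonneg hv ht, ?_, ?_⟩
    · rw [add_assoc, ← mul_add, hst, mul_one, huv]
    · module
  · rintro ⟨r, s, t, hr, hs, ht, h1, rfl⟩
    by_cases hst : s + t = 0
    · have hs0 : s = 0 := by linarith
      have ht0 : t = 0 := by linarith
      refine ⟨a, left_mem_segment _ _ _, 1, 0, by simp, by simp, by simp, ?_⟩
      have : r = 1 := by linarith
      simp [hs0, ht0, this]
    · have hpos : 0 < s + t := lt_of_le_of_ne (by positivity) (Ne.symm hst)
      refine ⟨(s / (s + t)) • a + (t / (s + t)) • b,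
        ⟨_, _, by positivity, by positivity, by field_simp, rfl⟩, r, s + t, hr, hpos.le,
        by linarith, ?_⟩
      rw [smul_add, smul_smul, smul_smul, mul_div_cancel₀ _ hst, mul_div_cancel₀ _ hst, add_assoc]

theorem coneFrom_segment_subset {S : AffineSubspace ℝ (Fin 3 → ℝ)} {p a b : Fin 3 → ℝ}
    (hp : p ∈ S) (ha : a ∈ S) (hb : b ∈ S) : coneFrom p (segment ℝ a b) ⊆ S := by
  rw [coneFrom_segment_eq]
  exact convexHull_min (by rintro _ (rfl | rfl | rfl) <;> assumption) S.convex

namespace IsGeneric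

variable {W : Set (Fin 3 → ℝ)} {p a b c d : Fin 3 → ℝ}

theorem mem_segment_of_mem_coneFrom (h : IsGeneric W p) (ha : a ∈ W) (hb : b ∈ W) (hc : c ∈ W)
    (hcone : c ∈ coneFrom p (segment ℝ a b)) : c ∈ segment ℝ a b := by
  obtain ⟨y, hy, hcy⟩ := mem_coneFrom_segment.1 hcone
  by_contra hne
  have hcy' : c ≠ y := fun e => hne (e ▸ hy)
  refine h.notMem_affineSpan_triple ha hb hc (AffineSubspace.mem_of_mem_segment hcy hcy' ?_ ?_)
  · exact mem_affineSpan ℝ (by simp)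
  · exact segment_subset_affineSubspace (mem_affineSpan ℝ (by simp)) (mem_affineSpan ℝ (by simp)) hy

theorem eq_of_mem_segment (h : IsGeneric W p) (ha : a ∈ W) (hc : c ∈ W) (hd : d ∈ W)
    {z : Fin 3 → ℝ} (hz : z ∈ segment ℝ p a) (hz' : z ∈ segment ℝ c d) : z = a := by
  by_contra hne
  refine h.notMem_affineSpan_triple ha hc hd (AffineSubspace.mem_of_mem_segment hz hne ?_ ?_)
  · exact segment_subset_affineSubspace (mem_affineSpan ℝ (by simp)) (mem_affineSpan ℝ (by simp)) hz'
  · exact mem_affineSpan ℝ (by simp)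

theorem affineSpan_eq_top (h : IsGeneric W p) (ha : a ∈ W) (hb : b ∈ W) (hc : c ∈ W) (hd : d ∈ W)
    (hdisj : Disjoint (segment ℝ a b) (segment ℝ c d))
    (hne : (coneFrom p (segment ℝ a b) ∩ segment ℝ c d).Nonempty) :
    affineSpan ℝ {a, b, c, d} = ⊤ := by
  by_contra htop
  obtain ⟨x, hx, hxcd⟩ := hne
  obtain ⟨y, hy, hxy⟩ := mem_coneFrom_segment.1 hx
  have hxy' : x ≠ y := by
    rintro rfl
    exact disjoint_left.1 hdisj hy hxcd
  refine h {a, b, c, d} ?_ htop (AffineSubspace.mem_of_mem_segment hxy hxy' ?_ ?_)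
  · rintro _ (rfl | rfl | rfl | rfl) <;> assumption
  · exact segment_subset_affineSubspace (mem_affineSpan ℝ (by simp)) (mem_affineSpan ℝ (by simp))
      hxcd
  · exact segment_subset_affineSubspace (mem_affineSpan ℝ (by simp)) (mem_affineSpan ℝ (by simp)) hy

theorem subsingleton_coneFrom_inter (h : IsGeneric W p) (ha : a ∈ W) (hb : b ∈ W) (hc : c ∈ W)
    (hd : d ∈ W) (hdisj : Disjoint (segment ℝ a b) (segment ℝ c d)) :
    (coneFrom p (segment ℝ a b) ∩ segment ℝ c d).Subsingleton := by
  intro x hx y hy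
  have htop := h.affineSpan_eq_top ha hb hc hd hdisj ⟨x, hx⟩
  have hS := subsingleton_inter_segment_of_affineSpan_eq_top
    (S := affineSpan ℝ {p, a, b}) htop (affineSpan_triple_ne_top p a b)
    (mem_affineSpan ℝ (by simp)) (mem_affineSpan ℝ (by simp))
  have hsub : coneFrom p (segment ℝ a b) ⊆ affineSpan ℝ {p, a, b} :=
    coneFrom_segment_subset (mem_affineSpan ℝ (by simp)) (mem_affineSpan ℝ (by simp))
      (mem_affineSpan ℝ (by simp))
  exact hS ⟨hsub hx.1, hx.2⟩ ⟨hsub hy.1, hy.2⟩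

end IsGeneric

theorem AffineMap.map_combination_three {E F : Type*} [AddCommGroup E] [Module ℝ E]
    [AddCommGroup F] [Module ℝ F] (g : E →ᵃ[ℝ] F) {r s t : ℝ} (h : r + s + t = 1) (a b c : E) :
    g (r • a + s • b + t • c) = r • g a + s • g b + t • g c := by
  rw [g.decomp]
  simp only [Pi.add_apply, map_add, map_smul]
  have : g 0 = r • g 0 + s • g 0 + t • g 0 := by rw [← add_smul, ← add_smul, h, one_smul]
  nth_rewrite 1 [this]
  module

theorem AffineSubspace.combination_three_mem {E : Type*} [AddCommGroup E] [Module ℝ E]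
    {S : AffineSubspace ℝ E} {r s t : ℝ} (h : r + s + t = 1) {a b c : E} (ha : a ∈ S) (hb : b ∈ S)
    (hc : c ∈ S) : r • a + s • b + t • c ∈ S := by
  have h1 := AffineSubspace.vadd_mem_of_mem_direction
    (Submodule.add_mem _ (S.direction.smul_mem s (S.vsub_mem_direction hb ha))
      (S.direction.smul_mem t (S.vsub_mem_direction hc ha))) ha
  convert h1 using 1
  rw [show r = 1 - s - t by linarith]
  simp only [vsub_eq_sub, vadd_eq_add]
  module

theorem affineIndependent_four {E : Type*} [AddCommGroup E] [Module ℝ E] {p q x y : E}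
    (hxy : x ≠ y) (hp : p ∉ affineSpan ℝ {x, y}) (hq : q ∉ affineSpan ℝ {p, x, y}) :
    AffineIndependent ℝ ![p, q, x, y] := by
  rw [affineIndependent_iff_of_fintype]
  intro w hw hs
  rw [Finset.univ.weightedVSub_eq_linear_combination hw] at hs
  simp only [Fin.sum_univ_four, Matrix.cons_val] at hw hs
  have h1 : w 1 = 0 := by
    by_contra h1
    apply hq
    have : q = (-(w 0 / w 1)) • p + (-(w 2 / w 1)) • x + (-(w 3 / w 1)) • y := by
      have : w 1 • q = -(w 0 • p + w 2 • x + w 3 • y) := by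
        rw [eq_neg_iff_add_eq_zero, ← hs]; module
      rw [← inv_smul_smul₀ h1 q, this]
      module
    rw [this]
    refine AffineSubspace.combination_three_mem ?_ (mem_affineSpan ℝ (by simp))
      (mem_affineSpan ℝ (by simp)) (mem_affineSpan ℝ (by simp))
    field_simp
    linarith
  simp only [h1, zero_smul, add_zero] at hs hw
  have h0 : w 0 = 0 := by
    by_contra h0
    apply hp
    have : p = (-(w 2 / w 0)) • x + (-(w 3 / w 0)) • y + (0 : ℝ) • y := by
      have : w 0 • p = -(w 2 • x + w 3 • y) := by
        rw [eq_neg_iff_add_eq_zero, ← hs]; module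
      rw [← inv_smul_smul₀ h0 p, this]
      module
    rw [this]
    refine AffineSubspace.combination_three_mem ?_ (mem_affineSpan ℝ (by simp))
      (mem_affineSpan ℝ (by simp)) (mem_affineSpan ℝ (by simp))
    field_simp
    linarith
  simp only [h0, zero_smul, zero_add] at hs hw
  have h3 : w 3 = -w 2 := by linarith
  have h2 : w 2 = 0 := by
    by_contra h2
    rw [h3, neg_smul, ← sub_eq_add_neg, ← smul_sub, smul_eq_zero, sub_eq_zero] at hs
    exact hs.elim h2 hxy
  intro i
  fin_cases i
  · exact h0
  · exact h1
  · exact h2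
  · simpa [h2] using h3

theorem AffineBasis.mem_coneFrom_segment_iff (b : AffineBasis (Fin 4) ℝ (Fin 3 → ℝ))
    {i j k l : Fin 4} (hj : i ≠ j) (hk : i ≠ k) (hl : i ≠ l)
    (hsum : ∀ f : Fin 4 → (Fin 3 → ℝ), ∑ m, f m = f i + f j + f k + f l)
    (hsum' : ∀ f : Fin 4 → ℝ, ∑ m, f m = f i + f j + f k + f l) (z : Fin 3 → ℝ) :
    z ∈ coneFrom (b j) (segment ℝ (b k) (b l)) ↔ b.coord i z = 0 ∧ ∀ m, 0 ≤ b.coord m z := by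
  rw [_root_.mem_coneFrom_segment_iff]
  constructor
  · rintro ⟨r, s, t, hr, hs, ht, h1, rfl⟩
    constructor
    · rw [AffineMap.map_combination_three _ h1, b.coord_apply_ne hj, b.coord_apply_ne hk,
        b.coord_apply_ne hl]
      simp
    · intro m
      rw [AffineMap.map_combination_three _ h1, b.coord_apply, b.coord_apply, b.coord_apply]
      simp only [smul_eq_mul]
      split_ifs <;> simp <;> positivity
  · rintro ⟨h0, hnn⟩
    refine ⟨b.coord j z, b.coord k z, b.coord l z, hnn _, hnn _, hnn _, ?_, ?_⟩
    · have := b.sum_coord_apply_eq_one z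
      rw [hsum', h0] at this
      linarith
    · have := b.linear_combination_coord_eq_self z
      rw [hsum, h0] at this
      simpa using this

theorem AffineBasis.mem_segment_of_coord (b : AffineBasis (Fin 4) ℝ (Fin 3 → ℝ))
    {i j k l : Fin 4}
    (hsum : ∀ f : Fin 4 → (Fin 3 → ℝ), ∑ m, f m = f i + f j + f k + f l)
    (hsum' : ∀ f : Fin 4 → ℝ, ∑ m, f m = f i + f j + f k + f l) {z : Fin 3 → ℝ}
    (hi : b.coord i z = 0) (hj : b.coord j z = 0) (hnn : ∀ m, 0 ≤ b.coord m z) :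
    z ∈ segment ℝ (b k) (b l) := by
  refine ⟨b.coord k z, b.coord l z, hnn _, hnn _, ?_, ?_⟩
  · have := b.sum_coord_apply_eq_one z
    rw [hsum', hi, hj] at this
    linarith
  · have := b.linear_combination_coord_eq_self z
    rw [hsum, hi, hj] at this
    simpa using this

/-- The number modulo `2` of points in which the triangle `p a b` meets the segment `c d`. -/
def hit (p a b c d : Fin 3 → ℝ) : ZMod 2 :=
  ind (coneFrom p (segment ℝ a b) ∩ segment ℝ c d).Nonempty

/-- A segment meets the boundary of a tetrahedron in as many points, modulo `2`, as it has
endpoints in the tetrahedron. -/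
theorem hit_tetrahedron {W : Set (Fin 3 → ℝ)} {p q x y a b : Fin 3 → ℝ} (hp : IsGeneric W p)
    (hq : IsGeneric (insert p W) q) (hx : x ∈ W) (hy : y ∈ W) (ha : a ∈ W) (hb : b ∈ W)
    (hxy : x ≠ y) (hdisj : Disjoint (segment ℝ x y) (segment ℝ a b)) :
    hit p x y a b + hit q x y a b + hit q p x a b + hit q p y a b =
      ind (a ∈ convexHull ℝ {p, q, x, y}) + ind (b ∈ convexHull ℝ {p, q, x, y}) := by
  have hqW : IsGeneric W q := hq.mono (subset_insert _ _)
  have hpW : p ∈ insert p W := mem_insert _ _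
  have hW : ∀ {z}, z ∈ W → z ∈ insert p W := fun h => mem_insert_of_mem _ h
  have hind : AffineIndependent ℝ ![p, q, x, y] := by
    refine affineIndependent_four hxy ?_ (hq.notMem_affineSpan_triple hpW (hW hx) (hW hy))
    have := hp.notMem_affineSpan_triple hx hy hy
    simpa using this
  let B : AffineBasis (Fin 4) ℝ (Fin 3 → ℝ) := ⟨![p, q, x, y], hind, by
    rw [hind.affineSpan_eq_top_iff_card_eq_finrank_add_one]; simp⟩
  have hseg : ∀ z ∈ segment ℝ a b, z ∉ segment ℝ x y := fun z h h' => disjoint_left.1 hdisj h' h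
  have hasg : a ∈ segment ℝ a b := left_mem_segment _ _ _
  have hbsg : b ∈ segment ℝ a b := right_mem_segment _ _ _
  have hxs : x ∈ segment ℝ x y := left_mem_segment _ _ _
  have hys : y ∈ segment ℝ x y := right_mem_segment _ _ _
  have f0 := fun z => B.mem_coneFrom_segment_iff (i := 0) (j := 1) (k := 2) (l := 3) (by decide)
    (by decide) (by decide) (fun f => by rw [Fin.sum_univ_four])
    (fun f => by rw [Fin.sum_univ_four]) z
  have f1 := fun z => B.mem_coneFrom_segment_iff (i := 1) (j := 0) (k := 2) (l := 3) (by decide)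
    (by decide) (by decide) (fun f => by rw [Fin.sum_univ_four]; abel)
    (fun f => by rw [Fin.sum_univ_four]; abel) z
  have f2 := fun z => B.mem_coneFrom_segment_iff (i := 2) (j := 1) (k := 0) (l := 3) (by decide)
    (by decide) (by decide) (fun f => by rw [Fin.sum_univ_four]; abel)
    (fun f => by rw [Fin.sum_univ_four]; abel) z
  have f3 := fun z => B.mem_coneFrom_segment_iff (i := 3) (j := 1) (k := 0) (l := 2) (by decide)
    (by decide) (by decide) (fun f => by rw [Fin.sum_univ_four]; abel)
    (fun f => by rw [Fin.sum_univ_four]; abel) z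
  have B0 : B 0 = p := rfl
  have B1 : B 1 = q := rfl
  have B2 : B 2 = x := rfl
  have B3 : B 3 = y := rfl
  rw [B1, B2, B3] at f0
  rw [B0, B2, B3] at f1
  rw [B0, B1, B3] at f2
  rw [B0, B1, B2] at f3
  have hull : convexHull ℝ {p, q, x, y} = {z | ∀ i, 0 ≤ B.coord i z} := by
    rw [← B.convexHull_eq_nonneg_coord]
    congr 1
    change _ = range ![p, q, x, y]
    ext z
    simp [eq_comm]
    tauto
  have hpos : ∀ z ∈ W, z ∈ segment ℝ a b → (∀ i, 0 ≤ B.coord i z) → ∀ i, 0 < B.coord i z := by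
    intro z hz hzs hnn i
    refine lt_of_le_of_ne (hnn i) (Ne.symm fun h0 => ?_)
    fin_cases i
    · exact hseg z hzs (hqW.mem_segment_of_mem_coneFrom hx hy hz ((f0 z).2 ⟨h0, hnn⟩))
    · exact hseg z hzs (hp.mem_segment_of_mem_coneFrom hx hy hz ((f1 z).2 ⟨h0, hnn⟩))
    · have h := hq.mem_segment_of_mem_coneFrom hpW (hW hy) (hW hz) ((f2 z).2 ⟨h0, hnn⟩)
      exact hseg z hzs (hp.eq_of_mem_segment hy ha hb h hzs ▸ hys)
    · have h := hq.mem_segment_of_mem_coneFrom hpW (hW hx) (hW hz) ((f3 z).2 ⟨h0, hnn⟩)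
      exact hseg z hzs (hp.eq_of_mem_segment hx ha hb h hzs ▸ hxs)
  have hline : ∀ i (t : ℝ), B.coord i a + t * (B.coord i b - B.coord i a) =
      B.coord i (AffineMap.lineMap a b t) := by
    intro i t
    rw [AffineMap.apply_lineMap, AffineMap.lineMap_apply]
    simp only [vsub_eq_sub, vadd_eq_add, smul_eq_mul]; ring
  have hmem : ∀ t ∈ Icc (0 : ℝ) 1, AffineMap.lineMap a b t ∈ segment ℝ a b := by
    intro t ht
    rw [segment_eq_image_lineMap]
    exact mem_image_of_mem _ ht
  have key := sum_ind_face (fun i => B.coord i a) (fun i => B.coord i b - B.coord i a)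
    (hpos a ha hasg) (by simpa using hpos b hb hbsg) (by
      simp only [hline]
      intro t ht hnn i j hi hj
      have hz := hmem t ht
      generalize AffineMap.lineMap a b t = z at *
      have e01 : B.coord 0 z = 0 → B.coord 1 z = 0 → False := fun h h' =>
        hseg z hz (B.mem_segment_of_coord (k := 2) (l := 3) (fun f => by rw [Fin.sum_univ_four])
          (fun f => by rw [Fin.sum_univ_four]) h h' hnn)
      have e02 : B.coord 0 z = 0 → B.coord 2 z = 0 → False := fun h h' =>
        hseg z hz (hqW.eq_of_mem_segment hy ha hb (B.mem_segment_of_coord (k := 1) (l := 3)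
          (fun f => by rw [Fin.sum_univ_four]; abel)
          (fun f => by rw [Fin.sum_univ_four]; abel) h h' hnn) hz ▸ hys)
      have e03 : B.coord 0 z = 0 → B.coord 3 z = 0 → False := fun h h' =>
        hseg z hz (hqW.eq_of_mem_segment hx ha hb (B.mem_segment_of_coord (k := 1) (l := 2)
          (fun f => by rw [Fin.sum_univ_four]; abel)
          (fun f => by rw [Fin.sum_univ_four]; abel) h h' hnn) hz ▸ hxs)
      have e12 : B.coord 1 z = 0 → B.coord 2 z = 0 → False := fun h h' =>
        hseg z hz (hp.eq_of_mem_segment hy ha hb (B.mem_segment_of_coord (k := 0) (l := 3)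
          (fun f => by rw [Fin.sum_univ_four]; abel)
          (fun f => by rw [Fin.sum_univ_four]; abel) h h' hnn) hz ▸ hys)
      have e13 : B.coord 1 z = 0 → B.coord 3 z = 0 → False := fun h h' =>
        hseg z hz (hp.eq_of_mem_segment hx ha hb (B.mem_segment_of_coord (k := 0) (l := 2)
          (fun f => by rw [Fin.sum_univ_four]; abel)
          (fun f => by rw [Fin.sum_univ_four]; abel) h h' hnn) hz ▸ hxs)
      have e23 : B.coord 2 z = 0 → B.coord 3 z = 0 → False := fun h h' => by
        have := hq.eq_of_mem_segment hpW (hW ha) (hW hb)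
          (B.mem_segment_of_coord (k := 1) (l := 0) (fun f => by rw [Fin.sum_univ_four]; abel)
          (fun f => by rw [Fin.sum_univ_four]; abel) h h' hnn) hz
        rw [this] at hz
        exact hp.notMem_affineSpan_triple ha hb hb (segment_subset_affineSubspace
          (mem_affineSpan ℝ (by simp)) (mem_affineSpan ℝ (by simp)) hz)
      fin_cases i <;> fin_cases j <;> first
        | rfl
        | exact (e01 hi hj).elim
        | exact (e01 hj hi).elim
        | exact (e02 hi hj).elim
        | exact (e02 hj hi).elim
        | exact (e03 hi hj).elim
        | exact (e03 hj hi).elim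
        | exact (e12 hi hj).elim
        | exact (e12 hj hi).elim
        | exact (e13 hi hj).elim
        | exact (e13 hj hi).elim
        | exact (e23 hi hj).elim
        | exact (e23 hj hi).elim)
  simp only [hline, add_sub_cancel, Fin.sum_univ_four, ← f0, ← f1, ← f2, ← f3] at key
  have hne : ∀ S : Set (Fin 3 → ℝ), (∃ t ∈ Icc (0 : ℝ) 1, AffineMap.lineMap a b t ∈ S) ↔
      (S ∩ segment ℝ a b).Nonempty := by
    intro S
    rw [segment_eq_image_lineMap, inter_nonempty]
    simp only [mem_image]
    constructor
    · rintro ⟨t, ht, h⟩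
      exact ⟨_, h, t, ht, rfl⟩
    · rintro ⟨_, h, t, ht, rfl⟩
      exact ⟨t, ht, h⟩
  simp only [hne] at key
  rw [hull]
  simp only [mem_ofPred_eq, ← key, hit]
  ring

theorem isOpen_disjoint_coneFrom_inter (a b a' b' c d : Fin 3 → ℝ) :
    IsOpen {p | Disjoint (coneFrom p (segment ℝ a b) ∩ segment ℝ c d)
      (coneFrom p (segment ℝ a' b') ∩ segment ℝ c d)} := by
  have hcomp : ∀ x y : Fin 3 → ℝ, IsCompact (segment ℝ x y) := fun x y => by
    rw [segment_eq_image_lineMap]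
    exact isCompact_Icc.image (by fun_prop)
  have hK : IsCompact (segment ℝ c d ×ˢ segment ℝ a b ×ˢ segment ℝ a' b' ×ˢ Icc (0 : ℝ) 1 ×ˢ
      Icc (0 : ℝ) 1) :=
    (hcomp _ _).prod ((hcomp _ _).prod ((hcomp _ _).prod (isCompact_Icc.prod isCompact_Icc)))
  have hset : {p | Disjoint (coneFrom p (segment ℝ a b) ∩ segment ℝ c d)
      (coneFrom p (segment ℝ a' b') ∩ segment ℝ c d)} =
      {p | ∀ q ∈ segment ℝ c d ×ˢ segment ℝ a b ×ˢ segment ℝ a' b' ×ˢ Icc (0 : ℝ) 1 ×ˢ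
        Icc (0 : ℝ) 1, ¬ (p + q.2.2.2.1 • (q.2.1 - p) = q.1 ∧
          p + q.2.2.2.2 • (q.2.2.1 - p) = q.1)} := by
    ext p
    simp only [mem_ofPred_eq, disjoint_left, mem_inter_iff, mem_coneFrom_segment,
      segment_eq_image' ℝ p, mem_image, Prod.forall, mem_prod]
    constructor
    · rintro h x y z s t ⟨hx, hy, hz, hs, ht⟩ ⟨h1, h2⟩
      exact h ⟨⟨y, hy, s, hs, h1⟩, hx⟩ ⟨⟨z, hz, t, ht, h2⟩, hx⟩
    · rintro h x ⟨⟨y, hy, s, hs, h1⟩, hx⟩ ⟨⟨z, hz, t, ht, h2⟩, -⟩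
      exact h x y z s t ⟨hx, hy, hz, hs, ht⟩ ⟨h1, h2⟩
  rw [hset, isOpen_iff_mem_nhds]
  intro p hp
  refine hK.eventually_forall_of_forall_eventually fun q hq => ?_
  have hcl : IsClosed {r : (Fin 3 → ℝ) × ((Fin 3 → ℝ) × (Fin 3 → ℝ) × (Fin 3 → ℝ) × ℝ × ℝ) |
      r.1 + r.2.2.2.2.1 • (r.2.2.1 - r.1) = r.2.1 ∧
        r.1 + r.2.2.2.2.2 • (r.2.2.2.1 - r.1) = r.2.1} :=
    (isClosed_eq (by fun_prop) (by fun_prop)).inter (isClosed_eq (by fun_prop) (by fun_prop))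
  exact hcl.isOpen_compl.mem_nhds (hp q hq)

/-- Generically, the cone over two segments meets a third segment in distinct points. -/
theorem IsGeneric.mem_closure_disjoint {W : Set (Fin 3 → ℝ)} {p a b a' b' c d : Fin 3 → ℝ}
    (hp : IsGeneric W p) (ha : a ∈ W) (hb : b ∈ W) (ha' : a' ∈ W) (hb' : b' ∈ W) (hc : c ∈ W)
    (hd : d ∈ W) (h : Disjoint (segment ℝ a b) (segment ℝ c d))
    (h' : Disjoint (segment ℝ a' b') (segment ℝ c d))
    (hab : ∀ x ∈ segment ℝ a b, x ∈ segment ℝ a' b' → x = a ∨ x = b) :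
    p ∈ closure {p | Disjoint (coneFrom p (segment ℝ a b) ∩ segment ℝ c d)
      (coneFrom p (segment ℝ a' b') ∩ segment ℝ c d)} := by
  by_cases hdis : Disjoint (coneFrom p (segment ℝ a b) ∩ segment ℝ c d)
      (coneFrom p (segment ℝ a' b') ∩ segment ℝ c d)
  · exact subset_closure hdis
  obtain ⟨x, ⟨hx, hxs⟩, hx', -⟩ := not_disjoint_iff.1 hdis
  have htop := hp.affineSpan_eq_top ha hb hc hd h ⟨x, hx, hxs⟩
  obtain ⟨y, hy, hxy⟩ := mem_coneFrom_segment.1 hx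
  obtain ⟨z, hz, hxz⟩ := mem_coneFrom_segment.1 hx'
  have hxz' : x ≠ z := fun e => disjoint_left.1 h' hz (e ▸ hxs)
  have hpx : p ≠ x := by
    rintro rfl
    exact hp.notMem_affineSpan_triple hc hd hd (segment_subset_affineSubspace
      (mem_affineSpan ℝ (by simp)) (mem_affineSpan ℝ (by simp)) hxs)
  have hyz : y ≠ z := by
    rintro rfl
    rcases hab y hy hz with rfl | rfl
    · exact disjoint_left.1 h hy (hp.eq_of_mem_segment ha hc hd hxy hxs ▸ hxs)
    · exact disjoint_left.1 h hy (hp.eq_of_mem_segment hb hc hd hxy hxs ▸ hxs)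
  have htop' : affineSpan ℝ {a, b, a', b'} = ⊤ := by
    by_contra hne
    refine hp _ (by rintro _ (rfl | rfl | rfl | rfl) <;> assumption) hne ?_
    have hyS : y ∈ affineSpan ℝ {a, b, a', b'} := segment_subset_affineSubspace
      (mem_affineSpan ℝ (by simp)) (mem_affineSpan ℝ (by simp)) hy
    have hzS : z ∈ affineSpan ℝ {a, b, a', b'} := segment_subset_affineSubspace
      (mem_affineSpan ℝ (by simp)) (mem_affineSpan ℝ (by simp)) hz
    rw [segment_eq_image' ℝ p] at hxy hxz
    obtain ⟨s, -, hs⟩ := hxy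
    obtain ⟨t, -, ht⟩ := hxz
    simp only at hs ht
    have hst : s - t ≠ 0 := by
      intro e
      rw [sub_eq_zero] at e
      subst e
      have h1 : s • y = s • z := by
        have := hs.trans ht.symm
        rw [add_right_inj, smul_sub, smul_sub, sub_left_inj] at this
        exact this
      refine hyz (smul_right_injective _ (fun e : s = 0 => hpx ?_) h1)
      rw [← hs, e]; simp
    have : p = (s / (s - t)) • y + (-(t / (s - t))) • z + (0 : ℝ) • z := by
      have h1 : (s - t) • p = s • y - t • z := by
        have : s • (y - p) = t • (z - p) := add_left_cancel (hs.trans ht.symm)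
        linear_combination (norm := module) (-1 : ℝ) • this
      rw [← inv_smul_smul₀ hst p, h1]
      module
    rw [this]
    exact AffineSubspace.combination_three_mem (by field_simp; ring) hyS hzS hzS
  have hpS : p ∈ affineSpan ℝ {x, a', b'} := AffineSubspace.mem_of_mem_segment hxz hxz'
    (mem_affineSpan ℝ (by simp)) (segment_subset_affineSubspace
      (mem_affineSpan ℝ (by simp)) (mem_affineSpan ℝ (by simp)) hz)
  obtain ⟨v, hv, hvS⟩ : ∃ v, v ∈ affineSpan ℝ {p, a, b} ∧ v ∉ affineSpan ℝ {x, a', b'} := by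
    by_contra! hall
    refine affineSpan_triple_ne_top x a' b' (top_unique ?_)
    rw [← htop', affineSpan_le]
    rintro _ (rfl | rfl | rfl | rfl)
    · exact hall _ (mem_affineSpan ℝ (by simp))
    · exact hall _ (mem_affineSpan ℝ (by simp))
    · exact mem_affineSpan ℝ (by simp)
    · exact mem_affineSpan ℝ (by simp)
  have hlim : Filter.Tendsto (fun t : ℝ => AffineMap.lineMap p v t) (nhdsWithin 0 {0}ᶜ) (nhds p) := by
    have : Continuous (fun t : ℝ => (AffineMap.lineMap p v t : Fin 3 → ℝ)) := by fun_prop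
    have := this.tendsto 0
    rw [AffineMap.lineMap_apply_zero] at this
    exact this.mono_left nhdsWithin_le_nhds
  refine mem_closure_of_tendsto hlim ?_
  filter_upwards [self_mem_nhdsWithin] with t ht
  have hpP : p ∈ affineSpan ℝ {p, a, b} := mem_affineSpan ℝ (by simp)
  have haP : a ∈ affineSpan ℝ {p, a, b} := mem_affineSpan ℝ (by simp)
  have hbP : b ∈ affineSpan ℝ {p, a, b} := mem_affineSpan ℝ (by simp)
  refine disjoint_left.2 fun w hw hw' => hvS ?_
  have hwx : w = x := subsingleton_inter_segment_of_affineSpan_eq_top htop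
    (affineSpan_triple_ne_top p a b) haP hbP
    ⟨coneFrom_segment_subset (AffineMap.lineMap_mem _ hpP hv) haP hbP hw.1, hw.2⟩
    ⟨coneFrom_segment_subset hpP haP hbP hx, hxs⟩
  subst hwx
  obtain ⟨u, hu, hwu⟩ := mem_coneFrom_segment.1 hw'.1
  have hwu' : w ≠ u := fun e => disjoint_left.1 h' hu (e ▸ hxs)
  have hmem : AffineMap.lineMap p v t ∈ affineSpan ℝ {w, a', b'} :=
    AffineSubspace.mem_of_mem_segment hwu hwu'
    (mem_affineSpan ℝ (by simp)) (segment_subset_affineSubspace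
      (mem_affineSpan ℝ (by simp)) (mem_affineSpan ℝ (by simp)) hu)
  have hvt : v = AffineMap.lineMap p (AffineMap.lineMap p v t) t⁻¹ := by
    have ht0 : t ≠ 0 := ht
    simp only [AffineMap.lineMap_apply, vsub_eq_sub, vadd_eq_add, add_sub_cancel_right]
    rw [inv_smul_smul₀ ht0, sub_add_cancel]
  rw [hvt]
  exact AffineMap.lineMap_mem _ hpS hmem

theorem ncard_biUnion_subsingleton {ι α : Type*} (s : Finset ι) (F : ι → Set α)
    (hF : ∀ i ∈ s, (F i).Subsingleton)
    (hd : ∀ i ∈ s, ∀ j ∈ s, i ≠ j → Disjoint (F i) (F j)) :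
    (⋃ i ∈ s, F i).Finite ∧ ((⋃ i ∈ s, F i).ncard : ZMod 2) = ∑ i ∈ s, ind (F i).Nonempty := by
  classical
  induction s using Finset.induction_on with
  | empty => simp
  | insert i s hi ih =>
    obtain ⟨hfin, hcard⟩ := ih (fun j hj => hF j (Finset.mem_insert_of_mem hj))
      (fun j hj k hk => hd j (Finset.mem_insert_of_mem hj) k (Finset.mem_insert_of_mem hk))
    have hFi := hF i (Finset.mem_insert_self _ _)
    rw [Finset.set_biUnion_insert]
    refine ⟨hFi.finite.union hfin, ?_⟩
    rw [ncard_union_eq _ hFi.finite hfin, Nat.cast_add, hcard, Finset.sum_insert hi]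
    · congr 1
      rcases hFi.eq_empty_or_singleton with h | ⟨x, h⟩
      · rw [h, ncard_empty, ind_of_not (by simp)]; rfl
      · rw [h, ncard_singleton, ind_of (by simp)]; rfl
    · simp only [disjoint_iUnion_right]
      intro j hj
      exact hd i (Finset.mem_insert_self _ _) j (Finset.mem_insert_of_mem hj)
        (fun e => hi (e ▸ hj))

/-- A polygonal embedding of `K₄,₄` in `ℝ³`, with vertices `A i` and `B j` and with all edges
subdivided into the same number `n` of segments. -/
structure PolygonalK44 where
  /-- The number of segments of each edge. -/
  n : ℕ
  /-- The vertices of the first part. -/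
  A : Fin 4 → Fin 3 → ℝ
  /-- The vertices of the second part. -/
  B : Fin 4 → Fin 3 → ℝ
  /-- The successive subdivision points of the edges. -/
  P : Fin 4 → Fin 4 → ℕ → Fin 3 → ℝ
  pos : 0 < n
  P_zero : ∀ i j, P i j 0 = A i
  P_n : ∀ i j, P i j n = B j
  ne : ∀ i j, ∀ k < n, P i j k ≠ P i j (k + 1)
  disj : ∀ i j, ∀ k < n, ∀ i' j', ∀ k' < n, i ≠ i' → j ≠ j' →
    Disjoint (segment ℝ (P i j k) (P i j (k + 1))) (segment ℝ (P i' j' k') (P i' j' (k' + 1)))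
  inter : ∀ i j, ∀ k < n, ∀ i' j', ∀ k' < n, (i, j, k) ≠ (i', j', k') →
    ∀ x ∈ segment ℝ (P i j k) (P i j (k + 1)),
      x ∈ segment ℝ (P i' j' k') (P i' j' (k' + 1)) → x = P i j k ∨ x = P i j (k + 1)

namespace PolygonalK44

variable (K : PolygonalK44)

/-- The initial point of a segment. -/
def src (e : Fin 4 × Fin 4 × ℕ) : Fin 3 → ℝ := K.P e.1 e.2.1 e.2.2

/-- The final point of a segment. -/
def tgt (e : Fin 4 × Fin 4 × ℕ) : Fin 3 → ℝ := K.P e.1 e.2.1 (e.2.2 + 1)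

/-- A segment of the subdivision of the edge `A i`, `B j`. -/
def seg (e : Fin 4 × Fin 4 × ℕ) : Set (Fin 3 → ℝ) := segment ℝ (K.src e) (K.tgt e)

/-- The segments of the edges joining given sets of vertices. -/
def segs (I J : Finset (Fin 4)) : Finset (Fin 4 × Fin 4 × ℕ) := I ×ˢ J ×ˢ Finset.range K.n

/-- The set of all vertices and subdivision points. -/
def W : Set (Fin 3 → ℝ) := (fun e : Fin 4 × Fin 4 × ℕ => K.src e) '' (univ ×ˢ univ ×ˢ Iic K.n)

theorem finite_W : K.W.Finite :=
  (finite_univ.prod (finite_univ.prod (finite_Iic _))).image _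

variable {K}

theorem P_mem_W {i j : Fin 4} {k : ℕ} (hk : k ≤ K.n) : K.P i j k ∈ K.W :=
  ⟨(i, j, k), by simpa using hk, rfl⟩

theorem B_mem_W (j : Fin 4) : K.B j ∈ K.W := K.P_n 0 j ▸ P_mem_W le_rfl

theorem mem_segs {I J : Finset (Fin 4)} {e : Fin 4 × Fin 4 × ℕ} :
    e ∈ K.segs I J ↔ e.1 ∈ I ∧ e.2.1 ∈ J ∧ e.2.2 < K.n := by
  simp [segs]

theorem src_mem_W {I J : Finset (Fin 4)} {e : Fin 4 × Fin 4 × ℕ} (he : e ∈ K.segs I J) :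
    K.src e ∈ K.W := P_mem_W (mem_segs.1 he).2.2.le

theorem tgt_mem_W {I J : Finset (Fin 4)} {e : Fin 4 × Fin 4 × ℕ} (he : e ∈ K.segs I J) :
    K.tgt e ∈ K.W := P_mem_W (mem_segs.1 he).2.2

variable {I J I' J' : Finset (Fin 4)} {e g : Fin 4 × Fin 4 × ℕ}

theorem disjoint_seg (hI : Disjoint I I') (hJ : Disjoint J J') (he : e ∈ K.segs I J)
    (hg : g ∈ K.segs I' J') : Disjoint (K.seg e) (K.seg g) := by
  obtain ⟨he1, he2, he3⟩ := mem_segs.1 he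
  obtain ⟨hg1, hg2, hg3⟩ := mem_segs.1 hg
  exact K.disj _ _ _ he3 _ _ _ hg3 (fun h => Finset.disjoint_left.1 hI he1 (h ▸ hg1))
    (fun h => Finset.disjoint_left.1 hJ he2 (h ▸ hg2))

theorem eq_src_or_eq_tgt {x : Fin 3 → ℝ} (he : e ∈ K.segs I J) (hg : g ∈ K.segs I' J')
    (heg : e ≠ g) (hx : x ∈ K.seg e) (hx' : x ∈ K.seg g) : x = K.src e ∨ x = K.tgt e :=
  K.inter _ _ _ (mem_segs.1 he).2.2 _ _ _ (mem_segs.1 hg).2.2 heg x hx hx'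

theorem sum_range_src_add_tgt (φ : (Fin 3 → ℝ) → ZMod 2) (i j : Fin 4) :
    ∑ k ∈ Finset.range K.n, (φ (K.P i j k) + φ (K.P i j (k + 1))) = φ (K.A i) + φ (K.B j) := by
  rw [← K.P_zero i j, ← K.P_n i j]
  generalize K.n = n
  induction n with
  | zero => simp [zmod_two_add_self]
  | succ n ih =>
    rw [Finset.sum_range_succ, ih]
    linear_combination zmod_two_add_self (φ (K.P i j n))

theorem sum_segs (F : Fin 4 × Fin 4 × ℕ → ZMod 2) :
    ∑ e ∈ K.segs I J, F e = ∑ i ∈ I, ∑ j ∈ J, ∑ k ∈ Finset.range K.n, F (i, j, k) := by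
  rw [segs, Finset.sum_product]
  exact Finset.sum_congr rfl fun i _ => Finset.sum_product _ _ _

theorem sum_segs_src_add_tgt (hI : Even I.card) (hJ : Even J.card)
    (φ : (Fin 3 → ℝ) → ZMod 2) : ∑ e ∈ K.segs I J, (φ (K.src e) + φ (K.tgt e)) = 0 := by
  rw [sum_segs]
  simp only [src, tgt, sum_range_src_add_tgt]
  simp only [Finset.sum_add_distrib, Finset.sum_const, nsmul_eq_mul,
    (ZMod.natCast_eq_zero_iff_even).2 hI, (ZMod.natCast_eq_zero_iff_even).2 hJ, zero_mul, mul_zero,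
    add_zero]

/-- The number modulo `2` of points in which the cone with apex `p` over one set of edges meets
another set of edges. -/
def lk (K : PolygonalK44) (p : Fin 3 → ℝ) (I J I' J' : Finset (Fin 4)) : ZMod 2 :=
  ∑ e ∈ K.segs I J, ∑ g ∈ K.segs I' J', hit p (K.src e) (K.tgt e) (K.src g) (K.tgt g)

theorem src_ne_tgt (he : e ∈ K.segs I J) : K.src e ≠ K.tgt e := K.ne _ _ _ (mem_segs.1 he).2.2

theorem lk_eq_of_isGeneric_insert {p q : Fin 3 → ℝ} (hp : IsGeneric K.W p)
    (hq : IsGeneric (insert p K.W) q) (hI : Even I.card) (hJ : Even J.card) (hI' : Even I'.card)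
    (hJ' : Even J'.card) (hII : Disjoint I I') (hJJ : Disjoint J J') :
    K.lk p I J I' J' = K.lk q I J I' J' := by
  have key := Finset.sum_congr rfl fun e (he : e ∈ K.segs I J) =>
    Finset.sum_congr rfl fun g (hg : g ∈ K.segs I' J') =>
      hit_tetrahedron hp hq (src_mem_W he) (tgt_mem_W he) (src_mem_W hg) (tgt_mem_W hg)
        (src_ne_tgt he) (disjoint_seg hII hJJ he hg)
  have h1 : ∑ e ∈ K.segs I J, ∑ g ∈ K.segs I' J',
      (hit q p (K.src e) (K.src g) (K.tgt g) + hit q p (K.tgt e) (K.src g) (K.tgt g)) = 0 := by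
    rw [Finset.sum_comm]
    exact Finset.sum_eq_zero fun g _ =>
      sum_segs_src_add_tgt hI hJ fun x => hit q p x (K.src g) (K.tgt g)
  have h2 : ∑ e ∈ K.segs I J, ∑ g ∈ K.segs I' J',
      (ind (K.src g ∈ convexHull ℝ {p, q, K.src e, K.tgt e}) +
        ind (K.tgt g ∈ convexHull ℝ {p, q, K.src e, K.tgt e})) = 0 :=
    Finset.sum_eq_zero fun e _ =>
      sum_segs_src_add_tgt hI' hJ' fun x => ind (x ∈ convexHull ℝ {p, q, K.src e, K.tgt e})
  rw [h2] at key
  simp only [Finset.sum_add_distrib] at key h1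
  change K.lk p I J I' J' + K.lk q I J I' J' + _ + _ = 0 at key
  linear_combination key - h1 - zmod_two_add_self (K.lk q I J I' J')

theorem lk_eq {p q : Fin 3 → ℝ} (hp : IsGeneric K.W p) (hq : IsGeneric K.W q)
    (hI : Even I.card) (hJ : Even J.card) (hI' : Even I'.card)
    (hJ' : Even J'.card) (hII : Disjoint I I') (hJJ : Disjoint J J') :
    K.lk p I J I' J' = K.lk q I J I' J' := by
  obtain ⟨r, hr⟩ := (dense_isGeneric ((K.finite_W.insert q).insert p)).nonempty
  rw [lk_eq_of_isGeneric_insert hp (hr.mono (insert_subset_insert (subset_insert _ _)))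
      hI hJ hI' hJ' hII hJJ,
    lk_eq_of_isGeneric_insert hq (hr.mono (subset_insert _ _)) hI hJ hI' hJ' hII hJJ]

theorem ncard_coneFrom_inter {p : Fin 3 → ℝ} (hp : IsGeneric K.W p)
    (hII : Disjoint I I') (hJJ : Disjoint J J')
    (hd : ∀ e ∈ K.segs I J, ∀ e' ∈ K.segs I J, ∀ g ∈ K.segs I' J', e ≠ e' →
      Disjoint (coneFrom p (K.seg e) ∩ K.seg g) (coneFrom p (K.seg e') ∩ K.seg g)) :
    (coneFrom p (⋃ e ∈ K.segs I J, K.seg e) ∩ ⋃ g ∈ K.segs I' J', K.seg g).Finite ∧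
      ((coneFrom p (⋃ e ∈ K.segs I J, K.seg e) ∩ ⋃ g ∈ K.segs I' J', K.seg g).ncard : ZMod 2) =
        K.lk p I J I' J' := by
  have hset : (coneFrom p (⋃ e ∈ K.segs I J, K.seg e) ∩ ⋃ g ∈ K.segs I' J', K.seg g) =
      ⋃ r ∈ K.segs I J ×ˢ K.segs I' J', coneFrom p (K.seg r.1) ∩ K.seg r.2 := by
    ext x
    simp only [coneFrom, mem_inter_iff, mem_iUnion, exists_prop, Finset.mem_product]
    constructor
    · rintro ⟨⟨y, ⟨e, he, hy⟩, hx⟩, g, hg, hxg⟩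
      exact ⟨⟨e, g⟩, ⟨he, hg⟩, ⟨y, hy, hx⟩, hxg⟩
    · rintro ⟨⟨e, g⟩, ⟨he, hg⟩, ⟨y, hy, hx⟩, hxg⟩
      exact ⟨⟨y, ⟨e, he, hy⟩, hx⟩, g, hg, hxg⟩
  rw [hset, lk, ← Finset.sum_product']
  refine ncard_biUnion_subsingleton _ _ ?_ ?_
  · intro r hr
    obtain ⟨he, hg⟩ := Finset.mem_product.1 hr
    exact hp.subsingleton_coneFrom_inter (src_mem_W he) (tgt_mem_W he) (src_mem_W hg)
      (tgt_mem_W hg) (disjoint_seg hII hJJ he hg)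
  · rintro ⟨e, g⟩ hr ⟨e', g'⟩ hr' hne
    obtain ⟨he, hg⟩ := Finset.mem_product.1 hr
    obtain ⟨he', hg'⟩ := Finset.mem_product.1 hr'
    by_cases hgg : g = g'
    · subst hgg
      exact hd _ he _ he' _ hg fun h => hne (Prod.ext h rfl)
    · refine disjoint_left.2 fun x hx hx' => ?_
      have hxe : x ∈ K.seg e := by
        rcases eq_src_or_eq_tgt hg hg' hgg hx.2 hx'.2 with rfl | rfl
        · exact hp.mem_segment_of_mem_coneFrom (src_mem_W he) (tgt_mem_W he) (src_mem_W hg) hx.1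
        · exact hp.mem_segment_of_mem_coneFrom (src_mem_W he) (tgt_mem_W he) (tgt_mem_W hg) hx.1
      exact disjoint_left.1 (disjoint_seg hII hJJ he hg) hxe hx.2

theorem linkedMod2Curves {p : Fin 3 → ℝ} (hp : IsGeneric K.W p)
    (hI : Even I.card) (hJ : Even J.card) (hI' : Even I'.card) (hJ' : Even J'.card)
    (hII : Disjoint I I') (hJJ : Disjoint J J') (hlk : K.lk p I J I' J' = 1) :
    LinkedMod2Curves (⋃ e ∈ K.segs I J, K.seg e) (⋃ g ∈ K.segs I' J', K.seg g) := by
  have hS : (↑(K.segs I J ×ˢ K.segs I J ×ˢ K.segs I' J') ∩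
      {r : (Fin 4 × Fin 4 × ℕ) × (Fin 4 × Fin 4 × ℕ) × (Fin 4 × Fin 4 × ℕ) |
        r.1 ≠ r.2.1}).Countable :=
    ((Finset.finite_toSet _).inter_of_left _).countable
  have hdense := dense_biInter_of_isOpen (S := ↑(K.segs I J ×ˢ K.segs I J ×ˢ K.segs I' J') ∩
      {r : (Fin 4 × Fin 4 × ℕ) × (Fin 4 × Fin 4 × ℕ) × (Fin 4 × Fin 4 × ℕ) | r.1 ≠ r.2.1})
    (f := fun r => {q | Disjoint (coneFrom q (K.seg r.1) ∩ K.seg r.2.2)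
      (coneFrom q (K.seg r.2.1) ∩ K.seg r.2.2)})
    (fun r _ => isOpen_disjoint_coneFrom_inter _ _ _ _ _ _) hS (by
      rintro ⟨e, e', g⟩ ⟨hr, hne⟩
      simp only [Finset.coe_product, mem_prod, Finset.mem_coe] at hr
      obtain ⟨he, he', hg⟩ := hr
      refine ((dense_isGeneric K.finite_W).mono fun q hq => ?_).of_closure
      exact IsGeneric.mem_closure_disjoint hq (src_mem_W he) (tgt_mem_W he) (src_mem_W he')
        (tgt_mem_W he') (src_mem_W hg) (tgt_mem_W hg) (disjoint_seg hII hJJ he hg)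
        (disjoint_seg hII hJJ he' hg) fun x => eq_src_or_eq_tgt he he' hne)
  refine ((dense_isGeneric K.finite_W).inter_of_isOpen_left hdense
    (isOpen_isGeneric K.finite_W)).mono ?_
  rintro q ⟨hq, hq'⟩
  have h := ncard_coneFrom_inter hq hII hJJ fun e he e' he' g hg hne =>
    mem_iInter₂.1 hq' (e, e', g) ⟨by simp [he, he', hg], hne⟩
  refine ⟨h.1, (ZMod.natCast_eq_one_iff_odd).1 ?_⟩
  rw [h.2, lk_eq hq hp hI hJ hI' hJ' hII hJJ, hlk]

end PolygonalK44

/-- The cross product of the images of two vectors under the projection of `ℝ³` to the plane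
along `vertical ε`. -/
def planeCross (ε : ℝ) (u v : Fin 3 → ℝ) : ℝ :=
  (u 0 + ε * u 1) * v 2 - (v 0 + ε * v 1) * u 2

/-- The direction of projection. -/
def vertical (ε : ℝ) : Fin 3 → ℝ := ![-ε, 1, 0]

/-- The ray through `x` lies below the segment `a b`. -/
def Below (ε : ℝ) (x a b : Fin 3 → ℝ) : Prop :=
  ∃ r ≥ (0 : ℝ), ∃ s ≥ (0 : ℝ), r • x + s • vertical ε ∈ segment ℝ a b

/-- The ray through `x` lies above the segment `a b`. -/
def Above (ε : ℝ) (x a b : Fin 3 → ℝ) : Prop :=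
  ∃ r ≥ (0 : ℝ), ∃ s ≥ (0 : ℝ), r • x - s • vertical ε ∈ segment ℝ a b

/-- Two segments have points on a common ray. -/
def Crosses (x y a b : Fin 3 → ℝ) : Prop :=
  ∃ z ∈ segment ℝ x y, ∃ r > (0 : ℝ), r • z ∈ segment ℝ a b

theorem planeCross_comb (ε r s t : ℝ) (x a b : Fin 3 → ℝ) :
    planeCross ε x (r • a + s • b + t • vertical ε) =
      r * planeCross ε x a + s * planeCross ε x b := by
  simp [planeCross, vertical]; ring

theorem planeCross_swap (ε : ℝ) (x y : Fin 3 → ℝ) : planeCross ε y x = -planeCross ε x y := by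
  simp [planeCross]

theorem planeCross_self (ε : ℝ) (x : Fin 3 → ℝ) : planeCross ε x x = 0 := by
  simp [planeCross]

theorem comb_apply_two (ε r s t : ℝ) (a b : Fin 3 → ℝ) :
    (r • a + s • b + t • vertical ε) 2 = r * a 2 + s * b 2 := by
  simp [vertical]

theorem pos_of_mem_segment {a b z : Fin 3 → ℝ} (ha : 0 < a 2) (hb : 0 < b 2)
    (hz : z ∈ segment ℝ a b) : 0 < z 2 :=
  ((convex_Ioi (0 : ℝ)).is_linear_preimage
    (LinearMap.proj (R := ℝ) (φ := fun _ : Fin 3 => ℝ) 2).isLinear).segment_subset ha hb hz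

theorem linearIndependent_vertical {ε : ℝ} {a b : Fin 3 → ℝ} (hab : planeCross ε a b ≠ 0) :
    LinearIndependent ℝ ![a, b, vertical ε] := by
  rw [Fintype.linearIndependent_iff]
  intro g hg
  simp only [Fin.sum_univ_three, Matrix.cons_val_zero, Matrix.cons_val_one, Matrix.cons_val] at hg
  have h1 := planeCross_comb ε (g 0) (g 1) (g 2) a a b
  have h2 := planeCross_comb ε (g 0) (g 1) (g 2) b a b
  have h3 := congrFun hg 1
  have hz : ∀ x, planeCross ε x 0 = 0 := fun x => by simp [planeCross]
  rw [hg, hz, planeCross_self, mul_zero, zero_add, eq_comm, mul_eq_zero, or_iff_left hab] at h1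
  rw [hg, hz, planeCross_self, mul_zero, add_zero, planeCross_swap, eq_comm, mul_eq_zero,
    neg_eq_zero, or_iff_left hab] at h2
  simp [h1, h2, vertical] at h3
  intro i
  fin_cases i <;> assumption

theorem smul_mem_segment_of_eq {r s : ℝ} {x a b : Fin 3 → ℝ} {w : Fin 3 → ℝ} (hr : 0 ≤ r)
    (hs : 0 ≤ s) (hx : x + w = r • a + s • b) (hrs : 0 < r + s) :
    (r + s)⁻¹ • x + (r + s)⁻¹ • w ∈ segment ℝ a b := by
  refine ⟨r / (r + s), s / (r + s), by positivity, by positivity, by field_simp, ?_⟩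
  rw [← smul_add, hx, smul_add, smul_smul, smul_smul, div_eq_inv_mul, div_eq_inv_mul]

/-- Change of the position of two segments relative to each other, along their endpoints. -/
theorem ind_crosses {ε : ℝ} {x y a b : Fin 3 → ℝ} (hx : 0 < x 2) (hy : 0 < y 2) (ha : 0 < a 2)
    (hb : 0 < b 2) (hab : planeCross ε a b ≠ 0) (hax : planeCross ε a x ≠ 0)
    (hay : planeCross ε a y ≠ 0) (hbx : planeCross ε b x ≠ 0) (hby : planeCross ε b y ≠ 0)
    (hxab : ∀ r > (0 : ℝ), r • x ∉ segment ℝ a b) (hyab : ∀ r > (0 : ℝ), r • y ∉ segment ℝ a b)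
    (haxy : ∀ r > (0 : ℝ), r • a ∉ segment ℝ x y) (hbxy : ∀ r > (0 : ℝ), r • b ∉ segment ℝ x y) :
    ind (Crosses x y a b) =
      ind (Below ε x a b) + ind (Below ε y a b) + ind (Above ε a x y) + ind (Above ε b x y) := by
  let B := basisOfLinearIndependentOfCardEqFinrank (linearIndependent_vertical hab) (by simp)
  have hB : ⇑B = ![a, b, vertical ε] := by
    simp [B]
  -- coordinates with respect to `a`, `b`, `-vertical ε`
  let c : (Fin 3 → ℝ) → Fin 3 → ℝ := fun z => ![B.repr z 0, B.repr z 1, -B.repr z 2]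
  have hc : ∀ z, z = c z 0 • a + c z 1 • b + (-c z 2) • vertical ε := fun z => by
    have := B.sum_repr z
    simpa [Fin.sum_univ_three, hB, c, eq_comm] using this
  have hc' : ∀ r s t z, z = r • a + s • b + t • vertical ε → c z 0 = r ∧ c z 1 = s ∧ c z 2 = -t := by
    intro r s t z hz
    have : z = ∑ i, ![r, s, t] i • B i := by simpa [Fin.sum_univ_three, hB] using hz
    have h := B.repr_sum_self ![r, s, t]
    rw [← this] at h
    simp [c, h]
  have hline : ∀ t : ℝ, ∀ i, c x i + t * (c y i - c x i) = c (AffineMap.lineMap x y t) i := by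
    intro t i
    rw [AffineMap.lineMap_apply]
    fin_cases i <;> simp [c] <;> ring
  have hmem : ∀ z, z ∈ segment ℝ x y ↔ ∃ t ∈ Icc (0 : ℝ) 1, z = AffineMap.lineMap x y t := by
    intro z
    rw [segment_eq_image_lineMap]
    simp [eq_comm]
  have hD0 : ∀ z, planeCross ε b z = -(c z 0 * planeCross ε a b) := fun z => by
    conv_lhs => rw [hc z, planeCross_comb, planeCross_self, planeCross_swap]
    ring
  have hD1 : ∀ z, planeCross ε a z = c z 1 * planeCross ε a b := fun z => by
    conv_lhs => rw [hc z, planeCross_comb, planeCross_self]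
    ring
  have hh : ∀ z : Fin 3 → ℝ, z 2 = c z 0 * a 2 + c z 1 * b 2 := fun z => by
    conv_lhs => rw [hc z, comb_apply_two]
  have hpos : ∀ z : Fin 3 → ℝ, 0 < z 2 → 0 ≤ c z 0 → 0 ≤ c z 1 → 0 < c z 0 + c z 1 := by
    intro z hz h0 h1
    by_contra hle
    have e0 : c z 0 = 0 := by linarith
    have e1 : c z 1 = 0 := by linarith
    rw [hh z, e0, e1] at hz
    simp at hz
  have hcone : ∀ z : Fin 3 → ℝ, 0 < z 2 → ((∀ i, 0 ≤ c z i) ↔ Below ε z a b) := by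
    intro z hz
    constructor
    · intro h
      refine ⟨(c z 0 + c z 1)⁻¹, inv_nonneg.2 (add_nonneg (h 0) (h 1)),
        (c z 0 + c z 1)⁻¹ * c z 2, mul_nonneg (inv_nonneg.2 (add_nonneg (h 0) (h 1))) (h 2), ?_⟩
      rw [mul_smul]
      refine smul_mem_segment_of_eq (h 0) (h 1) ?_ (hpos z hz (h 0) (h 1))
      conv_lhs => enter [1]; rw [hc z]
      module
    · rintro ⟨r, hr, s, hs, hseg⟩
      have hr0 : r ≠ 0 := by
        rintro rfl
        have := pos_of_mem_segment ha hb hseg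
        simp [vertical] at this
      obtain ⟨σ, τ, hσ, hτ, -, he⟩ := hseg
      obtain ⟨h0, h1, h2⟩ := hc' (σ / r) (τ / r) (-(s / r)) z (by
        have : r • z = σ • a + τ • b - s • vertical ε := by rw [he]; module
        rw [← inv_smul_smul₀ hr0 z, this]
        module)
      have hr' : 0 < r := lt_of_le_of_ne hr hr0.symm
      intro i
      fin_cases i
      · simp only [Fin.zero_eta, h0]; positivity
      · simp only [Fin.mk_one, h1]; positivity
      · simp only [Fin.reduceFinMk, h2]; rw [neg_neg]; positivity
  have hint : ∀ z : Fin 3 → ℝ, 0 < z 2 → planeCross ε a z ≠ 0 → planeCross ε b z ≠ 0 →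
      (∀ r > (0 : ℝ), r • z ∉ segment ℝ a b) → (∀ i, 0 ≤ c z i) → ∀ i, 0 < c z i := by
    intro z hz haz hbz hray h i
    refine lt_of_le_of_ne (h i) fun e => ?_
    fin_cases i
    · exact hbz (by rw [hD0]; simp at e; simp [← e])
    · exact haz (by rw [hD1]; simp at e; simp [← e])
    · refine hray _ (inv_pos.2 (hpos z hz (h 0) (h 1))) ?_
      have hz' := hc z
      rw [show c z 2 = 0 from e.symm, neg_zero, zero_smul] at hz'
      simpa using smul_mem_segment_of_eq (w := 0) (h 0) (h 1) (by rwa [add_zero] at hz' ⊢)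
        (hpos z hz (h 0) (h 1))
  have key := sum_ind_face (c x) (fun i => c y i - c x i) (hint x hx hax hbx hxab)
    (by simpa using hint y hy hay hby hyab) (by
      intro t ht
      simp only [hline]
      have hz := (hmem _).2 ⟨t, ht, rfl⟩
      have hz2 := pos_of_mem_segment hx hy hz
      generalize (AffineMap.lineMap x y t : Fin 3 → ℝ) = z at hz hz2 ⊢
      intro h
      have n01 : c z 0 = 0 → c z 1 = 0 → False := fun e0 e1 => by
        have := hpos z hz2 (h 0) (h 1)
        rw [e0, e1, add_zero] at this
        exact this.false
      have n02 : c z 0 = 0 → c z 2 = 0 → False := fun e0 e2 => by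
        refine hbxy (c z 1) (lt_of_le_of_ne (h 1) fun e => n01 e0 e.symm) ?_
        have hz' := hc z
        rw [e0, e2] at hz'
        simp only [zero_smul, zero_add, neg_zero, add_zero] at hz'
        rwa [← hz']
      have n12 : c z 1 = 0 → c z 2 = 0 → False := fun e1 e2 => by
        refine haxy (c z 0) (lt_of_le_of_ne (h 0) fun e => n01 e.symm e1) ?_
        have hz' := hc z
        rw [e1, e2] at hz'
        simp only [zero_smul, neg_zero, add_zero] at hz'
        rwa [← hz']
      intro i j hi hj
      fin_cases i <;> fin_cases j <;> first
        | rfl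
        | exact (n01 hi hj).elim
        | exact (n01 hj hi).elim
        | exact (n02 hi hj).elim
        | exact (n02 hj hi).elim
        | exact (n12 hi hj).elim
        | exact (n12 hj hi).elim)
  have hex : ∀ q : (Fin 3 → ℝ) → Prop,
      (∃ t ∈ Icc (0 : ℝ) 1, q (AffineMap.lineMap x y t)) ↔ ∃ z ∈ segment ℝ x y, q z := by
    intro q
    constructor
    · rintro ⟨t, ht, hq⟩
      exact ⟨_, (hmem _).2 ⟨t, ht, rfl⟩, hq⟩
    · rintro ⟨z, hz, hq⟩
      obtain ⟨t, ht, rfl⟩ := (hmem z).1 hz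
      exact ⟨t, ht, hq⟩
  have face0 : (∃ z ∈ segment ℝ x y, c z 0 = 0 ∧ ∀ j, 0 ≤ c z j) ↔ Above ε b x y := by
    constructor
    · rintro ⟨z, hz, e, h⟩
      refine ⟨c z 1, h 1, c z 2, h 2, ?_⟩
      have hz' := hc z
      rw [e, zero_smul, zero_add, neg_smul, ← sub_eq_add_neg] at hz'
      rwa [← hz']
    · rintro ⟨r, hr, s, hs, hz⟩
      obtain ⟨h0, h1, h2⟩ := hc' 0 r (-s) _
        (show r • b - s • vertical ε = (0 : ℝ) • a + r • b + (-s) • vertical ε by module)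
      refine ⟨_, hz, h0, Fin.forall_fin_succ.2 ⟨h0.ge, Fin.forall_fin_two.2 ⟨?_, ?_⟩⟩⟩
      · exact hr.trans_eq h1.symm
      · exact hs.trans_eq ((neg_neg s).symm.trans h2.symm)
  have face1 : (∃ z ∈ segment ℝ x y, c z 1 = 0 ∧ ∀ j, 0 ≤ c z j) ↔ Above ε a x y := by
    constructor
    · rintro ⟨z, hz, e, h⟩
      refine ⟨c z 0, h 0, c z 2, h 2, ?_⟩
      have hz' := hc z
      rw [e, zero_smul, add_zero, neg_smul, ← sub_eq_add_neg] at hz'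
      rwa [← hz']
    · rintro ⟨r, hr, s, hs, hz⟩
      obtain ⟨h0, h1, h2⟩ := hc' r 0 (-s) _
        (show r • a - s • vertical ε = r • a + (0 : ℝ) • b + (-s) • vertical ε by module)
      refine ⟨_, hz, h1, Fin.forall_fin_succ.2 ⟨?_, Fin.forall_fin_two.2 ⟨h1.ge, ?_⟩⟩⟩
      · exact hr.trans_eq h0.symm
      · exact hs.trans_eq ((neg_neg s).symm.trans h2.symm)
  have face2 : (∃ z ∈ segment ℝ x y, c z 2 = 0 ∧ ∀ j, 0 ≤ c z j) ↔ Crosses x y a b := by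
    constructor
    · rintro ⟨z, hz, e, h⟩
      have hp := hpos z (pos_of_mem_segment hx hy hz) (h 0) (h 1)
      refine ⟨z, hz, _, inv_pos.2 hp, ?_⟩
      have hz' := hc z
      rw [e, neg_zero, zero_smul] at hz'
      simpa using smul_mem_segment_of_eq (w := 0) (h 0) (h 1) (by rwa [add_zero] at hz' ⊢) hp
    · rintro ⟨z, hz, r, hr, σ, τ, hσ, hτ, -, he⟩
      obtain ⟨h0, h1, h2⟩ := hc' (σ / r) (τ / r) 0 z (by
        rw [← inv_smul_smul₀ hr.ne' z, ← he]
        module)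
      rw [neg_zero] at h2
      refine ⟨z, hz, h2, Fin.forall_fin_succ.2 ⟨?_, Fin.forall_fin_two.2 ⟨?_, h2.ge⟩⟩⟩
      · exact (div_nonneg hσ hr.le).trans_eq h0.symm
      · exact (div_nonneg hτ hr.le).trans_eq h1.symm
  simp only [hline, add_sub_cancel] at key
  rw [ind_congr (hcone x hx), ind_congr (hcone y hy), Fin.sum_univ_three,
    ind_congr ((hex fun z => c z 0 = 0 ∧ ∀ j, 0 ≤ c z j).trans face0),
    ind_congr ((hex fun z => c z 1 = 0 ∧ ∀ j, 0 ≤ c z j).trans face1),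
    ind_congr ((hex fun z => c z 2 = 0 ∧ ∀ j, 0 ≤ c z j).trans face2)] at key
  linear_combination key - zmod_two_add_self (ind (Above ε a x y)) -
    zmod_two_add_self (ind (Above ε b x y))

theorem ind_below_add_ind_above {ε : ℝ} {x a b : Fin 3 → ℝ} (hx : 0 < x 2) (ha : 0 < a 2)
    (hb : 0 < b 2) (hxa : planeCross ε x a ≠ 0) (hxb : planeCross ε x b ≠ 0)
    (hxab : ∀ r > (0 : ℝ), r • x ∉ segment ℝ a b) :
    ind (Below ε x a b) + ind (Above ε x a b) =
      ind (0 < planeCross ε x a) + ind (0 < planeCross ε x b) := by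
  have hlin : ∀ σ τ : ℝ, planeCross ε x (σ • a + τ • b) =
      σ * planeCross ε x a + τ * planeCross ε x b := fun σ τ => by
    simpa using planeCross_comb ε σ τ 0 x a b
  have hray : ∀ r s : ℝ, planeCross ε x (r • x + s • vertical ε) = 0 := fun r s => by
    simpa [planeCross_self] using planeCross_comb ε r 0 s x x 0
  have hseg : ∀ {w}, w ∈ segment ℝ a b → planeCross ε x w = 0 →
      ¬ (0 < planeCross ε x a ↔ 0 < planeCross ε x b) := by
    rintro _ ⟨σ, τ, hσ, hτ, hστ, rfl⟩ hw hiff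
    rw [hlin] at hw
    rcases hxa.lt_or_gt with ha' | ha'
    · have hb' := hxb.lt_or_gt.resolve_right fun h => ha'.asymm (hiff.2 h)
      exact (convex_Iio (0 : ℝ) ha' hb' hσ hτ hστ).ne hw
    · exact (convex_Ioi (0 : ℝ) ha' (hiff.1 ha') hσ hτ hστ).ne' hw
  by_cases hiff : 0 < planeCross ε x a ↔ 0 < planeCross ε x b
  · rw [ind_congr hiff, zmod_two_add_self, ind_of_not, ind_of_not, add_zero]
    · rintro ⟨r, -, s, -, hw⟩
      rw [sub_eq_add_neg, ← neg_smul] at hw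
      exact hseg hw (hray r (-s)) hiff
    · rintro ⟨r, -, s, -, hw⟩
      exact hseg hw (hray r s) hiff
  · have hsum : ind (0 < planeCross ε x a) + ind (0 < planeCross ε x b) = 1 := by
      rw [← ind_add_ind_not (0 < planeCross ε x a), ind_congr (not_iff.1 hiff)]
    have hne : planeCross ε x b - planeCross ε x a ≠ 0 := fun e => hiff (by
      rw [sub_eq_zero.1 e])
    obtain ⟨w, hw, hw0⟩ : ∃ w ∈ segment ℝ a b, planeCross ε x w = 0 := by
      refine ⟨_, ⟨planeCross ε x b / (planeCross ε x b - planeCross ε x a),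
        -planeCross ε x a / (planeCross ε x b - planeCross ε x a), ?_, ?_, ?_, rfl⟩, ?_⟩
      · rcases hxa.lt_or_gt with ha' | ha' <;> rcases hxb.lt_or_gt with hb' | hb'
        · exact (hiff (by simp [ha'.le.not_gt, hb'.le.not_gt])).elim
        · exact div_nonneg hb'.le (by linarith)
        · exact div_nonneg_of_nonpos hb'.le (by linarith)
        · exact (hiff (by simp [ha', hb'])).elim
      · rcases hxa.lt_or_gt with ha' | ha' <;> rcases hxb.lt_or_gt with hb' | hb'
        · exact (hiff (by simp [ha'.le.not_gt, hb'.le.not_gt])).elim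
        · exact div_nonneg (by linarith) (by linarith)
        · exact div_nonneg_of_nonpos (by linarith) (by linarith)
        · exact (hiff (by simp [ha', hb'])).elim
      · field_simp
        ring
      · rw [hlin]
        field_simp
        ring
    have huniq : ∀ w' ∈ segment ℝ a b, planeCross ε x w' = 0 → w' = w := by
      rintro _ ⟨σ', τ', -, -, h', rfl⟩ hw'
      obtain ⟨σ, τ, -, -, h, rfl⟩ := hw
      rw [hlin] at hw0 hw'
      obtain rfl : τ = 1 - σ := by linarith
      obtain rfl : τ' = 1 - σ' := by linarith
      have : σ' = σ := mul_right_cancel₀ hne (by linear_combination hw0 - hw')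
      rw [this]
    have hw2 := pos_of_mem_segment ha hb hw
    obtain ⟨r, s, hr, hrs⟩ : ∃ r s : ℝ, 0 < r ∧ w = r • x + s • vertical ε := by
      refine ⟨w 2 / x 2, w 1 - w 2 / x 2 * x 1, div_pos hw2 hx, ?_⟩
      ext i
      fin_cases i
      · simp only [planeCross] at hw0
        simp [vertical]
        field_simp
        linear_combination -hw0
      · simp [vertical]
      · simp [vertical]
        field_simp
    have hs : s ≠ 0 := by
      rintro rfl
      rw [zero_smul, add_zero] at hrs
      exact hxab r hr (hrs ▸ hw)
    have hs' : ∀ r' s' : ℝ, r' • x + s' • vertical ε ∈ segment ℝ a b → s' = s := by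
      intro r' s' hmem
      have he := (huniq _ hmem (hray r' s')).trans hrs
      have h2 := congrFun he 2
      have h1 := congrFun he 1
      simp [vertical] at h1 h2
      rcases h2 with h2 | h2
      · rw [h2] at h1
        linarith
      · exact (hx.ne' h2).elim
    have hB : Below ε x a b ↔ 0 ≤ s :=
      ⟨fun ⟨r', _, s', hs0, hmem⟩ => hs' r' s' hmem ▸ hs0, fun h => ⟨r, hr.le, s, h, hrs ▸ hw⟩⟩
    have hA : Above ε x a b ↔ ¬ 0 ≤ s := by
      constructor
      · rintro ⟨r', _, s', hs0, hmem⟩ h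
        rw [sub_eq_add_neg, ← neg_smul] at hmem
        have := hs' r' _ hmem
        exact hs (le_antisymm (by rw [← this]; exact neg_nonpos.2 hs0) h)
      · intro h
        refine ⟨r, hr.le, -s, by linarith, ?_⟩
        rw [neg_smul, sub_neg_eq_add]
        exact hrs ▸ hw
    rw [hsum, ind_congr hB, ind_congr hA, ind_add_ind_not]

theorem mem_segment_sub_iff {p z a b : Fin 3 → ℝ} :
    z ∈ segment ℝ (a - p) (b - p) ↔ p + z ∈ segment ℝ a b := by
  rw [← mem_segment_translate ℝ p (x := z), add_sub_cancel, add_sub_cancel]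

namespace IsGeneric

variable {W : Set (Fin 3 → ℝ)} {p x y a b : Fin 3 → ℝ}

theorem smul_sub_notMem_segment (hp : IsGeneric W p) (hx : x ∈ W) (ha : a ∈ W) (hb : b ∈ W)
    (hxab : x ∉ segment ℝ a b) (r : ℝ) : r • (x - p) ∉ segment ℝ (a - p) (b - p) := by
  rintro ⟨σ, τ, hσ, hτ, hστ, h⟩
  have hr : r ≠ 1 := by
    rintro rfl
    refine hxab ⟨σ, τ, hσ, hτ, hστ, ?_⟩
    have hp' : p = σ • p + τ • p := by rw [← add_smul, hστ, one_smul]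
    have h' : σ • a + τ • b - (σ • p + τ • p) = x - p := by
      rw [← one_smul ℝ (x - p), ← h]; module
    rw [← hp'] at h'
    exact sub_left_injective h'
  have hr' : 1 - r ≠ 0 := sub_ne_zero.2 hr.symm
  refine hp.notMem_affineSpan_triple hx ha hb ?_
  have h' : (1 - r) • p = (-r) • x + σ • a + τ • b := by
    have hp' : p = (σ + τ) • p := by rw [hστ, one_smul]
    have : (1 - r) • p = (σ + τ) • p - r • p := by rw [← hp']; module
    rw [this]
    linear_combination (norm := module) -h
  rw [← inv_smul_smul₀ hr' p, h', smul_add, smul_add, smul_smul, smul_smul, smul_smul]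
  refine AffineSubspace.combination_three_mem ?_ (mem_affineSpan ℝ (by simp))
    (mem_affineSpan ℝ (by simp)) (mem_affineSpan ℝ (by simp))
  field_simp
  linear_combination hστ

theorem hit_add_hit (hp : IsGeneric W p) (hx : x ∈ W) (hy : y ∈ W) (ha : a ∈ W) (hb : b ∈ W)
    (hdisj : Disjoint (segment ℝ x y) (segment ℝ a b)) :
    hit p x y a b + hit p a b x y = ind (Crosses (x - p) (y - p) (a - p) (b - p)) := by
  have hpseg : ∀ {c d}, c ∈ W → d ∈ W → p ∉ segment ℝ c d := fun hc hd h =>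
    hp.notMem_affineSpan_triple hc hd hd (segment_subset_affineSubspace
      (mem_affineSpan ℝ (by simp)) (mem_affineSpan ℝ (by simp)) h)
  have key : ∀ {x y a b : Fin 3 → ℝ}, a ∈ W → b ∈ W →
      ((coneFrom p (segment ℝ x y) ∩ segment ℝ a b).Nonempty ↔
      ∃ z ∈ segment ℝ (x - p) (y - p), ∃ r : ℝ, 0 < r ∧ r ≤ 1 ∧
        r • z ∈ segment ℝ (a - p) (b - p)) := by
    intro x y a b ha hb
    constructor
    · rintro ⟨w, hw, hwab⟩
      obtain ⟨u, hu, hwu⟩ := mem_coneFrom_segment.1 hw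
      rw [segment_eq_image'] at hwu
      obtain ⟨r, hr, rfl⟩ := hwu
      refine ⟨u - p, mem_segment_sub_iff.2 (by rwa [add_sub_cancel]), r,
        lt_of_le_of_ne hr.1 ?_, hr.2, mem_segment_sub_iff.2 hwab⟩
      rintro rfl
      exact hpseg ha hb (by simpa using hwab)
    · rintro ⟨z, hz, r, hr, hr1, h⟩
      refine ⟨p + r • z, mem_coneFrom_segment.2 ⟨p + z, mem_segment_sub_iff.1 hz, ?_⟩,
        mem_segment_sub_iff.1 h⟩
      rw [segment_eq_image']
      exact ⟨r, ⟨hr.le, hr1⟩, by simp⟩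
  have hxy : (coneFrom p (segment ℝ x y) ∩ segment ℝ a b).Nonempty →
      Crosses (x - p) (y - p) (a - p) (b - p) := fun h => by
    obtain ⟨z, hz, r, hr, -, h⟩ := (key ha hb).1 h
    exact ⟨z, hz, r, hr, h⟩
  have hab : (coneFrom p (segment ℝ a b) ∩ segment ℝ x y).Nonempty →
      Crosses (x - p) (y - p) (a - p) (b - p) := fun h => by
    obtain ⟨z, hz, r, hr, -, h⟩ := (key hx hy).1 h
    exact ⟨r • z, h, r⁻¹, inv_pos.2 hr, by rwa [inv_smul_smul₀ hr.ne']⟩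
  have hor : Crosses (x - p) (y - p) (a - p) (b - p) →
      ¬ (coneFrom p (segment ℝ x y) ∩ segment ℝ a b).Nonempty →
      (coneFrom p (segment ℝ a b) ∩ segment ℝ x y).Nonempty := by
    rintro ⟨z, hz, r, hr, h⟩ hn
    refine (key hx hy).2 ⟨r • z, h, r⁻¹, inv_pos.2 hr, ?_, by rwa [inv_smul_smul₀ hr.ne']⟩
    refine inv_le_one_of_one_le₀ (le_of_not_ge fun hr1 => hn ?_)
    exact (key ha hb).2 ⟨z, hz, r, hr, hr1, h⟩
  have hnot : (coneFrom p (segment ℝ x y) ∩ segment ℝ a b).Nonempty →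
      ¬ (coneFrom p (segment ℝ a b) ∩ segment ℝ x y).Nonempty := by
    intro h1 h2
    have htop := hp.affineSpan_eq_top hx hy ha hb hdisj h1
    have htop' := hp.affineSpan_eq_top ha hb hx hy hdisj.symm h2
    obtain ⟨z, hz, r, hr, hr1, h⟩ := (key ha hb).1 h1
    obtain ⟨w, hw, s, hs, hs1, h'⟩ := (key hx hy).1 h2
    have cone : ∀ {c d u : Fin 3 → ℝ} (t : ℝ), u ∈ segment ℝ (c - p) (d - p) →
        p + t • u ∈ affineSpan ℝ {p, c, d} := by
      intro c d u t hu
      have := AffineMap.lineMap_mem t (mem_affineSpan ℝ (show p ∈ {p, c, d} by simp))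
        (segment_subset_affineSubspace (S := affineSpan ℝ {p, c, d}) (mem_affineSpan ℝ (by simp))
          (mem_affineSpan ℝ (by simp)) (mem_segment_sub_iff.1 hu))
      simpa [AffineMap.lineMap_apply, add_comm] using this
    have hz' : p + z ∈ affineSpan ℝ {p, a, b} := by
      simpa [inv_smul_smul₀ hr.ne'] using cone r⁻¹ h
    have hw' : p + w ∈ affineSpan ℝ {p, x, y} := by
      simpa [inv_smul_smul₀ hs.ne'] using cone s⁻¹ h'
    have e1 : p + z = p + s • w := subsingleton_inter_segment_of_affineSpan_eq_top
      htop' (affineSpan_triple_ne_top p a b) (mem_affineSpan ℝ (by simp))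
      (mem_affineSpan ℝ (by simp)) ⟨hz', mem_segment_sub_iff.1 hz⟩
      ⟨cone s hw, mem_segment_sub_iff.1 h'⟩
    have e2 : p + w = p + r • z := subsingleton_inter_segment_of_affineSpan_eq_top
      htop (affineSpan_triple_ne_top p x y) (mem_affineSpan ℝ (by simp))
      (mem_affineSpan ℝ (by simp)) ⟨hw', mem_segment_sub_iff.1 hw⟩
      ⟨cone r hz, mem_segment_sub_iff.1 h⟩
    have e1' : z = s • w := add_left_cancel e1
    have e2' : w = r • z := add_left_cancel e2
    have hz0 : z ≠ 0 := by
      rintro rfl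
      exact hpseg hx hy (by simpa using mem_segment_sub_iff.1 hz)
    have hsr : s * r = 1 := smul_left_injective ℝ hz0 (by
      simp only [mul_smul, one_smul]
      rw [← e2', ← e1'])
    have hr' : r = 1 := le_antisymm hr1 (by nlinarith)
    refine disjoint_left.1 hdisj (mem_segment_sub_iff.1 hz) ?_
    rw [hr', one_smul] at h
    exact mem_segment_sub_iff.1 h
  unfold hit
  by_cases h1 : (coneFrom p (segment ℝ x y) ∩ segment ℝ a b).Nonempty
  · rw [ind_of h1, ind_of_not (hnot h1), ind_of (hxy h1), add_zero]
  · rw [ind_of_not h1, zero_add]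
    exact ind_congr ⟨hab, fun h => hor h h1⟩

theorem exists_planeCross_ne_zero (hp : IsGeneric W p) (hW : W.Finite)
    (hpos : ∀ w ∈ W, 0 < (w - p) 2) :
    ∃ ε : ℝ, ∀ x ∈ W, ∀ y ∈ W, x ≠ y → planeCross ε (x - p) (y - p) ≠ 0 := by
  have hfin : (⋃ q ∈ {q ∈ W ×ˢ W | q.1 ≠ q.2},
      {ε : ℝ | planeCross ε (q.1 - p) (q.2 - p) = 0}).Finite := by
    refine ((hW.prod hW).subset (sep_subset _ _)).biUnion ?_
    rintro ⟨x, y⟩ ⟨⟨hx, hy⟩, hne⟩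
    refine Set.Subsingleton.finite fun ε hε δ hδ => ?_
    by_contra hεδ
    simp only [mem_ofPred_eq, planeCross] at hε hδ hx hy hne
    have hx2 := hpos x hx
    have hy2 := hpos y hy
    have h1 : (x - p) 1 * (y - p) 2 - (y - p) 1 * (x - p) 2 = 0 :=
      mul_left_cancel₀ (sub_ne_zero.2 hεδ) (by linear_combination hε - hδ)
    have h0 : (x - p) 0 * (y - p) 2 - (y - p) 0 * (x - p) 2 = 0 := by
      linear_combination hε - ε * h1
    refine hp.smul_sub_notMem_segment hx hy hy (by simpa using hne)
      ((y - p) 2 / (x - p) 2) ?_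
    rw [segment_same, mem_singleton_iff]
    ext i
    simp only [Pi.smul_apply, smul_eq_mul]
    fin_cases i <;> simp only [Fin.zero_eta, Fin.mk_one, Fin.reduceFinMk] <;> field_simp
    · linear_combination h0
    · linear_combination h1
  obtain ⟨ε, hε⟩ := hfin.infinite_compl.nonempty
  refine ⟨ε, fun x hx y hy hne h => hε ?_⟩
  exact mem_iUnion₂.2 ⟨(x, y), ⟨⟨hx, hy⟩, hne⟩, h⟩

end IsGeneric

theorem exists_isGeneric_below {W : Set (Fin 3 → ℝ)} (hW : W.Finite) :
    ∃ p, IsGeneric W p ∧ ∀ w ∈ W, 0 < (w - p) 2 := by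
  obtain ⟨m, hm⟩ := (hW.image fun w => w 2).bddBelow
  obtain ⟨p, hp, hp'⟩ := (dense_isGeneric hW).inter_open_nonempty {p : Fin 3 → ℝ | p 2 < m}
    (isOpen_lt (continuous_apply 2) continuous_const) ⟨fun _ => m - 1, by simp⟩
  refine ⟨p, hp', fun w hw => ?_⟩
  have := hm (mem_image_of_mem _ hw)
  simp only [mem_ofPred_eq, Pi.sub_apply] at hp this ⊢
  linarith

theorem sum_linking_eq_one (N : Fin 4 → Fin 4 → Fin 4 → Fin 4 → ZMod 2)
    (α β γ δ : Fin 4 → Fin 4 → Fin 4 → ZMod 2) (U : Fin 4 → ZMod 2) (T : Fin 4 → Fin 4 → ZMod 2)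
    (L : Fin 4 → Fin 4 → Fin 4 → Fin 4 → Fin 4 → Fin 4 → Fin 4 → Fin 4 → ZMod 2)
    (hN : ∀ i j i' j', i ≠ i' → j ≠ j' →
      N i j i' j' + N i' j' i j = α i i' j' + β j i' j' + γ i' i j + δ j' i j)
    (hU : ∀ j l, j ≠ l → β j 2 l + δ j 2 l = U j + T j l)
    (hT : ∀ j l, j ≠ l → T j l + T l j = 1)
    (hL : ∀ a b c d e f g h, a ≠ b → c ≠ d → e ≠ f → g ≠ h → L a b c d e f g h =
      N a c e g + N a c e h + N a c f g + N a c f h + N a d e g + N a d e h + N a d f g +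
      N a d f h + N b c e g + N b c e h + N b c f g + N b c f h + N b d e g + N b d e h +
      N b d f g + N b d f h) :
    L 0 1 0 1 2 3 2 3 + L 0 1 0 2 2 3 1 3 + L 0 1 0 3 2 3 2 1 +
    L 0 2 0 1 1 3 2 3 + L 0 2 0 2 1 3 1 3 + L 0 2 0 3 1 3 2 1 +
    L 0 3 0 1 2 1 2 3 + L 0 3 0 2 2 1 1 3 + L 0 3 0 3 2 1 2 1 = 1 := by
  simp (disch := decide) only [hL]
  have key := fun i i' (hi : i ≠ i') =>
    congrArg₂ (· + ·)
      (congrArg₂ (· + ·)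
        (congrArg₂ (· + ·) (hN i 1 i' 2 hi (by decide)) (hN i 1 i' 3 hi (by decide)))
        (congrArg₂ (· + ·) (hN i 2 i' 1 hi (by decide)) (hN i 2 i' 3 hi (by decide))))
      (congrArg₂ (· + ·) (hN i 3 i' 1 hi (by decide)) (hN i 3 i' 2 hi (by decide)))
  linear_combination (norm := (ring_nf; reduce_mod_char)) key 1 2 (by decide) +
    key 1 3 (by decide) + key 2 3 (by decide) + hU 1 2 (by decide) + hU 1 3 (by decide) +
    hU 2 1 (by decide) + hU 2 3 (by decide) + hU 3 1 (by decide) + hU 3 2 (by decide) +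
    hT 1 2 (by decide) + hT 1 3 (by decide) + hT 2 3 (by decide)

namespace PolygonalK44

variable {K : PolygonalK44} {I J I' J' : Finset (Fin 4)} {e g : Fin 4 × Fin 4 × ℕ}

/-- The number modulo `2` of segments of an edge that lie above a vertex, as seen from `p`. -/
def countBelow (K : PolygonalK44) (p : Fin 3 → ℝ) (ε : ℝ) (v : Fin 3 → ℝ) (i j : Fin 4) : ZMod 2 :=
  ∑ g ∈ K.segs {i} {j}, ind (Below ε (v - p) (K.src g - p) (K.tgt g - p))

/-- The number modulo `2` of segments of an edge that lie below a vertex, as seen from `p`. -/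
def countAbove (K : PolygonalK44) (p : Fin 3 → ℝ) (ε : ℝ) (v : Fin 3 → ℝ) (i j : Fin 4) : ZMod 2 :=
  ∑ g ∈ K.segs {i} {j}, ind (Above ε (v - p) (K.src g - p) (K.tgt g - p))

theorem sum_edge_src_add_tgt (φ : (Fin 3 → ℝ) → ZMod 2) (i j : Fin 4) :
    ∑ e ∈ K.segs {i} {j}, (φ (K.src e) + φ (K.tgt e)) = φ (K.A i) + φ (K.B j) := by
  rw [sum_segs, Finset.sum_singleton, Finset.sum_singleton]
  exact sum_range_src_add_tgt φ i j

theorem src_mem_seg : K.src e ∈ K.seg e := left_mem_segment ℝ _ _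

theorem tgt_mem_seg : K.tgt e ∈ K.seg e := right_mem_segment ℝ _ _

theorem B_mem_seg (i j : Fin 4) : ∃ e ∈ K.segs {i} {j}, K.B j ∈ K.seg e := by
  have := K.pos
  refine ⟨(i, j, K.n - 1), mem_segs.2 ⟨by simp, by simp, Nat.sub_lt this one_pos⟩, ?_⟩
  have h : K.tgt (i, j, K.n - 1) = K.B j := by
    rw [tgt, ← K.P_n i j, Nat.sub_add_cancel this]
  exact h ▸ tgt_mem_seg

theorem B_notMem_seg {i j l : Fin 4} (h : j ≠ l) (hg : g ∈ K.segs {i} {l}) :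
    K.B j ∉ K.seg g := by
  obtain ⟨e, he, hB⟩ := K.B_mem_seg (i + 1) j
  exact disjoint_left.1 (disjoint_seg (by simp) (by simpa using h) he hg) hB

theorem B_ne_B {j l : Fin 4} (h : j ≠ l) : K.B j ≠ K.B l := by
  intro e
  obtain ⟨g, hg, hB⟩ := K.B_mem_seg 0 l
  exact B_notMem_seg h hg (e ▸ hB)

variable {p : Fin 3 → ℝ} {ε : ℝ}

theorem hit_add_hit_seg (hp : IsGeneric K.W p) (hpos : ∀ w ∈ K.W, 0 < (w - p) 2)
    (hε : ∀ x ∈ K.W, ∀ y ∈ K.W, x ≠ y → planeCross ε (x - p) (y - p) ≠ 0)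
    (he : e ∈ K.segs I J) (hg : g ∈ K.segs I' J') (hd : Disjoint (K.seg e) (K.seg g)) :
    hit p (K.src e) (K.tgt e) (K.src g) (K.tgt g) + hit p (K.src g) (K.tgt g) (K.src e) (K.tgt e) =
      ind (Below ε (K.src e - p) (K.src g - p) (K.tgt g - p)) +
      ind (Below ε (K.tgt e - p) (K.src g - p) (K.tgt g - p)) +
      (ind (Above ε (K.src g - p) (K.src e - p) (K.tgt e - p)) +
      ind (Above ε (K.tgt g - p) (K.src e - p) (K.tgt e - p))) := by
  have hx := src_mem_W he
  have hy := tgt_mem_W he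
  have ha := src_mem_W hg
  have hb := tgt_mem_W hg
  have hne : ∀ {u v}, u ∈ K.seg e → v ∈ K.seg g → v ≠ u := fun hu hv h =>
    disjoint_left.1 hd hu (h ▸ hv)
  rw [hp.hit_add_hit hx hy ha hb hd, ind_crosses (ε := ε) (hpos _ hx) (hpos _ hy) (hpos _ ha)
    (hpos _ hb) (hε _ ha _ hb (src_ne_tgt hg)) (hε _ ha _ hx (hne src_mem_seg src_mem_seg))
    (hε _ ha _ hy (hne tgt_mem_seg src_mem_seg)) (hε _ hb _ hx (hne src_mem_seg tgt_mem_seg))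
    (hε _ hb _ hy (hne tgt_mem_seg tgt_mem_seg))
    (fun r _ => hp.smul_sub_notMem_segment hx ha hb (disjoint_left.1 hd src_mem_seg) r)
    (fun r _ => hp.smul_sub_notMem_segment hy ha hb (disjoint_left.1 hd tgt_mem_seg) r)
    (fun r _ => hp.smul_sub_notMem_segment ha hx hy (disjoint_right.1 hd src_mem_seg) r)
    (fun r _ => hp.smul_sub_notMem_segment hb hx hy (disjoint_right.1 hd tgt_mem_seg) r)]
  ring

theorem lk_add_lk (hp : IsGeneric K.W p) (hpos : ∀ w ∈ K.W, 0 < (w - p) 2)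
    (hε : ∀ x ∈ K.W, ∀ y ∈ K.W, x ≠ y → planeCross ε (x - p) (y - p) ≠ 0)
    {i j i' j' : Fin 4} (hi : i ≠ i') (hj : j ≠ j') :
    K.lk p {i} {j} {i'} {j'} + K.lk p {i'} {j'} {i} {j} =
      K.countBelow p ε (K.A i) i' j' + K.countBelow p ε (K.B j) i' j' +
      K.countAbove p ε (K.A i') i j + K.countAbove p ε (K.B j') i j := by
  rw [lk, lk, Finset.sum_comm (s := K.segs {i'} {j'})]
  simp only [← Finset.sum_add_distrib]
  rw [Finset.sum_congr rfl fun e he => Finset.sum_congr rfl fun g hg =>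
    hit_add_hit_seg hp hpos hε he hg (disjoint_seg (by simpa using hi) (by simpa using hj) he hg)]
  simp only [Finset.sum_add_distrib (f := fun g => ind (Below _ _ _ _) + ind (Below _ _ _ _))]
  rw [Finset.sum_add_distrib, Finset.sum_comm,
    Finset.sum_congr rfl fun g _ => sum_edge_src_add_tgt
      (fun x => ind (Below ε (x - p) (K.src g - p) (K.tgt g - p))) i j,
    Finset.sum_congr rfl fun e _ => sum_edge_src_add_tgt
      (fun x => ind (Above ε (x - p) (K.src e - p) (K.tgt e - p))) i' j',
    Finset.sum_add_distrib, Finset.sum_add_distrib, add_assoc _ (countAbove _ _ _ _ _ _)]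
  rfl

theorem countBelow_add_countAbove (hp : IsGeneric K.W p) (hpos : ∀ w ∈ K.W, 0 < (w - p) 2)
    (hε : ∀ x ∈ K.W, ∀ y ∈ K.W, x ≠ y → planeCross ε (x - p) (y - p) ≠ 0)
    {i j l : Fin 4} (h : j ≠ l) :
    K.countBelow p ε (K.B j) i l + K.countAbove p ε (K.B j) i l =
      ind (0 < planeCross ε (K.B j - p) (K.A i - p)) +
      ind (0 < planeCross ε (K.B j - p) (K.B l - p)) := by
  rw [countBelow, countAbove, ← Finset.sum_add_distrib,
    ← sum_edge_src_add_tgt (fun x => ind (0 < planeCross ε (K.B j - p) (x - p)))]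
  refine Finset.sum_congr rfl fun g hg => ?_
  have hB := K.B_notMem_seg h hg
  exact ind_below_add_ind_above (hpos _ (B_mem_W j)) (hpos _ (src_mem_W hg)) (hpos _ (tgt_mem_W hg))
    (hε _ (B_mem_W j) _ (src_mem_W hg) fun e => hB (e ▸ src_mem_seg))
    (hε _ (B_mem_W j) _ (tgt_mem_W hg) fun e => hB (e ▸ tgt_mem_seg))
    fun r _ => hp.smul_sub_notMem_segment (B_mem_W j) (src_mem_W hg) (tgt_mem_W hg) hB r

theorem exists_lk_eq_one (K : PolygonalK44) : ∃ p, IsGeneric K.W p ∧ ∃ σ τ : Equiv.Perm (Fin 4),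
    K.lk p {σ 0, σ 1} {τ 0, τ 1} {σ 2, σ 3} {τ 2, τ 3} = 1 := by
  obtain ⟨p, hp, hpos⟩ := exists_isGeneric_below K.finite_W
  obtain ⟨ε, hε⟩ := hp.exists_planeCross_ne_zero K.finite_W hpos
  refine ⟨p, hp, ?_⟩
  by_contra! hne
  have hzero : ∀ σ τ : Equiv.Perm (Fin 4),
      K.lk p {σ 0, σ 1} {τ 0, τ 1} {σ 2, σ 3} {τ 2, τ 3} = 0 := fun σ τ =>
    (show ∀ x : ZMod 2, x ≠ 1 → x = 0 by decide) _ (hne σ τ)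
  have key := sum_linking_eq_one (fun i j i' j' => K.lk p {i} {j} {i'} {j'})
    (fun i => K.countBelow p ε (K.A i)) (fun j => K.countBelow p ε (K.B j))
    (fun i => K.countAbove p ε (K.A i)) (fun j => K.countAbove p ε (K.B j))
    (fun j => ind (0 < planeCross ε (K.B j - p) (K.A 2 - p)))
    (fun j l => ind (0 < planeCross ε (K.B j - p) (K.B l - p)))
    (fun a b c d e f g h => K.lk p {a, b} {c, d} {e, f} {g, h})
    (fun i j i' j' => lk_add_lk hp hpos hε) (fun j l => countBelow_add_countAbove hp hpos hε)
    (fun j l h => by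
      have hne := hε _ (B_mem_W j) _ (B_mem_W l) (B_ne_B h)
      rw [planeCross_swap ε (K.B j - p) (K.B l - p), ← ind_add_ind_not
        (0 < planeCross ε (K.B j - p) (K.B l - p)), neg_pos, not_lt, hne.le_iff_lt])
    (fun a b c d e f g h hab hcd hef hgh => by
      simp only [lk, sum_segs, Finset.sum_pair hab, Finset.sum_pair hcd, Finset.sum_pair hef,
        Finset.sum_pair hgh, Finset.sum_singleton, Finset.sum_add_distrib]
      ring)
  have s12 : ∀ i : Fin 4, Equiv.swap (1 : Fin 4) 2 i = ![0, 2, 1, 3] i := by decide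
  have s13 : ∀ i : Fin 4, Equiv.swap (1 : Fin 4) 3 i = ![0, 3, 2, 1] i := by decide
  have h11 := hzero 1 1
  have h12 := hzero 1 (Equiv.swap 1 2)
  have h13 := hzero 1 (Equiv.swap 1 3)
  have h21 := hzero (Equiv.swap 1 2) 1
  have h22 := hzero (Equiv.swap 1 2) (Equiv.swap 1 2)
  have h23 := hzero (Equiv.swap 1 2) (Equiv.swap 1 3)
  have h31 := hzero (Equiv.swap 1 3) 1
  have h32 := hzero (Equiv.swap 1 3) (Equiv.swap 1 2)
  have h33 := hzero (Equiv.swap 1 3) (Equiv.swap 1 3)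
  simp only [s12, s13, Equiv.Perm.one_apply, Matrix.cons_val_zero, Matrix.cons_val_one,
    Matrix.cons_val] at h11 h12 h13 h21 h22 h23 h31 h32 h33
  simp [h11, h12, h13, h21, h22, h23, h31, h32, h33] at key

end PolygonalK44

theorem exists_partition {E : Set ℝ} (hE : E.Finite) (hE01 : E ⊆ Icc 0 1) (h0 : 0 ∈ E)
    (h1 : 1 ∈ E) : ∃ (n : ℕ) (t : ℕ → ℝ), 0 < n ∧ t 0 = 0 ∧ t n = 1 ∧ StrictMonoOn t (Iic n) ∧
      ∀ x ∈ E, ∀ k < n, x ≤ t k ∨ t (k + 1) ≤ x := by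
  lift E to Finset ℝ using hE
  simp only [Finset.mem_coe] at h0 h1
  have hcard : 1 < E.card := Finset.one_lt_card.2 ⟨0, h0, 1, h1, zero_ne_one⟩
  obtain ⟨n, hn⟩ : ∃ n, E.card = n + 1 := ⟨E.card - 1, by omega⟩
  set e := E.orderEmbOfFin hn
  have he : ∀ k, e k ∈ E := E.orderEmbOfFin_mem hn
  have hsurj : ∀ x ∈ E, ∃ k, e k = x := fun x hx => by
    have : x ∈ range e := by rw [Finset.range_orderEmbOfFin]; exact hx
    exact this
  have hval : ∀ k (hk : k ≤ n), e (Fin.ofNat (n + 1) k) = e ⟨k, Nat.lt_succ_of_le hk⟩ :=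
    fun k hk => congrArg e (Fin.ext (Nat.mod_eq_of_lt (Nat.lt_succ_of_le hk)))
  refine ⟨n, fun k => e (Fin.ofNat (n + 1) k), by omega, ?_, ?_, ?_, ?_⟩
  · obtain ⟨k, hk⟩ := hsurj 0 h0
    refine le_antisymm ?_ (hE01 (he _)).1
    rw [← hk]
    exact e.monotone (Fin.zero_le k)
  · obtain ⟨k, hk⟩ := hsurj 1 h1
    refine le_antisymm (hE01 (he _)).2 ?_
    simp only [hval n le_rfl]
    rw [← hk]
    exact e.monotone (Fin.le_last k)
  · intro a ha b hb hab
    simp only [hval a ha, hval b hb]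
    exact e.strictMono hab
  · intro x hx k hk
    obtain ⟨m, rfl⟩ := hsurj x hx
    simp only [hval k hk.le, hval (k + 1) hk]
    rcases le_or_gt m.1 k with h | h
    · exact Or.inl (e.monotone h)
    · exact Or.inr (e.monotone h)

theorem exists_partition_subset {S : Set (Set ℝ)} (hS : S.Finite) (hconv : ∀ s ∈ S, Convex ℝ s)
    (hclosed : ∀ s ∈ S, IsClosed s) : ∃ (n : ℕ) (t : ℕ → ℝ), 0 < n ∧ t 0 = 0 ∧ t n = 1 ∧
      StrictMonoOn t (Iic n) ∧
      ∀ s ∈ S, ∀ k < n, (Ioo (t k) (t (k + 1)) ∩ s).Nonempty → Icc (t k) (t (k + 1)) ⊆ s := by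
  have hcpt : ∀ s ∈ S, IsCompact (s ∩ Icc 0 1) := fun s hs =>
    isCompact_Icc.inter_left (hclosed s hs)
  let S' := {s ∈ S | (s ∩ Icc 0 1).Nonempty}
  have hS' : S'.Finite := hS.subset (sep_subset _ _)
  obtain ⟨n, t, hn, h0, h1, ht, h⟩ := exists_partition
    (E := {0, 1} ∪ ((fun s => sInf (s ∩ Icc 0 1)) '' S' ∪ (fun s => sSup (s ∩ Icc 0 1)) '' S'))
    ((toFinite _).union ((hS'.image _).union (hS'.image _)))
    (by
      rintro x ((rfl | rfl) | ⟨s, hs, rfl⟩ | ⟨s, hs, rfl⟩)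
      · simp
      · simp
      · exact ((hcpt s hs.1).sInf_mem hs.2).2
      · exact ((hcpt s hs.1).sSup_mem hs.2).2)
    (by simp) (by simp)
  refine ⟨n, t, hn, h0, h1, ht, fun s hs k hk ⟨x, ⟨hxk, hxk'⟩, hxs⟩ => ?_⟩
  have hx0 : 0 ≤ x := by
    rw [← h0]
    exact (ht.monotoneOn (Nat.zero_le n) hk.le (Nat.zero_le k)).trans hxk.le
  have hx1 : x ≤ 1 := by
    rw [← h1]
    exact hxk'.le.trans (ht.monotoneOn (show k + 1 ≤ n from hk) self_mem_Iic hk)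
  have hne : (s ∩ Icc 0 1).Nonempty := ⟨x, hxs, hx0, hx1⟩
  have hIcc := eq_Icc_of_connected_compact
    ⟨hne, ((hconv s hs).inter (convex_Icc 0 1)).isPreconnected⟩ (hcpt s hs)
  have hx : x ∈ s ∩ Icc 0 1 := ⟨hxs, hx0, hx1⟩
  rw [hIcc] at hx
  have hl := h _ (Or.inr (Or.inl ⟨s, ⟨hs, hne⟩, rfl⟩)) k hk
  have hr := h _ (Or.inr (Or.inr ⟨s, ⟨hs, hne⟩, rfl⟩)) k hk
  refine Subset.trans (fun y hy => ?_) (inter_subset_left (t := Icc 0 1))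
  rw [hIcc]
  refine ⟨le_trans ?_ hy.1, hy.2.trans ?_⟩
  · exact hl.resolve_right fun h => (hxk'.trans_le h).not_ge hx.1
  · exact hr.resolve_left fun h => (h.trans_lt hxk).not_ge hx.2

theorem exists_mem_Icc_of_partition {t : ℕ → ℝ} {n : ℕ} (hn : 0 < n) {x : ℝ} (h0 : t 0 ≤ x)
    (h1 : x ≤ t n) : ∃ k < n, x ∈ Icc (t k) (t (k + 1)) := by
  induction n, hn using Nat.le_induction with
  | base => exact ⟨0, one_pos, h0, h1⟩
  | succ n _ ih =>
    rcases le_total x (t n) with h | h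
    · obtain ⟨k, hk, hx⟩ := ih h
      exact ⟨k, hk.trans n.lt_succ_self, hx⟩
    · exact ⟨n, n.lt_succ_self, h, h1⟩

/-- Sixteen arcs, parametrised by the unit interval, that form an embedding of `K₄,₄`. -/
structure IsEmbeddedK44 (γ : Fin 4 → Fin 4 → ℝ → Fin 3 → ℝ) : Prop where
  eq_of_eq : ∀ {i j i' j' s s'}, s ∈ Icc (0 : ℝ) 1 → s' ∈ Icc (0 : ℝ) 1 →
    γ i j s = γ i' j' s' → s = s' ∧ (s ≠ 1 → i = i') ∧ (s ≠ 0 → j = j')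
  zero : ∀ i j j', γ i j 0 = γ i j' 0
  one : ∀ i i' j, γ i j 1 = γ i' j 1

theorem IsEmbeddedK44.exists_polygonalK44 {γ : Fin 4 → Fin 4 → ℝ → Fin 3 → ℝ}
    (hγ : IsEmbeddedK44 γ) {n : ℕ} {t : ℕ → ℝ} (hn : 0 < n) (h0 : t 0 = 0) (h1 : t n = 1)
    (ht : StrictMonoOn t (Iic n)) (hseg : ∀ i j, ∀ k < n,
      γ i j '' Icc (t k) (t (k + 1)) = segment ℝ (γ i j (t k)) (γ i j (t (k + 1)))) :
    ∃ K : PolygonalK44, ∀ I J, ⋃ e ∈ K.segs I J, K.seg e = ⋃ i ∈ I, ⋃ j ∈ J, γ i j '' Icc 0 1 := by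
  have hlt : ∀ k < n, t k < t (k + 1) := fun k hk => ht hk.le (show k + 1 ≤ n from hk) k.lt_succ_self
  have hle : ∀ {k l}, k ≤ l → l ≤ n → t k ≤ t l := fun hkl hl =>
    ht.monotoneOn (hkl.trans hl) hl hkl
  have h01 : ∀ {k}, k ≤ n → t k ∈ Icc (0 : ℝ) 1 := fun hk =>
    ⟨h0 ▸ hle (Nat.zero_le _) hk, h1 ▸ hle hk le_rfl⟩
  have hsub : ∀ {k}, k < n → Icc (t k) (t (k + 1)) ⊆ Icc 0 1 := fun hk =>
    Icc_subset_Icc (h01 hk.le).1 (h01 hk).2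
  let K : PolygonalK44 :=
    { n := n
      A := fun i => γ i 0 0
      B := fun j => γ 0 j 1
      P := fun i j k => γ i j (t k)
      pos := hn
      P_zero := fun i j => by rw [h0]; exact hγ.zero _ _ _
      P_n := fun i j => by rw [h1]; exact hγ.one _ _ _
      ne := fun i j k hk h => (hlt k hk).ne (hγ.eq_of_eq (h01 hk.le) (h01 hk) h).1
      disj := fun i j k hk i' j' k' hk' hi hj => by
        rw [← hseg i j k hk, ← hseg i' j' k' hk', disjoint_left]
        rintro _ ⟨s, hs, rfl⟩ ⟨s', hs', h⟩
        obtain ⟨-, h2, h3⟩ := hγ.eq_of_eq (hsub hk hs) (hsub hk' hs') h.symm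
        rcases eq_or_ne s 0 with rfl | h4
        · exact hi (h2 zero_ne_one)
        · exact hj (h3 h4)
      inter := fun i j k hk i' j' k' hk' hne x hx hx' => by
        rw [← hseg i j k hk] at hx
        rw [← hseg i' j' k' hk'] at hx'
        obtain ⟨s, hs, rfl⟩ := hx
        obtain ⟨s', hs', h⟩ := hx'
        obtain ⟨rfl, h2, h3⟩ := hγ.eq_of_eq (hsub hk hs) (hsub hk' hs') h.symm
        rcases lt_trichotomy k k' with hkk | rfl | hkk
        · exact Or.inr (congrArg _ (hs.2.antisymm ((hle hkk hk'.le).trans hs'.1)))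
        · rcases eq_or_ne s 0 with rfl | h4
          · exact Or.inl (congrArg _ ((h01 hk.le).1.antisymm hs.1))
          rcases eq_or_ne s 1 with rfl | h5
          · exact Or.inr (congrArg _ (hs.2.antisymm (h01 hk).2))
          · exact absurd (by rw [h2 h5, h3 h4]) hne
        · exact Or.inl (congrArg _ (le_antisymm (hs'.2.trans (hle hkk hk.le)) hs.1)) }
  refine ⟨K, fun I J => ?_⟩
  ext x
  simp only [mem_iUnion, exists_prop]
  constructor
  · rintro ⟨⟨i, j, k⟩, he, hx⟩
    obtain ⟨hi, hj, hk⟩ := PolygonalK44.mem_segs.1 he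
    have hx' : x ∈ γ i j '' Icc (t k) (t (k + 1)) := by rw [hseg i j k hk]; exact hx
    exact ⟨i, hi, j, hj, image_mono (hsub hk) hx'⟩
  · rintro ⟨i, hi, j, hj, s, hs, rfl⟩
    obtain ⟨k, hk, hsk⟩ := exists_mem_Icc_of_partition hn (h0 ▸ hs.1) (h1 ▸ hs.2)
    refine ⟨(i, j, k), PolygonalK44.mem_segs.2 ⟨hi, hj, hk⟩, ?_⟩
    have := mem_image_of_mem (γ i j) hsk
    rw [hseg i j k hk] at this
    exact this

/-- The edge of the geometric realization of `K₄,₄` joining two given vertices, as a path. -/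
def edgeMap (i j : Fin 4) : ℝ →ᵃ[ℝ] (Fin 4 ⊕ Fin 4 → ℝ) :=
  AffineMap.lineMap (vert (Sum.inl i)) (vert (Sum.inr j))

theorem edgeMap_inl (i j l : Fin 4) (s : ℝ) :
    edgeMap i j s (Sum.inl l) = if l = i then 1 - s else 0 := by
  simp [edgeMap, AffineMap.lineMap_apply_module, vert]

theorem edgeMap_inr (i j l : Fin 4) (s : ℝ) :
    edgeMap i j s (Sum.inr l) = if l = j then s else 0 := by
  simp [edgeMap, AffineMap.lineMap_apply_module, vert]

theorem edgeMap_image_Icc (i j : Fin 4) :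
    edgeMap i j '' Icc 0 1 = segment ℝ (vert (Sum.inl i)) (vert (Sum.inr j)) :=
  (segment_eq_image_lineMap ℝ _ _).symm

theorem edgeMap_mem_graphRealization (i j : Fin 4) {s : ℝ} (hs : s ∈ Icc (0 : ℝ) 1) :
    edgeMap i j s ∈ graphRealization (completeBipartiteGraph (Fin 4) (Fin 4)) := by
  refine mem_iUnion.2 ⟨⟨(Sum.inl i, Sum.inr j), by simp⟩, ?_⟩
  rw [← edgeMap_image_Icc]
  exact mem_image_of_mem _ hs

theorem edgeMap_eq_edgeMap {i j i' j' : Fin 4} {s s' : ℝ} (h : edgeMap i j s = edgeMap i' j' s') :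
    s = s' ∧ (s ≠ 1 → i = i') ∧ (s ≠ 0 → j = j') := by
  have hi := congrFun h (Sum.inl i)
  have hj := congrFun h (Sum.inr j)
  have hi' := congrFun h (Sum.inl i')
  simp only [edgeMap_inl, edgeMap_inr, if_true] at hi hj hi'
  by_cases hs : s = 0
  · subst hs
    have : i = i' := by
      by_contra h
      simp [h] at hi
    subst this
    simp only [if_true] at hi
    exact ⟨by linarith, fun _ => rfl, fun h => absurd rfl h⟩
  · have : j = j' := by
      by_contra h
      rw [if_neg h] at hj
      exact hs hj
    rw [if_pos this] at hj
    refine ⟨hj, fun hs1 => ?_, fun _ => this⟩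
    by_contra h
    rw [if_neg h] at hi
    exact hs1 (by linarith)

theorem isEmbeddedK44_of_injOn {f : ((Fin 4 ⊕ Fin 4) → ℝ) → (Fin 3 → ℝ)}
    (hInj : InjOn f (graphRealization (completeBipartiteGraph (Fin 4) (Fin 4)))) :
    IsEmbeddedK44 fun i j s => f (edgeMap i j s) where
  eq_of_eq hs hs' h := edgeMap_eq_edgeMap
    (hInj (edgeMap_mem_graphRealization _ _ hs) (edgeMap_mem_graphRealization _ _ hs') h)
  zero i j j' := by simp [edgeMap]
  one i i' j := by simp [edgeMap]

/-- An embedded piecewise linear `K₄,₄` is polygonal. -/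
theorem exists_polygonalK44 {f : ((Fin 4 ⊕ Fin 4) → ℝ) → (Fin 3 → ℝ)}
    (hPL : IsPLOn f (graphRealization (completeBipartiteGraph (Fin 4) (Fin 4))))
    (hInj : InjOn f (graphRealization (completeBipartiteGraph (Fin 4) (Fin 4)))) :
    ∃ K : PolygonalK44, ∀ I J, ⋃ e ∈ K.segs I J, K.seg e =
      f '' ⋃ i ∈ I, ⋃ j ∈ J, segment ℝ (vert (Sum.inl i)) (vert (Sum.inr j)) := by
  obtain ⟨T, hT, hpoly, hcov, haff⟩ := hPL
  have hcont : ∀ i j, Continuous (edgeMap i j) := fun i j => AffineMap.lineMap_continuous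
  obtain ⟨n, t, hn, h0, h1, ht, hsub⟩ := exists_partition_subset
    (S := image2 (fun (ij : Fin 4 × Fin 4) P => edgeMap ij.1 ij.2 ⁻¹' P) univ T)
    (finite_univ.image2 _ hT)
    (by
      rintro _ ⟨ij, -, P, hP, rfl⟩
      obtain ⟨Q, -, rfl⟩ := hpoly P hP
      exact (convex_convexHull ℝ Q).affine_preimage (edgeMap ij.1 ij.2))
    (by
      rintro _ ⟨ij, -, P, hP, rfl⟩
      obtain ⟨Q, hQ, rfl⟩ := hpoly P hP
      exact (hQ.isClosed_convexHull ℝ).preimage (hcont _ _))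
  obtain ⟨K, hK⟩ := (isEmbeddedK44_of_injOn hInj).exists_polygonalK44 hn h0 h1 ht
    fun i j k hk => by
      have hlt : t k < t (k + 1) := ht hk.le (show k + 1 ≤ n from hk) k.lt_succ_self
      have hIcc : Icc (t k) (t (k + 1)) ⊆ Icc 0 1 := Icc_subset_Icc
        (h0 ▸ ht.monotoneOn (Nat.zero_le n) hk.le (Nat.zero_le k))
        (h1 ▸ ht.monotoneOn (show k + 1 ≤ n from hk) self_mem_Iic hk)
      obtain ⟨m, hm⟩ := exists_between hlt
      obtain ⟨P, hP, hmP⟩ := hcov (edgeMap_mem_graphRealization i j (hIcc ⟨hm.1.le, hm.2.le⟩))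
      have hkP := hsub _ ⟨(i, j), mem_univ _, P, hP, rfl⟩ k hk ⟨m, hm, hmP⟩
      obtain ⟨g, hg⟩ := haff P hP
      have heq : EqOn (fun s => f (edgeMap i j s)) (g.comp (edgeMap i j))
          (Icc (t k) (t (k + 1))) := fun s hs =>
        hg ⟨hkP hs, edgeMap_mem_graphRealization i j (hIcc hs)⟩
      have hl := heq (left_mem_Icc.2 hlt.le)
      have hr := heq (right_mem_Icc.2 hlt.le)
      dsimp only at hl hr
      rw [heq.image_eq, hl, hr, ← segment_eq_Icc hlt.le, image_segment]
  refine ⟨K, fun I J => ?_⟩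
  simp only [hK, image_iUnion, ← edgeMap_image_Icc, image_image]

/-- The cycle of length four through given vertices of `K₄,₄`. -/
def fourCycle (i i' j j' : Fin 4) :
    (completeBipartiteGraph (Fin 4) (Fin 4)).Walk (Sum.inl i) (Sum.inl i) :=
  .cons (v := Sum.inr j) (by simp) <| .cons (v := Sum.inl i') (by simp) <|
    .cons (v := Sum.inr j') (by simp) <| .cons (by simp) .nil

theorem fourCycle_isCycle {i i' j j' : Fin 4} (hi : i ≠ i') (hj : j ≠ j') :
    (fourCycle i i' j j').IsCycle := by
  simp [fourCycle, SimpleGraph.Walk.cons_isCycle_iff, hi, hj, hi.symm]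

theorem mem_support_fourCycle {i i' j j' : Fin 4} {x : Fin 4 ⊕ Fin 4} :
    x ∈ (fourCycle i i' j j').support ↔
      x = Sum.inl i ∨ x = Sum.inl i' ∨ x = Sum.inr j ∨ x = Sum.inr j' := by
  simp only [fourCycle, SimpleGraph.Walk.support_cons, SimpleGraph.Walk.support_nil,
    List.mem_cons, List.not_mem_nil]
  tauto

theorem cycleSet_fourCycle (i i' j j' : Fin 4) :
    cycleSet (fourCycle i i' j j') = ⋃ a ∈ ({i, i'} : Finset (Fin 4)),
      ⋃ b ∈ ({j, j'} : Finset (Fin 4)), segment ℝ (vert (Sum.inl a)) (vert (Sum.inr b)) := by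
  have hedge : ∀ x y : Fin 4 ⊕ Fin 4, s(x, y) ∈ (fourCycle i i' j j').edges ↔
      ∃ a ∈ ({i, i'} : Finset (Fin 4)), ∃ b ∈ ({j, j'} : Finset (Fin 4)),
        s(x, y) = s(Sum.inl a, Sum.inr b) := by
    intro x y
    simp only [fourCycle, SimpleGraph.Walk.edges_cons, SimpleGraph.Walk.edges_nil,
      List.mem_cons, List.not_mem_nil, Finset.mem_insert, Finset.mem_singleton,
      exists_eq_or_imp, exists_eq_left, Sym2.eq_swap (a := Sum.inr j) (b := Sum.inl i'),
      Sym2.eq_swap (a := Sum.inr j') (b := Sum.inl i)]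
    tauto
  ext z
  simp only [cycleSet, mem_iUnion, exists_prop, Subtype.exists, Prod.exists]
  constructor
  · rintro ⟨x, y, hxy, hz⟩
    obtain ⟨a, ha, b, hb, hab⟩ := (hedge x y).1 hxy
    refine ⟨a, ha, b, hb, ?_⟩
    rcases Sym2.eq_iff.1 hab with ⟨rfl, rfl⟩ | ⟨rfl, rfl⟩
    · exact hz
    · rwa [segment_symm]
  · rintro ⟨a, ha, b, hb, hz⟩
    exact ⟨Sum.inl a, Sum.inr b, (hedge _ _).2 ⟨a, ha, b, hb, rfl⟩, hz⟩

/-- Sachs' theorem: every PL embedding of `K₄,₄` into `ℝ³` contains two vertex-disjoint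
cycles whose images have nonzero mod 2 linking number. -/
theorem sachs (f : ((Fin 4 ⊕ Fin 4) → ℝ) → (Fin 3 → ℝ))
    (hPL : IsPLOn f (graphRealization (completeBipartiteGraph (Fin 4) (Fin 4))))
    (hInj : InjOn f (graphRealization (completeBipartiteGraph (Fin 4) (Fin 4)))) :
    ∃ (a b : Fin 4 ⊕ Fin 4)
      (c : (completeBipartiteGraph (Fin 4) (Fin 4)).Walk a a)
      (d : (completeBipartiteGraph (Fin 4) (Fin 4)).Walk b b),
      c.IsCycle ∧ d.IsCycle ∧ (∀ x ∈ c.support, x ∉ d.support) ∧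
      LinkedMod2Curves (f '' cycleSet c) (f '' cycleSet d) := by
  obtain ⟨K, hK⟩ := exists_polygonalK44 hPL hInj
  obtain ⟨p, hp, σ, τ, hlk⟩ := K.exists_lk_eq_one
  have hcard : ∀ (ρ : Equiv.Perm (Fin 4)) {a b : Fin 4}, a ≠ b →
      Even ({ρ a, ρ b} : Finset (Fin 4)).card := fun ρ a b h => by
    rw [Finset.card_pair (ρ.injective.ne h)]
    exact even_two
  have hdisj : ∀ ρ : Equiv.Perm (Fin 4),
      Disjoint ({ρ 0, ρ 1} : Finset (Fin 4)) {ρ 2, ρ 3} := fun ρ => by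
    simp [ρ.injective.eq_iff]
  refine ⟨_, _, fourCycle (σ 0) (σ 1) (τ 0) (τ 1), fourCycle (σ 2) (σ 3) (τ 2) (τ 3),
    fourCycle_isCycle (σ.injective.ne (by decide)) (τ.injective.ne (by decide)),
    fourCycle_isCycle (σ.injective.ne (by decide)) (τ.injective.ne (by decide)), ?_, ?_⟩
  · intro x hx hx'
    rw [mem_support_fourCycle] at hx hx'
    rcases hx with rfl | rfl | rfl | rfl <;> simp [σ.injective.eq_iff, τ.injective.eq_iff] at hx'
  · rw [cycleSet_fourCycle, cycleSet_fourCycle, ← hK, ← hK]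
    exact PolygonalK44.linkedMod2Curves hp (hcard σ (by decide)) (hcard τ (by decide))
      (hcard σ (by decide)) (hcard τ (by decide)) (hdisj σ) (hdisj τ) hlk
end
end

section
/- There exists an almost embedding of the complete graph K₅ into the complete bipartite graph K₃,₃: a piecewise-linear map f : K₅ → K₃,₃ such that for any two disjoint closed simplices (vertices or edges) a, b of K₅ one has f(a) ∩ f(b) = ∅. -/
open Set

noncomputable section

/-- The closed cells (vertices and closed edges) of the realization of a graph. -/
def graphCells {V : Type*} [DecidableEq V] (G : SimpleGraph V) : Set (Set (V → ℝ)) :=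
  {c | (∃ v, c = {vert v}) ∨ ∃ u v, G.Adj u v ∧ c = segment ℝ (vert u) (vert v)}

/-- The PL map on `ℝ⁵` that sends vertex `0` to the midpoint of the edge `inl 2 — inr 2`, vertices
`1, 2` to `inl 0, inl 1`, vertices `3, 4` to `inr 0, inr 1`, and each edge of `K₅` to a shortest
path. -/
def almostEmb (x : Fin 5 → ℝ) : Fin 3 ⊕ Fin 3 → ℝ :=
  Sum.elim
    ![max 0 (x 1 - x 2 - x 0), max 0 (x 2 - x 1 - x 0),
      2 * min (x 3) (x 4) + 2 * min (x 0) (x 3 + x 4) + max 0 (x 0 - x 1 - x 2 - x 3 - x 4) / 2]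
    ![max 0 (x 3 - x 4 - x 0), max 0 (x 4 - x 3 - x 0),
      2 * min (x 1) (x 2) + 2 * min (x 0) (x 1 + x 2) + max 0 (x 0 - x 1 - x 2 - x 3 - x 4) / 2]

/-- On the cone spanned by `vert u` and `vert u + vert v`, the map `almostEmb` is linear. -/
lemma almostEmb_half (u v : Fin 5) (huv : u ≠ v) (a b : ℝ) (hb : 0 ≤ b) (hab : b ≤ a) :
    almostEmb (a • vert u + b • vert v) =
      a • almostEmb (vert u) + b • (almostEmb (vert u + vert v) - almostEmb (vert u)) := by
  have ha : 0 ≤ a := hb.trans hab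
  have hcases : ∀ w : Fin 5, w = 0 ∨ w = 1 ∨ w = 2 ∨ w = 3 ∨ w = 4 := by decide
  funext k
  rcases k with k | k <;> fin_cases k <;>
    simp only [almostEmb, Fin.zero_eta, Fin.mk_one, Fin.reduceFinMk, Sum.elim_inl, Sum.elim_inr,
      Matrix.cons_val, Pi.add_apply, Pi.sub_apply, Pi.smul_apply, smul_eq_mul, vert] <;>
    (rcases hcases u with rfl | rfl | rfl | rfl | rfl <;>
      rcases hcases v with rfl | rfl | rfl | rfl | rfl <;> first
      | exact absurd rfl huv
      | (simp only [Fin.reduceEq, if_true, if_false, mul_one, mul_zero, add_zero, zero_add]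
         grind))

lemma almostEmb_isPLOn : IsPLOn almostEmb (graphRealization (⊤ : SimpleGraph (Fin 5))) := by
  refine ⟨range fun p : {p : Fin 5 × Fin 5 // p.1 ≠ p.2} =>
    segment ℝ (vert p.1.1) ((1 / 2 : ℝ) • vert p.1.1 + (1 / 2 : ℝ) • vert p.1.2),
    finite_range _, ?_, ?_, ?_⟩
  · rintro _ ⟨p, rfl⟩
    exact ⟨{_, _}, by simp, (convexHull_pair _ _).symm⟩
  · intro x hx
    obtain ⟨⟨⟨u, v⟩, huv⟩, a, b, ha, hb, hab, rfl⟩ := mem_iUnion.1 hx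
    have huv : u ≠ v := huv
    rcases le_total b a with h | h
    · refine mem_sUnion.2 ⟨_, ⟨⟨(u, v), huv⟩, rfl⟩, a - b, 2 * b, by linarith, by linarith,
        by linarith, ?_⟩
      module
    · refine mem_sUnion.2 ⟨_, ⟨⟨(v, u), huv.symm⟩, rfl⟩, b - a, 2 * a, by linarith, by linarith,
        by linarith, ?_⟩
      module
  · rintro _ ⟨⟨⟨u, v⟩, huv⟩, rfl⟩
    have huv : u ≠ v := huv
    refine ⟨((LinearMap.proj u : (Fin 5 → ℝ) →ₗ[ℝ] ℝ).smulRight (almostEmb (vert u)) +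
      (LinearMap.proj v : (Fin 5 → ℝ) →ₗ[ℝ] ℝ).smulRight
        (almostEmb (vert u + vert v) - almostEmb (vert u))).toAffineMap, ?_⟩
    rintro _ ⟨⟨a, b, ha, hb, hab, rfl⟩, -⟩
    have key := almostEmb_half u v huv (a + b / 2) (b / 2) (by linarith) (by linarith)
    have hx : a • vert u + b • ((1 / 2 : ℝ) • vert u + (1 / 2 : ℝ) • vert v) =
        (a + b / 2) • (vert u : Fin 5 → ℝ) + (b / 2) • vert v := by module
    simp only
    rw [hx, key]
    simp [vert, huv, huv.symm]

lemma mem_realization_of_coords {y : Fin 3 ⊕ Fin 3 → ℝ} (h0 : ∀ k, 0 ≤ y k)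
    (hs : y (.inl 0) + y (.inl 1) + y (.inl 2) + y (.inr 0) + y (.inr 1) + y (.inr 2) = 1)
    {i j : Fin 3} (hl : ∀ i', i' ≠ i → y (.inl i') = 0) (hr : ∀ j', j' ≠ j → y (.inr j') = 0) :
    y ∈ graphRealization (completeBipartiteGraph (Fin 3) (Fin 3)) := by
  refine mem_iUnion.2 ⟨⟨(.inl i, .inr j), by simp⟩, y (.inl i), y (.inr j), h0 _, h0 _, ?_, ?_⟩
  · have h1 := Finset.sum_eq_single (s := Finset.univ) (f := fun i => y (.inl i)) i
      (fun i' _ h => hl i' h) (by simp)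
    have h2 := Finset.sum_eq_single (s := Finset.univ) (f := fun j => y (.inr j)) j
      (fun j' _ h => hr j' h) (by simp)
    simp only [Fin.sum_univ_three] at h1 h2
    linarith
  · funext k
    rcases k with k | k
    · by_cases h : k = i
      · simp [vert, h]
      · simp [vert, h, hl k h]
    · by_cases h : k = j
      · simp [vert, h]
      · simp [vert, h, hr k h]

lemma exists_forall_ne_eq_zero {g : Fin 3 → ℝ} (h01 : g 0 = 0 ∨ g 1 = 0) (h02 : g 0 = 0 ∨ g 2 = 0)
    (h12 : g 1 = 0 ∨ g 2 = 0) : ∃ i, ∀ j, j ≠ i → g j = 0 := by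
  simp only [Fin.exists_fin_succ, Fin.forall_fin_succ]
  grind

lemma eq_zero_of_mem_segment {V : Type*} [DecidableEq V] {u v i : V} {x : V → ℝ}
    (hx : x ∈ segment ℝ (vert u) (vert v)) (hu : i ≠ u) (hv : i ≠ v) : x i = 0 := by
  obtain ⟨a, b, -, -, -, rfl⟩ := hx
  simp [vert, hu, hv]

/-- The coordinates of a point of a (possibly degenerate) segment between two vertices. -/
structure IsEdgePoint {V : Type*} [Fintype V] (x : V → ℝ) : Prop where
  nonneg : ∀ i, 0 ≤ x i
  sum_eq : ∑ i, x i = 1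
  support : ∀ i j k, i ≠ j → i ≠ k → j ≠ k → x i = 0 ∨ x j = 0 ∨ x k = 0

lemma isEdgePoint_of_mem {V : Type*} [Fintype V] [DecidableEq V] {u v : V} {x : V → ℝ}
    (hx : x ∈ segment ℝ (vert u) (vert v)) : IsEdgePoint x := by
  obtain ⟨a, b, ha, hb, hab, rfl⟩ := hx
  refine ⟨fun i => ?_, ?_, fun i j k hij hik hjk => ?_⟩
  · simp only [vert, Pi.add_apply, Pi.smul_apply, smul_eq_mul]
    positivity
  · simp [vert, Finset.sum_add_distrib, hab]
  · simp only [vert, Pi.add_apply, Pi.smul_apply, smul_eq_mul]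
    grind

lemma almostEmb_mem {u v : Fin 5} {x : Fin 5 → ℝ} (hx : x ∈ segment ℝ (vert u) (vert v)) :
    almostEmb x ∈ graphRealization (completeBipartiteGraph (Fin 3) (Fin 3)) := by
  have hcases : ∀ w : Fin 5, w = 0 ∨ w = 1 ∨ w = 2 ∨ w = 3 ∨ w = 4 := by decide
  have hE := isEdgePoint_of_mem hx
  have n0 := hE.nonneg 0
  have n1 := hE.nonneg 1
  have n2 := hE.nonneg 2
  have n3 := hE.nonneg 3
  have n4 := hE.nonneg 4
  have hs := hE.sum_eq
  rw [Fin.sum_univ_five] at hs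
  have h0 : ∀ k, 0 ≤ almostEmb x k := by
    rintro (k | k) <;> fin_cases k <;> simp [almostEmb] <;> positivity
  have h013 := hE.support 0 1 3 (by decide) (by decide) (by decide)
  have h014 := hE.support 0 1 4 (by decide) (by decide) (by decide)
  have h023 := hE.support 0 2 3 (by decide) (by decide) (by decide)
  have h024 := hE.support 0 2 4 (by decide) (by decide) (by decide)
  have h123 := hE.support 1 2 3 (by decide) (by decide) (by decide)
  have h124 := hE.support 1 2 4 (by decide) (by decide) (by decide)
  have h134 := hE.support 1 3 4 (by decide) (by decide) (by decide)
  have h234 := hE.support 2 3 4 (by decide) (by decide) (by decide)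
  have hl01 : almostEmb x (.inl 0) = 0 ∨ almostEmb x (.inl 1) = 0 := by
    simp only [almostEmb, Sum.elim_inl, Matrix.cons_val]
    grind
  have hl02 : almostEmb x (.inl 0) = 0 ∨ almostEmb x (.inl 2) = 0 := by
    simp only [almostEmb, Sum.elim_inl, Matrix.cons_val]
    grind
  have hl12 : almostEmb x (.inl 1) = 0 ∨ almostEmb x (.inl 2) = 0 := by
    simp only [almostEmb, Sum.elim_inl, Matrix.cons_val]
    grind
  have hr01 : almostEmb x (.inr 0) = 0 ∨ almostEmb x (.inr 1) = 0 := by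
    simp only [almostEmb, Sum.elim_inr, Matrix.cons_val]
    grind
  have hr02 : almostEmb x (.inr 0) = 0 ∨ almostEmb x (.inr 2) = 0 := by
    simp only [almostEmb, Sum.elim_inr, Matrix.cons_val]
    grind
  have hr12 : almostEmb x (.inr 1) = 0 ∨ almostEmb x (.inr 2) = 0 := by
    simp only [almostEmb, Sum.elim_inr, Matrix.cons_val]
    grind
  obtain ⟨i, hi⟩ :=
    exists_forall_ne_eq_zero (g := fun i => almostEmb x (.inl i)) hl01 hl02 hl12
  obtain ⟨j, hj⟩ :=
    exists_forall_ne_eq_zero (g := fun i => almostEmb x (.inr i)) hr01 hr02 hr12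
  refine mem_realization_of_coords h0 ?_ hi hj
  simp only [almostEmb, Sum.elim_inl, Sum.elim_inr, Matrix.cons_val]
  have z : ∀ i, i ≠ u → i ≠ v → x i = 0 := fun i => eq_zero_of_mem_segment hx
  have z0 := z 0
  have z1 := z 1
  have z2 := z 2
  have z3 := z 3
  have z4 := z 4
  clear z hi hj hl01 hl02 hl12 hr01 hr02 hr12 h013 h014 h023 h024 h123 h124 h134 h234 h0 hE hx
  rcases hcases u with rfl | rfl | rfl | rfl | rfl <;>
    rcases hcases v with rfl | rfl | rfl | rfl | rfl <;>
    simp only [ne_eq, Fin.reduceEq, not_true, not_false_eq_true, true_implies, false_implies] at * <;>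
    grind

lemma almostEmb_ne_of_zero {x y : Fin 5 → ℝ} (hx : IsEdgePoint x) (hy : IsEdgePoint y)
    (hxy : ∀ i, x i = 0 ∨ y i = 0) (hy0 : y 0 = 0) : almostEmb x ≠ almostEmb y := by
  intro h
  have e1 := congrFun h (.inl 0)
  have e2 := congrFun h (.inl 1)
  have e3 := congrFun h (.inl 2)
  have e4 := congrFun h (.inr 0)
  have e5 := congrFun h (.inr 1)
  have e6 := congrFun h (.inr 2)
  simp only [almostEmb, hy0, Sum.elim_inl, Sum.elim_inr, Matrix.cons_val] at e1 e2 e3 e4 e5 e6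
  have sx := hx.sum_eq
  have sy := hy.sum_eq
  rw [Fin.sum_univ_five] at sx sy
  have x0 := hx.nonneg 0
  have x1 := hx.nonneg 1
  have x2 := hx.nonneg 2
  have x3 := hx.nonneg 3
  have x4 := hx.nonneg 4
  have y1 := hy.nonneg 1
  have y2 := hy.nonneg 2
  have y3 := hy.nonneg 3
  have y4 := hy.nonneg 4
  have h12 : y 1 = y 2 := by
    have := hxy 1
    have := hxy 2
    grind
  have h34 : y 3 = y 4 := by
    have := hxy 3
    have := hxy 4
    grind
  rcases hy.support 1 2 3 (by decide) (by decide) (by decide) with h' | h' | h'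
  · have := hxy 3
    have := hxy 4
    grind
  · have := hxy 3
    have := hxy 4
    grind
  · have := hxy 1
    have := hxy 2
    grind

lemma almostEmb_ne {x y : Fin 5 → ℝ} (hx : IsEdgePoint x) (hy : IsEdgePoint y)
    (hxy : ∀ i, x i = 0 ∨ y i = 0) : almostEmb x ≠ almostEmb y := by
  rcases hxy 0 with h | h
  · exact (almostEmb_ne_of_zero hy hx (fun i => (hxy i).symm) h).symm
  · exact almostEmb_ne_of_zero hx hy hxy h

/-- Every closed cell is a possibly degenerate segment between vertices. -/
lemma exists_eq_segment_of_mem_graphCells {V : Type*} [DecidableEq V] {G : SimpleGraph V}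
    {c : Set (V → ℝ)} (hc : c ∈ graphCells G) : ∃ u v, c = segment ℝ (vert u) (vert v) := by
  rcases hc with ⟨v, rfl⟩ | ⟨u, v, -, rfl⟩
  · exact ⟨v, v, (segment_same ℝ _).symm⟩
  · exact ⟨u, v, rfl⟩

lemma eq_zero_or_eq_zero_of_disjoint {V : Type*} [DecidableEq V] {u v u' v' : V}
    (h : Disjoint (segment ℝ (vert u) (vert v)) (segment ℝ (vert u') (vert v')))
    {x y : V → ℝ} (hx : x ∈ segment ℝ (vert u) (vert v))
    (hy : y ∈ segment ℝ (vert u') (vert v')) (i : V) : x i = 0 ∨ y i = 0 := by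
  by_contra! hne
  have h1 : vert i ∈ segment ℝ (vert u) (vert v) := by
    by_cases hu : i = u
    · exact hu ▸ left_mem_segment ℝ _ _
    by_cases hv : i = v
    · exact hv ▸ right_mem_segment ℝ _ _
    exact absurd (eq_zero_of_mem_segment hx hu hv) hne.1
  have h2 : vert i ∈ segment ℝ (vert u') (vert v') := by
    by_cases hu : i = u'
    · exact hu ▸ left_mem_segment ℝ _ _
    by_cases hv : i = v'
    · exact hv ▸ right_mem_segment ℝ _ _
    exact absurd (eq_zero_of_mem_segment hy hu hv) hne.2
  exact disjoint_left.1 h h1 h2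

/-- There is an almost embedding of `K₅` into `K₃,₃`: a PL map whose images of any two
disjoint closed cells (vertices or edges) of `K₅` are disjoint. -/
theorem K5_almost_embeds_in_K33 :
    ∃ f : (Fin 5 → ℝ) → ((Fin 3 ⊕ Fin 3) → ℝ),
      IsPLOn f (graphRealization (⊤ : SimpleGraph (Fin 5))) ∧
      f '' graphRealization (⊤ : SimpleGraph (Fin 5)) ⊆
        graphRealization (completeBipartiteGraph (Fin 3) (Fin 3)) ∧
      ∀ a ∈ graphCells (⊤ : SimpleGraph (Fin 5)),
        ∀ b ∈ graphCells (⊤ : SimpleGraph (Fin 5)),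
          Disjoint a b → Disjoint (f '' a) (f '' b) := by
  refine ⟨almostEmb, almostEmb_isPLOn, ?_, ?_⟩
  · rintro _ ⟨x, hx, rfl⟩
    obtain ⟨⟨⟨u, v⟩, huv⟩, hx⟩ := mem_iUnion.1 hx
    exact almostEmb_mem hx
  · intro a ha b hb hab
    obtain ⟨u, v, rfl⟩ := exists_eq_segment_of_mem_graphCells ha
    obtain ⟨u', v', rfl⟩ := exists_eq_segment_of_mem_graphCells hb
    rw [disjoint_left]
    rintro _ ⟨x, hx, rfl⟩ ⟨y, hy, hyx⟩
    exact almostEmb_ne (isEdgePoint_of_mem hx) (isEdgePoint_of_mem hy)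
      (eq_zero_or_eq_zero_of_disjoint hab hx hy) hyx.symm
end
end

section
/- If a compact polyhedron K does not embed piecewise-linearly into the sphere S^d, then the cone CK does not embed piecewise-linearly into ℝ^{d+1}. -/
open Set

noncomputable section

/-- The cone over a subset `K ⊆ E`, realized in `E × ℝ` with apex `(0, 1)`. -/
def coneOf {E : Type*} [AddCommGroup E] [Module ℝ E] (K : Set E) : Set (E × ℝ) :=
  ⋃ x ∈ K, segment ℝ (x, 0) (0, 1)

/-- A PL `d`-sphere: the boundary of the standard `(d+1)`-simplex in `ℝ^{d+2}`. -/
def stdSphere (d : ℕ) : Set (Fin (d + 2) → ℝ) :=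
  {x | (∀ i, 0 ≤ x i) ∧ ∑ i, x i = 1 ∧ ∃ i, x i = 0}

theorem PointedCone.mem_hull_insert {V : Type*} [AddCommGroup V] [Module ℝ V] {q y : V}
    {s : Set V} : y ∈ PointedCone.hull ℝ (insert q s) ↔
      ∃ t : ℝ, 0 ≤ t ∧ y - t • q ∈ PointedCone.hull ℝ s := by
  rw [PointedCone.hull, Submodule.mem_span_insert]
  constructor
  · rintro ⟨a, z, hz, rfl⟩
    refine ⟨a, a.2, ?_⟩
    have : a • q + z - (a : ℝ) • q = z := by
      exact add_sub_cancel_left ((a : ℝ) • q) z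
    rwa [this]
  · rintro ⟨t, ht, hz⟩
    refine ⟨⟨t, ht⟩, _, hz, ?_⟩
    change y = t • q + (y - t • q)
    abel

/-- One half of the Minkowski–Weyl theorem: a finitely generated cone is the solution set of
finitely many homogeneous linear inequalities. -/
theorem PointedCone.exists_finite_dual_of_finite {V : Type*} [AddCommGroup V] [Module ℝ V]
    [FiniteDimensional ℝ V] {s : Set V} (hs : s.Finite) :
    ∃ L : Set (Module.Dual ℝ V), L.Finite ∧
      ∀ y, y ∈ PointedCone.hull ℝ s ↔ ∀ l ∈ L, 0 ≤ l y := by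
  induction s, hs using Set.Finite.induction_on with
  | empty =>
    let B := Module.finBasis ℝ V
    refine ⟨range B.coord ∪ range (fun i => - B.coord i),
      (finite_range _).union (finite_range _), fun y => ?_⟩
    simp only [PointedCone.hull, Submodule.span_empty, Submodule.mem_bot]
    constructor
    · rintro rfl l -
      simp
    · intro h
      refine B.ext_elem fun i => ?_
      have h1 := h _ (Or.inl ⟨i, rfl⟩)
      have h2 := h _ (Or.inr ⟨i, rfl⟩)
      simp only [Module.Basis.coord_apply, LinearMap.neg_apply] at h1 h2
      simp only [map_zero, Finsupp.coe_zero, Pi.zero_apply]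
      linarith
  | @insert q s _ _ ih =>
    obtain ⟨L, hL, h⟩ := ih
    refine ⟨(L ∩ {l | 0 ≤ l q}) ∪ image2 (fun l₁ l₂ => l₁ q • l₂ - l₂ q • l₁)
      (L ∩ {l | 0 ≤ l q}) (L ∩ {l | l q < 0}),
      (hL.inter_of_left _).union ((hL.inter_of_left _).image2 _ (hL.inter_of_left _)),
      fun y => ?_⟩
    rw [PointedCone.mem_hull_insert]
    simp only [h, map_sub, map_smul, smul_eq_mul]
    constructor
    · rintro ⟨t, ht, hy⟩ l (⟨hl, hlq⟩ | ⟨l₁, ⟨hl₁, hq₁⟩, l₂, ⟨hl₂, hq₂⟩, rfl⟩)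
      · have := mul_nonneg ht hlq
        linarith [hy l hl]
      · simp only [LinearMap.sub_apply, LinearMap.smul_apply, smul_eq_mul, mem_ofPred_eq] at *
        nlinarith [mul_nonneg hq₁ (hy _ hl₂), mul_nonneg (neg_nonneg.2 hq₂.le) (hy _ hl₁)]
    · intro hy
      have hy₁ : ∀ l ∈ L, 0 ≤ l q → 0 ≤ l y := fun l hl hq => hy l (Or.inl ⟨hl, hq⟩)
      have hy₂ : ∀ l₁ ∈ L, 0 ≤ l₁ q → ∀ l₂ ∈ L, l₂ q < 0 → l₂ q * l₁ y ≤ l₁ q * l₂ y :=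
        fun l₁ h₁ hq₁ l₂ h₂ hq₂ => by
          simpa using hy _ (Or.inr ⟨l₁, ⟨h₁, hq₁⟩, l₂, ⟨h₂, hq₂⟩, rfl⟩)
      obtain hA | hA := (L ∩ {l | l q < 0 ∧ l y < 0}).eq_empty_or_nonempty
      · refine ⟨0, le_rfl, fun l hl => ?_⟩
        rw [zero_mul, sub_zero]
        by_contra! hc
        obtain hq | hq := le_or_gt 0 (l q)
        · exact hc.not_ge (hy₁ l hl hq)
        · exact eq_empty_iff_forall_notMem.1 hA l ⟨hl, hq, hc⟩
      · obtain ⟨m, ⟨hm, hmq, hmy⟩, hmax⟩ :=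
          exists_max_image _ (fun l : Module.Dual ℝ V => l y / l q) (hL.inter_of_left _) hA
        refine ⟨m y / m q, (div_pos_of_neg_of_neg hmy hmq).le, fun l hl => ?_⟩
        rw [sub_nonneg]
        obtain hq | hq := le_or_gt 0 (l q)
        · rw [div_mul_eq_mul_div, div_le_iff_of_neg hmq]
          linarith [hy₂ l hl hq m hm hmq]
        · obtain hly | hly := le_or_gt 0 (l y)
          · exact (mul_nonpos_of_nonneg_of_nonpos
              (div_pos_of_neg_of_neg hmy hmq).le hq.le).trans hly
          · exact (div_le_iff_of_neg hq).1 (hmax l ⟨hl, hq, hly⟩)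

section Arrangement

variable {V ι : Type*} [AddCommGroup V] [Module ℝ V] {L : Set (Module.Dual ℝ V)}

/-- The functionals of the arrangement `L` which are nonnegative at `y`. If `L` is closed under
negation, then `signPattern L y ⊆ signPattern L z` means that `z` lies in the smallest closed
cell of the arrangement which contains `y`. -/
def signPattern (L : Set (Module.Dual ℝ V)) (y : V) : Set (Module.Dual ℝ V) :=
  {l | l ∈ L ∧ 0 ≤ l y}

theorem signPattern_subset (L : Set (Module.Dual ℝ V)) (y : V) : signPattern L y ⊆ L :=
  fun _ hl => hl.1

theorem signPattern_zero (L : Set (Module.Dual ℝ V)) : signPattern L 0 = L := by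
  ext l
  simp [signPattern]

theorem signPattern_smul {t : ℝ} (ht : 0 < t) (y : V) :
    signPattern L (t • y) = signPattern L y := by
  ext l
  simp [signPattern, ht]

theorem signPattern_subset_sum_smul [Fintype ι] {w : ι → ℝ} (hw : ∀ i, 0 ≤ w i) {b : ι → V}
    {S : Set (Module.Dual ℝ V)} (hSL : S ⊆ L) (h : ∀ i, w i ≠ 0 → S ⊆ signPattern L (b i)) :
    S ⊆ signPattern L (∑ i, w i • b i) := by
  intro l hl
  refine ⟨hSL hl, ?_⟩
  simp only [map_sum, map_smul, smul_eq_mul]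
  refine Finset.sum_nonneg fun i _ => ?_
  obtain hi | hi := eq_or_ne (w i) 0
  · simp [hi]
  · exact mul_nonneg (hw i) (h i hi hl).2

theorem nonpos_of_signPattern_subset (hL : ∀ l ∈ L, -l ∈ L) {y z : V}
    (h : signPattern L y ⊆ signPattern L z) {l : Module.Dual ℝ V} (hl : l ∈ L) (hy : l y ≤ 0) :
    l z ≤ 0 := by
  simpa using (h (a := -l) ⟨hL l hl, by simpa using hy⟩).2

theorem pos_of_signPattern_eq (hL : ∀ l ∈ L, -l ∈ L) {y z : V}
    (h : signPattern L y = signPattern L z) {l : Module.Dual ℝ V} (hl : l ∈ L) (hy : 0 < l y) :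
    0 < l z := by
  by_contra! hz
  exact hy.not_ge (nonpos_of_signPattern_subset hL h.ge hl hz)

/-- Nonnegative weights on the points `b i` whose support is a chain of cells. -/
structure IsChainWeight (L : Set (Module.Dual ℝ V)) (b : ι → V) (w : ι → ℝ) : Prop where
  nonneg : ∀ i, 0 ≤ w i
  chain : ∀ i j, w i ≠ 0 → w j ≠ 0 →
    signPattern L (b i) ⊆ signPattern L (b j) ∨ signPattern L (b j) ⊆ signPattern L (b i)

theorem exists_isChainWeight [Fintype ι] (hfin : L.Finite) (hL : ∀ l ∈ L, -l ∈ L) {C : Set V}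
    (hC : ∀ y ∈ C, ∀ z, signPattern L y ⊆ signPattern L z → z ∈ C)
    {h : Module.Dual ℝ V} (hh : h ∈ L) (hpos : ∀ y ∈ C, y ≠ 0 → 0 < h y) {b : ι → V}
    (hb : ∀ y ∈ C, y ≠ 0 → ∃ i, signPattern L (b i) = signPattern L y) {y : V} (hy : y ∈ C) :
    ∃ w : ι → ℝ, IsChainWeight L b w ∧
      (∀ i, w i ≠ 0 → signPattern L y ⊆ signPattern L (b i)) ∧ ∑ i, w i • b i = y := by
  classical
  induction hn : (L \ signPattern L y).ncard using Nat.strong_induction_on generalizing y with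
  | _ n ih =>
  obtain rfl | hy0 := eq_or_ne y 0
  · exact ⟨0, ⟨by simp, by simp⟩, by simp, by simp⟩
  obtain ⟨i, hi⟩ := hb y hy hy0
  obtain ⟨m, ⟨hmL, hmy⟩, hmin⟩ :=
    exists_min_image {l : Module.Dual ℝ V | l ∈ L ∧ 0 < l y} (fun l => l y / l (b i))
      (hfin.subset fun l hl => hl.1) ⟨h, hh, hpos y hy hy0⟩
  have hmb : 0 < m (b i) := pos_of_signPattern_eq hL hi.symm hmL hmy
  set τ := m y / m (b i) with hτ
  have hτpos : 0 < τ := div_pos hmy hmb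
  have hsub : signPattern L y ⊆ signPattern L (y - τ • b i) := by
    rintro l ⟨hl, hly⟩
    refine ⟨hl, ?_⟩
    simp only [map_sub, map_smul, smul_eq_mul, sub_nonneg]
    obtain hly | hly := hly.eq_or_lt
    · rw [← hly]
      exact mul_nonpos_of_nonneg_of_nonpos hτpos.le
        (nonpos_of_signPattern_subset hL hi.ge hl hly.ge)
    · exact (le_div_iff₀ (pos_of_signPattern_eq hL hi.symm hl hly)).1 (hmin l ⟨hl, hly⟩)
  have hm₁ : -m ∈ signPattern L (y - τ • b i) := by
    refine ⟨hL m hmL, ?_⟩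
    simp [hτ, hmb.ne']
  have hm₂ : -m ∉ signPattern L y := fun hm => by
    have := hm.2
    simp only [LinearMap.neg_apply] at this
    linarith
  have hlt : (L \ signPattern L (y - τ • b i)).ncard < n := by
    rw [← hn]
    refine ncard_lt_ncard ⟨sdiff_subset_sdiff_right hsub, fun hc => ?_⟩ hfin.sdiff
    exact (hc ⟨hL m hmL, hm₂⟩).2 hm₁
  obtain ⟨w, hw, hwsub, hwsum⟩ := ih _ hlt (hC y hy _ hsub) rfl
  have hsupp : ∀ j, (w + (Pi.single i τ : ι → ℝ)) j ≠ 0 → j = i ∨ w j ≠ 0 := by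
    intro j hj
    by_contra! hc
    simp [hc.1, hc.2] at hj
  have key : ∀ j, (w + (Pi.single i τ : ι → ℝ)) j ≠ 0 → signPattern L y ⊆ signPattern L (b j) := by
    intro j hj
    obtain rfl | hj := hsupp j hj
    · exact hi.ge
    · exact hsub.trans (hwsub j hj)
  refine ⟨w + Pi.single i τ, ⟨fun j => add_nonneg (hw.nonneg j) ?_, fun j k hj hk => ?_⟩,
    key, ?_⟩
  · exact (Pi.single_nonneg.2 hτpos.le : (0 : ι → ℝ) ≤ Pi.single i τ) j
  · obtain rfl | hj' := hsupp j hj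
    · exact Or.inl (hi.trans_subset (key k hk))
    obtain rfl | hk' := hsupp k hk
    · exact Or.inr (hi.trans_subset (key j hj))
    exact hw.chain j k hj' hk'
  · simp only [Pi.add_apply, add_smul, Finset.sum_add_distrib, hwsum]
    rw [Finset.sum_eq_single i (by intro j _ hj; simp [hj]) (by simp)]
    simp

theorem IsChainWeight.exists_signPattern_eq [Fintype ι] (hL : ∀ l ∈ L, -l ∈ L) {b : ι → V}
    {w : ι → ℝ} (hw : IsChainWeight L b w) (hw0 : w ≠ 0) :
    ∃ i, w i ≠ 0 ∧ signPattern L (∑ i, w i • b i) = signPattern L (b i) := by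
  classical
  obtain ⟨i₀, hi₀⟩ := Function.ne_iff.1 hw0
  obtain ⟨i, hi, hmin⟩ := Finset.exists_minimalFor (fun i => signPattern L (b i))
    (Finset.univ.filter fun i => w i ≠ 0) ⟨i₀, by simpa using hi₀⟩
  simp only [Finset.mem_filter, Finset.mem_univ, true_and] at hi hmin
  have hsub : ∀ j, w j ≠ 0 → signPattern L (b i) ⊆ signPattern L (b j) := fun j hj =>
    (hw.chain i j hi hj).elim id fun h => hmin hj h
  refine ⟨i, hi, Subset.antisymm ?_
    (signPattern_subset_sum_smul hw.nonneg (signPattern_subset L _) hsub)⟩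
  rintro l ⟨hl, hl0⟩
  refine ⟨hl, ?_⟩
  by_contra! hlt
  refine hl0.not_gt ?_
  simp only [map_sum, map_smul, smul_eq_mul]
  refine Finset.sum_neg' (fun j _ => ?_) ⟨i, Finset.mem_univ i, ?_⟩
  · obtain hj | hj := eq_or_ne (w j) 0
    · simp [hj]
    · exact mul_nonpos_of_nonneg_of_nonpos (hw.nonneg j)
        (nonpos_of_signPattern_subset hL (hsub j hj) hl hlt.le)
  · exact mul_neg_of_pos_of_neg ((hw.nonneg i).lt_of_ne' hi) hlt

theorem IsChainWeight.eq_of_sum_eq [Fintype ι] (hL : ∀ l ∈ L, -l ∈ L) {b : ι → V}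
    (hb : Function.Injective fun i => signPattern L (b i)) {h : Module.Dual ℝ V} (hh : h ∈ L)
    (hpos : ∀ i, 0 < h (b i)) {w w' : ι → ℝ} (hw : IsChainWeight L b w)
    (hw' : IsChainWeight L b w') (heq : ∑ i, w i • b i = ∑ i, w' i • b i) : w = w' := by
  classical
  have hzero : ∀ v : ι → ℝ, IsChainWeight L b v → ∑ i, v i • b i = 0 → v = 0 := by
    intro v hv hv0
    by_contra hne
    obtain ⟨i, -, hi⟩ := hv.exists_signPattern_eq hL hne
    rw [hv0] at hi
    have := pos_of_signPattern_eq hL hi.symm hh (hpos i)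
    simp at this
  induction hn : (Finset.univ.filter fun i => w i ≠ 0).card +
    (Finset.univ.filter fun i => w' i ≠ 0).card using Nat.strong_induction_on
    generalizing w w' with
  | _ n ih =>
  by_cases hw0 : w = 0
  · subst hw0
    exact (hzero w' hw' (by simpa using heq.symm)).symm
  by_cases hw0' : w' = 0
  · subst hw0'
    exact hzero w hw (by simpa using heq)
  obtain ⟨i, hi, hpi⟩ := hw.exists_signPattern_eq hL hw0
  obtain ⟨j, hj, hpj⟩ := hw'.exists_signPattern_eq hL hw0'
  obtain rfl : i = j := hb (hpi.symm.trans ((congrArg (signPattern L) heq).trans hpj))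
  set μ := min (w i) (w' i) with hμ
  have hμpos : 0 < μ := lt_min ((hw.nonneg i).lt_of_ne' hi) ((hw'.nonneg i).lt_of_ne' hj)
  have hsupp : ∀ v : ι → ℝ, v i ≠ 0 → ∀ k, (v - (Pi.single i μ : ι → ℝ)) k ≠ 0 → v k ≠ 0 := by
    intro v hv k hk
    obtain rfl | hki := eq_or_ne k i
    · exact hv
    · simpa [hki] using hk
  have hchain : ∀ v : ι → ℝ, IsChainWeight L b v → v i ≠ 0 → μ ≤ v i →
      IsChainWeight L b (v - Pi.single i μ) := by
    intro v hv hvi hμv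
    refine ⟨fun k => ?_, fun k l hk hl => hv.chain k l (hsupp v hvi k hk) (hsupp v hvi l hl)⟩
    obtain rfl | hki := eq_or_ne k i
    · simpa using hμv
    · simpa [hki] using hv.nonneg k
  have hsum : ∀ v : ι → ℝ, ∑ k, (v - (Pi.single i μ : ι → ℝ)) k • b k = ∑ k, v k • b k - μ • b i := by
    intro v
    simp only [Pi.sub_apply, sub_smul, Finset.sum_sub_distrib]
    congr 1
    rw [Finset.sum_eq_single i (by intro j _ hj; simp [hj]) (by simp)]
    simp
  have hsubset : ∀ v : ι → ℝ, v i ≠ 0 →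
      (Finset.univ.filter fun k => (v - (Pi.single i μ : ι → ℝ)) k ≠ 0) ⊆
      Finset.univ.filter fun k => v k ≠ 0 := fun v hvi =>
    Finset.monotone_filter_right _ fun k _ => hsupp v hvi k
  have hssubset : ∀ v : ι → ℝ, v i ≠ 0 → μ = v i →
      (Finset.univ.filter fun k => (v - (Pi.single i μ : ι → ℝ)) k ≠ 0) ⊂
      Finset.univ.filter fun k => v k ≠ 0 := fun v hvi hv =>
    (hsubset v hvi).ssubset_of_mem_notMem (a := i) (by simpa using hvi) (by simp [hv])
  refine sub_left_injective (ih _ ?_ (hchain w hw hi (min_le_left _ _))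
    (hchain w' hw' hj (min_le_right _ _)) (by rw [hsum, hsum, heq]) rfl)
  rw [← hn]
  obtain hm | hm := min_choice (w i) (w' i)
  · exact add_lt_add_of_lt_of_le (Finset.card_lt_card (hssubset w hi hm))
      (Finset.card_le_card (hsubset w' hj))
  · exact add_lt_add_of_le_of_lt (Finset.card_le_card (hsubset w hi))
      (Finset.card_lt_card (hssubset w' hj hm))

theorem exists_linearMap_of_chain [Fintype ι] (hL : ∀ l ∈ L, -l ∈ L) {b : ι → V}
    (hb : Function.Injective fun i => signPattern L (b i)) {h : Module.Dual ℝ V} (hh : h ∈ L)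
    (hpos : ∀ i, 0 < h (b i)) {c : Set ι}
    (hc : ∀ i ∈ c, ∀ j ∈ c,
      signPattern L (b i) ⊆ signPattern L (b j) ∨ signPattern L (b j) ⊆ signPattern L (b i))
    {F : Type*} [AddCommGroup F] [Module ℝ F] (v : ι → F) :
    ∃ g : V →ₗ[ℝ] F, ∀ i ∈ c, g (b i) = v i := by
  classical
  let e := Fintype.linearCombination ℝ (fun i : c => b i)
  let ext : (c → ℝ) → ι → ℝ := fun u i => if hi : i ∈ c then u ⟨i, hi⟩ else 0
  have hext : ∀ u : c → ℝ, ∑ i, ext u i • b i = e u := by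
    intro u
    rw [Fintype.linearCombination_apply, ← Finset.sum_subset (Finset.subset_univ c.toFinset),
      Finset.sum_subtype (p := (· ∈ c)) _ (by simp)]
    · exact Finset.sum_congr rfl fun i _ => by simp [ext]
    · intro i _ hi
      simp [ext, mem_toFinset.not.1 hi]
  have hcw : ∀ u : c → ℝ, (∀ i, 0 ≤ u i) → IsChainWeight L b (ext u) := by
    intro u hu
    have hmem : ∀ i, ext u i ≠ 0 → i ∈ c := fun i hi => by
      by_contra hic
      simp [ext, hic] at hi
    refine ⟨fun i => ?_, fun i j hi hj => hc i (hmem i hi) j (hmem j hj)⟩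
    by_cases hi : i ∈ c
    · simpa [ext, hi] using hu ⟨i, hi⟩
    · simp [ext, hi]
  have hker : LinearMap.ker e = ⊥ := by
    rw [LinearMap.ker_eq_bot']
    intro u hu
    have h₁ : u = u⁺ - u⁻ := (posPart_sub_negPart u).symm
    rw [h₁, map_sub, sub_eq_zero, ← hext, ← hext] at hu
    have h₂ := (hcw _ fun i => posPart_nonneg u i).eq_of_sum_eq hL hb hh hpos
      (hcw _ fun i => negPart_nonneg u i) hu
    rw [h₁, sub_eq_zero]
    funext i
    simpa [ext] using congrFun h₂ i
  obtain ⟨g, hg⟩ := e.exists_leftInverse_of_injective hker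
  refine ⟨Fintype.linearCombination ℝ (fun i : c => v i) ∘ₗ g, fun i hi => ?_⟩
  have : e (Pi.single ⟨i, hi⟩ 1) = b i := by
    simp [e]
  have hgi := LinearMap.congr_fun hg (Pi.single ⟨i, hi⟩ 1)
  rw [LinearMap.comp_apply, this] at hgi
  rw [LinearMap.comp_apply, hgi]
  simp


/-- The cone with apex `0` over the image of `K` under `u`. -/
def coneOver {E V : Type*} [AddCommGroup V] [Module ℝ V] (u : E → V) (K : Set E) : Set V :=
  {y | ∃ t : ℝ, 0 ≤ t ∧ ∃ x ∈ K, y = t • u x}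

/-- Pseudo-radial projection: if the cone over `K` is a union of closed cells of a finite
arrangement of hyperplanes, then an injective map of this cone to the boundary of an orthant
which is linear on cells gives rise to a PL embedding of `K` in the boundary of a simplex. -/
theorem exists_isPLOn_injOn_of_linear_on_cells {E V κ : Type*} [AddCommGroup E] [Module ℝ E]
    [AddCommGroup V] [Module ℝ V] [Fintype κ] {L : Set (Module.Dual ℝ V)} (hfin : L.Finite)
    (hL : ∀ l ∈ L, -l ∈ L) {h : Module.Dual ℝ V} (hh : h ∈ L) {K : Set E} {u : E →ᵃ[ℝ] V}
    (hu : Function.Injective u) (huh : ∀ x, h (u x) = 1)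
    (hC : ∀ y ∈ coneOver u K, ∀ z, signPattern L y ⊆ signPattern L z → z ∈ coneOver u K)
    {G : V → κ → ℝ}
    (hG : ∀ y ∈ coneOver u K, ∃ B : V →ₗ[ℝ] κ → ℝ,
      ∀ z, signPattern L y ⊆ signPattern L z → G z = B z)
    (hinj : InjOn G (coneOver u K)) (hG0 : ∀ y ∈ coneOver u K, ∀ k, 0 ≤ G y k)
    (hGz : ∀ y ∈ coneOver u K, ∃ k, G y k = 0) :
    ∃ f : E → κ → ℝ, IsPLOn f K ∧ InjOn f K ∧
      ∀ x ∈ K, (∀ k, 0 ≤ f x k) ∧ ∑ k, f x k = 1 ∧ ∃ k, f x k = 0 := by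
  classical
  have huC : ∀ x ∈ K, u x ∈ coneOver u K := fun x hx => ⟨1, zero_le_one, x, hx, by simp⟩
  have hfinι : Finite ((fun x => signPattern L (u x)) '' K) := by
    refine (hfin.powerset.subset ?_).to_subtype
    rintro _ ⟨x, -, rfl⟩
    exact signPattern_subset L _
  have := Fintype.ofFinite ((fun x => signPattern L (u x)) '' K)
  set ι := ((fun x => signPattern L (u x)) '' K)
  choose p hpK hp using fun i : ι => i.2
  have hbinj : Function.Injective fun i : ι => signPattern L (u (p i)) := fun i j hij =>
    Subtype.ext ((hp i).symm.trans (hij.trans (hp j)))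
  have hbpos : ∀ i : ι, 0 < h (u (p i)) := fun i => (huh _).symm ▸ one_pos
  have hpos : ∀ y ∈ coneOver u K, y ≠ 0 → 0 < h y := by
    rintro _ ⟨t, ht, x, hx, rfl⟩ hy
    have : t ≠ 0 := by
      rintro rfl
      simp at hy
    simpa [huh] using ht.lt_of_ne' this
  have hb : ∀ y ∈ coneOver u K, y ≠ 0 → ∃ i : ι, signPattern L (u (p i)) = signPattern L y := by
    rintro _ ⟨t, ht, x, hx, rfl⟩ hy
    have : t ≠ 0 := by
      rintro rfl
      simp at hy
    rw [signPattern_smul (ht.lt_of_ne' this)]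
    exact ⟨⟨_, x, hx, rfl⟩, hp ⟨_, x, hx, rfl⟩⟩
  choose! w hw hwsub hwsum using fun x (hx : x ∈ K) =>
    exists_isChainWeight hfin hL hC hh hpos hb (huC x hx)
  set σ : ι → ℝ := fun i => ∑ k, G (u (p i)) k with hσ
  have hσpos : ∀ i, 0 < σ i := by
    intro i
    have hnn := hG0 _ (huC _ (hpK i))
    refine (Finset.sum_nonneg fun k _ => hnn k).lt_of_ne' fun h0 => ?_
    have hGi : G (u (p i)) = 0 := by
      funext k
      exact (Finset.sum_eq_zero_iff_of_nonneg fun k _ => hnn k).1 h0 k (Finset.mem_univ k)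
    have hsub : signPattern L (u (p i)) ⊆ signPattern L 0 := by
      rw [signPattern_zero]
      exact signPattern_subset L _
    obtain ⟨B, hB⟩ := hG _ (huC _ (hpK i))
    have := hinj (huC _ (hpK i)) (hC _ (huC _ (hpK i)) _ hsub)
      (hGi.trans ((hB 0 hsub).trans B.map_zero).symm)
    have h1 := huh (p i)
    simp [this] at h1
  -- on a chain of cells below `u x`, `G` commutes with nonnegative combinations
  have hGsum : ∀ x ∈ K, ∀ v : ι → ℝ, (∀ i, 0 ≤ v i) → (∀ i, v i ≠ 0 → w x i ≠ 0) →
      G (∑ i, v i • u (p i)) = ∑ i, v i • G (u (p i)) := by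
    intro x hx v hv hvw
    obtain ⟨B, hB⟩ := hG _ (huC x hx)
    rw [hB _ (signPattern_subset_sum_smul hv (signPattern_subset L _)
      fun i hi => hwsub x hx i (hvw i hi)), map_sum]
    refine Finset.sum_congr rfl fun i _ => ?_
    obtain hi | hi := eq_or_ne (v i) 0
    · simp [hi]
    · rw [map_smul, hB _ (hwsub x hx i (hvw i hi))]
  set f : E → κ → ℝ := fun x => ∑ i, w x i • (σ i)⁻¹ • G (u (p i)) with hf
  set z : E → V := fun x => ∑ i, (w x i * (σ i)⁻¹) • u (p i) with hz
  have hscale : ∀ x ∈ K, ∀ i, 0 ≤ w x i * (σ i)⁻¹ := fun x hx i =>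
    mul_nonneg ((hw x hx).nonneg i) (inv_nonneg.2 (hσpos i).le)
  have hzC : ∀ x ∈ K, z x ∈ coneOver u K := fun x hx =>
    hC _ (huC x hx) _ (signPattern_subset_sum_smul (hscale x hx) (signPattern_subset L _)
      fun i hi => hwsub x hx i (left_ne_zero_of_mul hi))
  have hGzf : ∀ x ∈ K, G (z x) = f x := by
    intro x hx
    simp only [hz, hf]
    rw [hGsum x hx _ (hscale x hx) fun i hi => left_ne_zero_of_mul hi]
    simp only [mul_smul]
  have hwz : ∀ x ∈ K, IsChainWeight L (fun i : ι => u (p i)) fun i => w x i * (σ i)⁻¹ :=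
    fun x hx => ⟨hscale x hx, fun i j hi hj =>
      (hw x hx).chain i j (left_ne_zero_of_mul hi) (left_ne_zero_of_mul hj)⟩
  have hw1 : ∀ x ∈ K, ∑ i, w x i = 1 := by
    intro x hx
    simpa [huh] using congrArg h (hwsum x hx)
  refine ⟨f, ?_, ?_, fun x hx => ⟨?_, ?_, ?_⟩⟩
  · refine ⟨(fun c : Set ι => convexHull ℝ (p '' c)) '' {c | ∀ i ∈ c, ∀ j ∈ c,
      signPattern L (u (p i)) ⊆ signPattern L (u (p j)) ∨
      signPattern L (u (p j)) ⊆ signPattern L (u (p i))}, toFinite _, ?_, ?_, ?_⟩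
    · rintro _ ⟨c, -, rfl⟩
      exact ⟨p '' c, toFinite _, rfl⟩
    · intro x hx
      refine ⟨_, ⟨{i | w x i ≠ 0}, fun i hi j hj => (hw x hx).chain i j hi hj, rfl⟩, ?_⟩
      have hx' : x = ∑ i ∈ Finset.univ.filter (fun i => w x i ≠ 0), w x i • p i := by
        refine hu ?_
        have h1 : ∑ i ∈ Finset.univ.filter (fun i => w x i ≠ 0), w x i = 1 := by
          rw [Finset.sum_filter_ne_zero, hw1 x hx]
        rw [← Finset.affineCombination_eq_linear_combination _ _ _ h1,
          Finset.map_affineCombination _ _ _ h1,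
          Finset.affineCombination_eq_linear_combination _ _ _ h1, Finset.sum_filter_of_ne]
        · exact (hwsum x hx).symm
        · intro i _ hi
          exact left_ne_zero_of_smul hi
      refine mem_of_eq_of_mem hx' ?_
      refine (convex_convexHull ℝ _).sum_mem (fun i _ => (hw x hx).nonneg i) ?_ ?_
      · rw [Finset.sum_filter_ne_zero, hw1 x hx]
      · intro i hi
        exact subset_convexHull ℝ _ ⟨i, by simpa using hi, rfl⟩
    · rintro _ ⟨c, hc, rfl⟩
      obtain ⟨g, hg⟩ := exists_linearMap_of_chain hL hbinj hh hbpos hc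
        fun i => (σ i)⁻¹ • G (u (p i))
      refine ⟨g.toAffineMap.comp u, ?_⟩
      rintro x ⟨hxc, hx⟩
      have hsub : convexHull ℝ (p '' c) ⊆ {x | ∃ v : ι → ℝ, (∀ i, 0 ≤ v i) ∧
          (∀ i, v i ≠ 0 → i ∈ c) ∧ ∑ i, v i • u (p i) = u x} := by
        refine convexHull_min ?_ ?_
        · rintro _ ⟨i, hi, rfl⟩
          refine ⟨Pi.single i 1, fun j => ?_, fun j hj => ?_, ?_⟩
          · exact (Pi.single_nonneg.2 zero_le_one : (0 : ι → ℝ) ≤ Pi.single i 1) j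
          · by_contra hjc
            exact hj (Pi.single_eq_of_ne (by rintro rfl; exact hjc hi) _)
          · rw [Finset.sum_eq_single i (by intro j _ hj; simp [hj]) (by simp)]
            simp
        · rintro y ⟨v, hv, hvc, hvy⟩ y' ⟨v', hv', hvc', hvy'⟩ a a' ha ha' haa
          refine ⟨a • v + a' • v', fun i => ?_, fun i hi => ?_, ?_⟩
          · exact add_nonneg (mul_nonneg ha (hv i)) (mul_nonneg ha' (hv' i))
          · by_contra hic
            have h1 := not_imp_comm.1 (hvc i) hic
            have h2 := not_imp_comm.1 (hvc' i) hic
            simp [h1, h2] at hi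
          · rw [Convex.combo_affine_apply haa, ← hvy, ← hvy']
            simp [add_smul, mul_smul, Finset.sum_add_distrib, Finset.smul_sum]
      obtain ⟨v, hv, hvc, hvx⟩ := hsub hxc
      have hvw : v = w x := IsChainWeight.eq_of_sum_eq hL hbinj hh hbpos
        ⟨hv, fun i j hi hj => hc i (hvc i hi) j (hvc j hj)⟩ (hw x hx)
        (hvx.trans (hwsum x hx).symm)
      simp only [AffineMap.comp_apply, LinearMap.coe_toAffineMap]
      rw [← hvx, map_sum]
      refine Finset.sum_congr rfl fun i _ => ?_
      rw [hvw, map_smul]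
      obtain hi | hi := eq_or_ne (w x i) 0
      · simp [hi]
      · rw [hg i (hvc i (hvw ▸ hi))]
  · intro x hx y hy hxy
    have hzxy : z x = z y :=
      hinj (hzC x hx) (hzC y hy) ((hGzf x hx).trans (hxy.trans (hGzf y hy).symm))
    have hww := (hwz x hx).eq_of_sum_eq hL hbinj hh hbpos (hwz y hy) hzxy
    have hwxy : w x = w y := by
      funext i
      exact mul_right_cancel₀ (inv_ne_zero (hσpos i).ne') (congrFun hww i)
    exact hu (by rw [← hwsum x hx, ← hwsum y hy, hwxy])
  · exact hGzf x hx ▸ hG0 _ (hzC x hx)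
  · simp only [hf, Finset.sum_apply, Pi.smul_apply, smul_eq_mul]
    rw [Finset.sum_comm, ← hw1 x hx]
    refine Finset.sum_congr rfl fun i _ => ?_
    rw [← Finset.mul_sum, ← Finset.mul_sum]
    change w x i * ((σ i)⁻¹ * σ i) = w x i
    rw [inv_mul_cancel₀ (hσpos i).ne', mul_one]
  · exact hGzf x hx ▸ hGz _ (hzC x hx)

end Arrangement

open Filter Topology

theorem smul_sub_mem_hull_of_mem_convexHull {W : Type*} [AddCommGroup W] [Module ℝ W] {Q : Set W}
    {c y : W} {t : ℝ} (ht : 0 < t) (h : c + t • y ∈ convexHull ℝ Q) :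
    y ∈ PointedCone.hull ℝ ((fun q => q - c) '' Q) := by
  have hsub : convexHull ℝ Q ⊆ {p | p - c ∈ PointedCone.hull ℝ ((fun q => q - c) '' Q)} := by
    refine convexHull_min (fun q hq => PointedCone.subset_hull ⟨q, hq, rfl⟩) ?_
    intro p hp q hq a b ha hb hab
    have : a • p + b • q - c = a • (p - c) + b • (q - c) := by
      calc a • p + b • q - c = a • p + b • q - (a + b) • c := by rw [hab, one_smul]
        _ = a • (p - c) + b • (q - c) := by module
    rw [mem_ofPred_eq, this]
    exact add_mem (PointedCone.smul_mem _ ha hp) (PointedCone.smul_mem _ hb hq)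
  have hmem : c + t • y - c ∈ PointedCone.hull ℝ ((fun q => q - c) '' Q) := hsub h
  rw [add_sub_cancel_left] at hmem
  exact (PointedCone.smul_mem_iff _ ht).1 hmem

theorem eventually_add_smul_mem_convexHull {W : Type*} [AddCommGroup W] [Module ℝ W] {Q : Set W}
    {c y : W} (hc : c ∈ convexHull ℝ Q)
    (hy : y ∈ PointedCone.hull ℝ ((fun q => q - c) '' Q)) :
    ∀ᶠ t in 𝓝[>] (0 : ℝ), c + t • y ∈ convexHull ℝ Q := by
  suffices h : ∃ t₀ > (0 : ℝ), ∀ t, 0 ≤ t → t ≤ t₀ → c + t • y ∈ convexHull ℝ Q by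
    obtain ⟨t₀, ht₀, h⟩ := h
    filter_upwards [Ioo_mem_nhdsGT ht₀] with t ht
    exact h t ht.1.le ht.2.le
  have hconv := convex_convexHull ℝ Q
  induction hy using Submodule.span_induction with
  | mem y hy =>
    obtain ⟨q, hq, rfl⟩ := hy
    refine ⟨1, one_pos, fun t ht ht₁ => ?_⟩
    exact hconv.add_smul_sub_mem hc (subset_convexHull ℝ Q hq) ⟨ht, ht₁⟩
  | zero => exact ⟨1, one_pos, fun t _ _ => by simpa using hc⟩
  | add y z _ _ hy hz =>
    obtain ⟨t₁, ht₁, h₁⟩ := hy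
    obtain ⟨t₂, ht₂, h₂⟩ := hz
    refine ⟨min t₁ t₂ / 2, by positivity, fun t ht htle => ?_⟩
    have h := hconv (h₁ (2 * t) (by linarith) (by linarith [min_le_left t₁ t₂]))
      (h₂ (2 * t) (by linarith) (by linarith [min_le_right t₁ t₂]))
      (a := 1 / 2) (b := 1 / 2) (by norm_num) (by norm_num) (by norm_num)
    convert h using 1
    module
  | smul a y _ hy =>
    obtain ⟨t₁, ht₁, h₁⟩ := hy
    have ha : (0 : ℝ) ≤ a := a.2
    refine ⟨t₁ / (a + 1), by positivity, fun t ht htle => ?_⟩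
    have h := h₁ (t * a) (by positivity) ?_
    · rwa [mul_smul] at h
    · rw [le_div_iff₀ (by positivity)] at htle
      linarith

theorem coneOver_convexHull {E V : Type*} [AddCommGroup E] [Module ℝ E] [AddCommGroup V]
    [Module ℝ V] (u : E →ᵃ[ℝ] V) {Q : Set E} (hQ : Q.Nonempty) :
    coneOver u (convexHull ℝ Q) = PointedCone.hull ℝ (u '' Q) := by
  have hconv := convex_convexHull ℝ Q
  obtain ⟨q₀, hq₀⟩ := hQ
  have hq₀ := subset_convexHull ℝ Q hq₀
  refine Subset.antisymm ?_ fun y hy => ?_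
  · rintro _ ⟨t, ht, x, hx, rfl⟩
    refine PointedCone.smul_mem _ ht ?_
    have hsub : convexHull ℝ Q ⊆ u ⁻¹' (PointedCone.hull ℝ (u '' Q)) :=
      convexHull_min (fun q hq => PointedCone.subset_hull ⟨q, hq, rfl⟩)
        ((PointedCone.convex _).affine_preimage u)
    exact hsub hx
  · induction hy using Submodule.span_induction with
    | mem y hy =>
      obtain ⟨q, hq, rfl⟩ := hy
      exact ⟨1, zero_le_one, q, subset_convexHull ℝ Q hq, (one_smul _ _).symm⟩
    | zero => exact ⟨0, le_rfl, q₀, hq₀, (zero_smul _ _).symm⟩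
    | add y z _ _ hy hz =>
      obtain ⟨t, ht, x, hx, rfl⟩ := hy
      obtain ⟨s, hs, x', hx', rfl⟩ := hz
      obtain h | h := (add_nonneg ht hs).eq_or_lt
      · obtain rfl : t = 0 := by linarith
        obtain rfl : s = 0 := by linarith
        exact ⟨0, le_rfl, q₀, hq₀, by simp⟩
      · have h1 : t / (t + s) + s / (t + s) = 1 := by rw [← add_div, div_self h.ne']
        refine ⟨t + s, h.le, (t / (t + s)) • x + (s / (t + s)) • x',
          hconv hx hx' (by positivity) (by positivity) h1, ?_⟩
        rw [Convex.combo_affine_apply h1, smul_add, smul_smul, smul_smul, mul_div_cancel₀ _ h.ne',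
          mul_div_cancel₀ _ h.ne']
    | smul a y _ hy =>
      obtain ⟨t, ht, x, hx, rfl⟩ := hy
      exact ⟨a * t, mul_nonneg a.2 ht, x, hx, (mul_smul (a : ℝ) t (u x)).symm⟩

/-- The derivative `H` of a PL map at a point `c`, along a set `C` of directions which stay in the
domain: it is linear on each of finitely many finitely generated cones which cover `C`. -/
theorem IsPLOn.exists_derivative {W F : Type*} [NormedAddCommGroup W] [NormedSpace ℝ W]
    [AddCommGroup F] [Module ℝ F] {g : W → F} {S : Set W} (hg : IsPLOn g S) {c : W} (hc : c ∈ S)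
    {C : Set W} (hC : ∀ y ∈ C, ∀ᶠ t in 𝓝[>] (0 : ℝ), c + t • y ∈ S) :
    ∃ (D : Set (PointedCone ℝ W)) (H : W → F), D.Finite ∧
      (∀ N ∈ D, ∃ s : Set W, s.Finite ∧ N = PointedCone.hull ℝ s) ∧ (∀ y ∈ C, ∃ N ∈ D, y ∈ N) ∧
      (∀ y ∈ C, ∀ᶠ t in 𝓝[>] (0 : ℝ), g (c + t • y) = g c + t • H y) ∧
      ∀ N ∈ D, ∃ A : W →ₗ[ℝ] F, ∀ y ∈ C, y ∈ N → H y = A y := by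
  obtain ⟨T, hT, hTQ, hST, hTg⟩ := hg
  choose! Q hQ hPQ using hTQ
  choose! A hA using hTg
  have hcover : ∀ y ∈ C, ∃ P ∈ T, c ∈ P ∧ y ∈ PointedCone.hull ℝ ((fun q => q - c) '' Q P) := by
    intro y hy
    have hfreq : ∃ P ∈ T, ∃ᶠ t in 𝓝[>] (0 : ℝ), c + t • y ∈ P := by
      by_contra! hcon
      have h := (eventually_all_finite hT).2 hcon
      obtain ⟨t, ht, hnot⟩ := ((hC y hy).and h).exists
      obtain ⟨P, hP, htP⟩ := hST ht
      exact hnot P hP htP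
    obtain ⟨P, hP, hf⟩ := hfreq
    refine ⟨P, hP, ?_, ?_⟩
    · have hclosed : IsClosed P := by
        rw [hPQ P hP]
        exact (hQ P hP).isClosed_convexHull ℝ
      refine hclosed.mem_of_frequently_of_tendsto hf ?_
      have : Tendsto (fun t : ℝ => c + t • y) (𝓝 0) (𝓝 (c + (0 : ℝ) • y)) :=
        (continuous_const.add (continuous_id.smul continuous_const) :
          Continuous fun t : ℝ => c + t • y).tendsto 0
      rw [zero_smul, add_zero] at this
      exact this.mono_left nhdsWithin_le_nhds
    · obtain ⟨t, htP, ht⟩ := (hf.and_eventually self_mem_nhdsWithin).exists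
      rw [hPQ P hP] at htP
      exact smul_sub_mem_hull_of_mem_convexHull ht htP
  have hlin : ∀ y ∈ C, ∀ P ∈ T, c ∈ P → y ∈ PointedCone.hull ℝ ((fun q => q - c) '' Q P) →
      ∀ᶠ t in 𝓝[>] (0 : ℝ), g (c + t • y) = g c + t • (A P).linear y := by
    intro y hy P hP hcP hyP
    have h := eventually_add_smul_mem_convexHull ((hPQ P hP).subset hcP) hyP
    rw [← hPQ P hP] at h
    filter_upwards [h, hC y hy] with t htP htS
    rw [hA P hP ⟨htP, htS⟩, hA P hP ⟨hcP, hc⟩, add_comm c, ← vadd_eq_add, AffineMap.map_vadd,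
      map_smul, vadd_eq_add, add_comm]
  choose! p hpT hcp hyp using hcover
  refine ⟨(fun P => PointedCone.hull ℝ ((fun q => q - c) '' Q P)) '' {P | P ∈ T ∧ c ∈ P},
    fun y => (A (p y)).linear y, (hT.subset fun P hP => hP.1).image _, ?_, ?_, ?_, ?_⟩
  · rintro _ ⟨P, ⟨hP, -⟩, rfl⟩
    exact ⟨_, (hQ P hP).image _, rfl⟩
  · intro y hy
    exact ⟨_, ⟨p y, ⟨hpT y hy, hcp y hy⟩, rfl⟩, hyp y hy⟩
  · intro y hy
    exact hlin y hy _ (hpT y hy) (hcp y hy) (hyp y hy)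
  · rintro _ ⟨P, ⟨hP, hcP⟩, rfl⟩
    refine ⟨(A P).linear, fun y hy hyP => ?_⟩
    obtain ⟨t, ⟨h₁, h₂⟩, ht⟩ := (((hlin y hy _ (hpT y hy) (hcp y hy) (hyp y hy)).and
      (hlin y hy P hP hcP hyP)).and self_mem_nhdsWithin).exists
    exact smul_right_injective F (ne_of_gt ht) (add_left_cancel (h₁.symm.trans h₂))

/-- The inclusion of `ℝ^n` as the hyperplane `x 0 = 0` of `ℝ^(n+1)`. -/
def consZero (n : ℕ) : (Fin n → ℝ) →ₗ[ℝ] Fin (n + 1) → ℝ :=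
  LinearMap.pi (Fin.cases 0 fun i => LinearMap.proj i)

theorem consZero_zero {n : ℕ} (v : Fin n → ℝ) : consZero n v 0 = 0 := rfl

theorem consZero_succ {n : ℕ} (v : Fin n → ℝ) (i : Fin n) : consZero n v i.succ = v i := rfl

/-- The PL homeomorphism from `ℝ^n` to the boundary of the positive orthant of `ℝ^(n+1)` which
translates each point along the diagonal. -/
def toOrthantBoundary {n : ℕ} (v : Fin n → ℝ) (k : Fin (n + 1)) : ℝ :=
  consZero n v k - ⨅ l, consZero n v l

theorem toOrthantBoundary_nonneg {n : ℕ} (v : Fin n → ℝ) (k : Fin (n + 1)) :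
    0 ≤ toOrthantBoundary v k :=
  sub_nonneg.2 (ciInf_le (finite_range _).bddBelow k)

theorem exists_toOrthantBoundary_eq_zero {n : ℕ} (v : Fin n → ℝ) :
    ∃ k, toOrthantBoundary v k = 0 := by
  obtain ⟨k, hk⟩ := exists_eq_ciInf_of_finite (f := consZero n v)
  exact ⟨k, sub_eq_zero.2 hk⟩

theorem toOrthantBoundary_of_le {n : ℕ} {v : Fin n → ℝ} {k : Fin (n + 1)}
    (h : ∀ l, consZero n v k ≤ consZero n v l) (l : Fin (n + 1)) :
    toOrthantBoundary v l = consZero n v l - consZero n v k := by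
  rw [toOrthantBoundary, le_antisymm (ciInf_le (finite_range _).bddBelow k) (le_ciInf h)]

theorem toOrthantBoundary_injective {n : ℕ} :
    Function.Injective (toOrthantBoundary : (Fin n → ℝ) → Fin (n + 1) → ℝ) := by
  intro v w hvw
  have h₀ := congrFun hvw 0
  simp only [toOrthantBoundary, consZero_zero] at h₀
  funext i
  have hi := congrFun hvw i.succ
  simp only [toOrthantBoundary, consZero_succ] at hi
  linarith

/-- The affine map sending `x` to the direction from the apex of the cone over `K` to `(x, 0)`. -/
def apexDirection (E : Type*) [AddCommGroup E] [Module ℝ E] : E →ᵃ[ℝ] E × ℝ :=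
  (AffineMap.id ℝ E).prod (AffineMap.const ℝ E (-1))

theorem apexDirection_apply {E : Type*} [AddCommGroup E] [Module ℝ E] (x : E) :
    apexDirection E x = (x, -1) := rfl

theorem eventually_mem_coneOf {E : Type*} [AddCommGroup E] [Module ℝ E] {K : Set E} {y : E × ℝ}
    (hy : y ∈ coneOver (apexDirection E) K) :
    ∀ᶠ t in 𝓝[>] (0 : ℝ), ((0, 1) : E × ℝ) + t • y ∈ coneOf K := by
  obtain ⟨s, hs, x, hx, rfl⟩ := hy
  have h₀ : (0 : ℝ) < 1 / (s + 1) := by positivity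
  filter_upwards [Ioo_mem_nhdsGT h₀] with t ht
  have hts : t * s ≤ 1 := by
    have := (lt_div_iff₀ (by positivity)).1 ht.2
    linarith [ht.1]
  refine mem_biUnion hx ⟨t * s, 1 - t * s, mul_nonneg ht.1.le hs, sub_nonneg.2 hts, by ring, ?_⟩
  rw [apexDirection_apply]
  ext
  · simp [smul_smul]
  · simp
    ring

/-- Finitely many finitely generated cones are unions of closed cells of some finite arrangement
of hyperplanes, which may be chosen to contain any given finite set of functionals. -/
theorem exists_arrangement {V : Type*} [AddCommGroup V] [Module ℝ V] [FiniteDimensional ℝ V]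
    {D : Set (PointedCone ℝ V)} (hD : D.Finite)
    (hDfg : ∀ N ∈ D, ∃ s : Set V, s.Finite ∧ N = PointedCone.hull ℝ s)
    {M : Set (Module.Dual ℝ V)} (hM : M.Finite) :
    ∃ L : Set (Module.Dual ℝ V), L.Finite ∧ (∀ l ∈ L, -l ∈ L) ∧ M ⊆ L ∧
      ∀ N ∈ D, ∀ y ∈ N, ∀ z, signPattern L y ⊆ signPattern L z → z ∈ N := by
  have h : ∀ N ∈ D, ∃ L : Set (Module.Dual ℝ V), L.Finite ∧
      ∀ y, y ∈ N ↔ ∀ l ∈ L, 0 ≤ l y := by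
    intro N hN
    obtain ⟨s, hs, rfl⟩ := hDfg N hN
    exact PointedCone.exists_finite_dual_of_finite hs
  choose! L hL hLN using h
  set L₀ := M ∪ ⋃ N ∈ D, L N
  have hL₀ : L₀.Finite := hM.union (hD.biUnion hL)
  refine ⟨L₀ ∪ Neg.neg '' L₀, hL₀.union (hL₀.image _), ?_,
    subset_union_left.trans subset_union_left, fun N hN y hy z hyz => ?_⟩
  · rintro l (hl | ⟨l, hl, rfl⟩)
    · exact Or.inr ⟨l, hl, rfl⟩
    · exact Or.inl (by rwa [neg_neg])
  · exact (hLN N hN z).2 fun l hl =>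
      (hyz ⟨Or.inl (Or.inr (mem_biUnion hN hl)), (hLN N hN y).1 hy l hl⟩).2

/-- If a compact polyhedron `K` does not embed piecewise linearly into the sphere `S^d`,
then the cone `CK` does not embed piecewise linearly into `ℝ^{d+1}`. -/
theorem cone_not_embeddable {m d : ℕ} (K : Set (Fin m → ℝ)) (hK : IsPolyhedron K)
    (h : ¬ ∃ f : (Fin m → ℝ) → (Fin (d + 2) → ℝ),
      IsPLOn f K ∧ InjOn f K ∧ f '' K ⊆ stdSphere d) :
    ¬ ∃ g : ((Fin m → ℝ) × ℝ) → (Fin (d + 1) → ℝ),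
      IsPLOn g (coneOf K) ∧ InjOn g (coneOf K) := by
  rintro ⟨g, hg, hginj⟩
  apply h
  obtain rfl | ⟨x₀, hx₀⟩ := K.eq_empty_or_nonempty
  · exact ⟨0, ⟨∅, by simp, by simp, by simp, by simp⟩, by simp, by simp⟩
  set u := apexDirection (Fin m → ℝ) with hu
  set C := coneOver u K with hCdef
  have hapex : ((0, 1) : (Fin m → ℝ) × ℝ) ∈ coneOf K :=
    mem_biUnion hx₀ (right_mem_segment ℝ _ _)
  obtain ⟨D, H, hD, hDfg, hDC, hHg, hHA⟩ := hg.exists_derivative hapex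
    (C := C) fun y hy => eventually_mem_coneOf hy
  choose! A hA using hHA
  have hHinj : InjOn H C := by
    intro y hy z hz hyz
    obtain ⟨t, ⟨⟨h₁, h₂⟩, h₃, h₄⟩, ht⟩ := ((((hHg y hy).and (hHg z hz)).and
      ((eventually_mem_coneOf hy).and (eventually_mem_coneOf hz))).and
      self_mem_nhdsWithin).exists
    rw [hyz, ← h₂] at h₁
    exact smul_right_injective _ (ne_of_gt ht) (add_left_cancel (hginj h₃ h₄ h₁))
  obtain ⟨T, hT, hTQ, hKT⟩ := hK
  choose! Q hQ hPQ using hTQ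
  have hcone : ∀ P ∈ T, P.Nonempty → coneOver u P = PointedCone.hull ℝ (u '' Q P) := by
    intro P hP hne
    rw [← coneOver_convexHull u (convexHull_nonempty_iff.1 (hPQ P hP ▸ hne)), ← hPQ P hP]
  let D' : Set (PointedCone ℝ ((Fin m → ℝ) × ℝ)) :=
    (fun P => PointedCone.hull ℝ (u '' Q P)) '' {P | P ∈ T ∧ P.Nonempty}
  let height : Module.Dual ℝ ((Fin m → ℝ) × ℝ) := -LinearMap.snd ℝ _ _
  let coord (N : PointedCone ℝ ((Fin m → ℝ) × ℝ)) (k : Fin (d + 2)) :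
    Module.Dual ℝ ((Fin m → ℝ) × ℝ) := LinearMap.proj k ∘ₗ consZero (d + 1) ∘ₗ A N
  obtain ⟨L, hL, hLneg, hML, hLD⟩ := exists_arrangement (D := D ∪ D')
    (M := {height} ∪ ⋃ N ∈ D, range fun kl : Fin (d + 2) × Fin (d + 2) =>
      coord N kl.2 - coord N kl.1)
    (hD.union ((hT.subset fun P hP => hP.1).image _)) (by
      rintro N (hN | ⟨P, ⟨hP, -⟩, rfl⟩)
      · exact hDfg N hN
      · exact ⟨_, (hQ P hP).image _, rfl⟩)
    ((finite_singleton _).union (hD.biUnion fun N _ => finite_range _))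
  have hC : ∀ y ∈ C, ∀ z, signPattern L y ⊆ signPattern L z → z ∈ C := by
    rintro y ⟨t, ht, x, hx, rfl⟩ z hyz
    obtain ⟨P, hP, hxP⟩ := hKT.subset hx
    have hPc := hcone P hP ⟨x, hxP⟩
    obtain ⟨s, hs, x', hx', rfl⟩ : z ∈ coneOver u P := by
      rw [hPc]
      refine hLD _ (Or.inr ⟨P, ⟨hP, x, hxP⟩, rfl⟩) _ ?_ z hyz
      exact hPc.subset ⟨t, ht, x, hxP, rfl⟩
    exact ⟨s, hs, x', hKT.superset ⟨P, hP, hx'⟩, rfl⟩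
  have hG : ∀ y ∈ C, ∃ B : (Fin m → ℝ) × ℝ →ₗ[ℝ] Fin (d + 2) → ℝ,
      ∀ z, signPattern L y ⊆ signPattern L z → toOrthantBoundary (H z) = B z := by
    intro y hy
    obtain ⟨N, hN, hyN⟩ := hDC y hy
    obtain ⟨k, hk⟩ := Finite.exists_min fun k => coord N k y
    refine ⟨LinearMap.pi fun l => coord N l - coord N k, fun z hyz => ?_⟩
    have hzN := hLD N (Or.inl hN) y hyN z hyz
    have hkz : ∀ l, coord N k z ≤ coord N l z := by
      intro l
      have hl : coord N l - coord N k ∈ L := hML (Or.inr (mem_biUnion hN ⟨(k, l), rfl⟩))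
      exact sub_nonneg.1 (hyz ⟨hl, sub_nonneg.2 (hk l)⟩).2
    funext l
    rw [hA N hN z (hC y hy z hyz) hzN, toOrthantBoundary_of_le hkz]
    rfl
  obtain ⟨f, hf, hfinj, hfK⟩ := exists_isPLOn_injOn_of_linear_on_cells hL hLneg
    (hML (Or.inl rfl)) (K := K) (u := u) (fun x y hxy => congrArg Prod.fst hxy)
    (fun x => by simp [height, hu, apexDirection_apply]) hC
    (G := fun y => toOrthantBoundary (H y)) hG
    (toOrthantBoundary_injective.comp_injOn hHinj) (fun y _ => toOrthantBoundary_nonneg _)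
    (fun y _ => exists_toOrthantBoundary_eq_zero _)
  exact ⟨f, hf, hfinj, image_subset_iff.2 hfK⟩
end
end
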